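/- Let f be a 2π-periodic complex-valued continuous function on ℝ. Then for almost every x ∈ ℝ (with respect to Lebesgue measure), the partial Fourier sums converge: lim_{N→∞} S_N f(x) = f(x). -/

import Mathlib

open MeasureTheory Filter
open scoped Real

/-- The `N`-th partial Fourier sum of a `2π`-periodic function `f`,
`S_N f(x) = ∑_{n=-N}^{N} f̂_n e^{inx}` with `f̂_n = (1/2π) ∫₀^{2π} f(y) e^{-iny} dy`. -/
noncomputable def partialFourierSum (N : ℕ) (f : ℝ → ℂ) (x : ℝ) : ℂ :=
  ∑ n ∈ Finset.Icc (-(N : ℤ)) (N : ℤ),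
    ((((2 * π)⁻¹ : ℝ) : ℂ) *
        ∫ y in (0 : ℝ)..(2 * π), f y * Complex.exp (-(Complex.I * (n : ℂ) * (y : ℂ)))) *
      Complex.exp (Complex.I * (n : ℂ) * (x : ℂ))

namespace Carl
open Finset

/-- circle distance on integers mod 16^n -/
noncomputable def cd (n x y : ℕ) : ℝ := ‖(((x:ℝ) - (y:ℝ) : ℝ) : AddCircle ((16:ℝ)^n))‖

/-- length at scale K -/
def LN (n K : ℕ) : ℕ := 16^(n-K)
/-- length at scale K (real) -/
noncomputable def LL (n K : ℕ) : ℝ := (16:ℝ)^(n-K)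
/-- weight -/
noncomputable def W (n K x y : ℕ) : ℝ := LL n K / (LL n K + cd n x y)

lemma LN_cast (n K : ℕ) : ((LN n K : ℕ) : ℝ) = LL n K := by simp [LN, LL]
lemma LN_pos (n K : ℕ) : 0 < LN n K := by unfold LN; positivity
lemma LL_pos (n K : ℕ) : 0 < LL n K := by unfold LL; positivity
lemma one_le_LL (n K : ℕ) : 1 ≤ LL n K := one_le_pow₀ (by norm_num)
lemma LL_anti {n K K' : ℕ} (h : K ≤ K') : LL n K' ≤ LL n K :=
  pow_le_pow_right₀ (by norm_num) (by omega)

lemma cd_nonneg (n x y : ℕ) : 0 ≤ cd n x y := norm_nonneg _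
lemma cd_self (n x : ℕ) : cd n x x = 0 := by simp [cd]
lemma cd_comm (n x y : ℕ) : cd n x y = cd n y x := by
  unfold cd
  rw [← norm_neg, ← AddCircle.coe_neg, neg_sub]
lemma cd_tri (n x y z : ℕ) : cd n x z ≤ cd n x y + cd n y z := by
  unfold cd
  have : ((x:ℝ) - z) = (x - y) + (y - z) := by ring
  rw [this, AddCircle.coe_add]
  exact norm_add_le _ _
lemma cd_le_abs (n x y : ℕ) : cd n x y ≤ |(x:ℝ) - y| := by
  exact QuotientAddGroup.norm_mk_le_norm

/-- lower representation: distance is |x-y+jM| for some j in -1,0,1 -/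
lemma cd_rep {n x y : ℕ} (hx : x < 16^n) (hy : y < 16^n) :
    ∃ j : ℤ, (j = -1 ∨ j = 0 ∨ j = 1) ∧
      cd n x y = |(((x:ℤ) - y + j * 16^n : ℤ) : ℝ)| := by
  have hM : (0:ℝ) < 16^n := by positivity
  have hx' : (x:ℝ) < 16^n := by exact_mod_cast hx
  have hy' : (y:ℝ) < 16^n := by exact_mod_cast hy
  have h0 : (0:ℝ) ≤ x := by positivity
  have h1 : (0:ℝ) ≤ y := by positivity
  refine ⟨-round (((16:ℝ)^n)⁻¹ * ((x:ℝ)-y)), ?_, ?_⟩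
  · have hb : |((16:ℝ)^n)⁻¹ * ((x:ℝ)-y)| < 1 := by
      rw [abs_mul, abs_of_pos (by positivity : (0:ℝ) < ((16:ℝ)^n)⁻¹), inv_mul_lt_iff₀ hM, mul_one,
        abs_lt]
      constructor <;> linarith
    have hr := abs_sub_round (((16:ℝ)^n)⁻¹ * ((x:ℝ)-y))
    rw [abs_lt] at hb
    rw [abs_le] at hr
    have u1 : ((round (((16:ℝ)^n)⁻¹ * ((x:ℝ)-y)) : ℤ) : ℝ) < 2 := by linarith [hb.2]
    have u2 : (-2:ℝ) < ((round (((16:ℝ)^n)⁻¹ * ((x:ℝ)-y)) : ℤ) : ℝ) := by linarith [hb.1]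
    have v1 : round (((16:ℝ)^n)⁻¹ * ((x:ℝ)-y)) < 2 := by exact_mod_cast u1
    have v2 : -2 < round (((16:ℝ)^n)⁻¹ * ((x:ℝ)-y)) := by exact_mod_cast u2
    omega
  · unfold cd
    rw [AddCircle.norm_eq]
    congr 1
    push_cast
    ring

lemma W_pos (n K x y : ℕ) : 0 < W n K x y :=
  div_pos (LL_pos n K) (by linarith [LL_pos n K, cd_nonneg n x y])
lemma W_le_one (n K x y : ℕ) : W n K x y ≤ 1 := by
  unfold W
  rw [div_le_one (by linarith [LL_pos n K, cd_nonneg n x y])]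
  linarith [cd_nonneg n x y]
lemma W_comm (n K x y : ℕ) : W n K x y = W n K y x := by simp only [W, cd_comm n x y]
lemma W_self (n K x : ℕ) : W n K x x = 1 := by
  unfold W; rw [cd_self, add_zero, div_self (LL_pos n K).ne']

lemma W_le_of_cd {n K x y x' y' : ℕ} (h : cd n x' y' ≤ cd n x y) : W n K x y ≤ W n K x' y' := by
  unfold W
  have := LL_pos n K
  have := cd_nonneg n x' y'
  gcongr

lemma W_anti {n K K' : ℕ} (h : K ≤ K') (x y : ℕ) : W n K' x y ≤ W n K x y := by
  unfold W
  have h1 := LL_pos n K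
  have h2 := LL_pos n K'
  have h3 := cd_nonneg n x y
  have h4 : LL n K' ≤ LL n K := LL_anti h
  rw [div_le_div_iff₀ (by linarith) (by linarith)]
  nlinarith

lemma W_mul_le {n J K : ℕ} (h : J ≤ K) (x y z : ℕ) : W n K x y * W n J y z ≤ W n J x z := by
  refine (mul_le_mul_of_nonneg_right (W_anti h x y) (W_pos _ _ _ _).le).trans ?_
  unfold W
  have h1 := LL_pos n J
  have h2 := cd_nonneg n x y
  have h3 := cd_nonneg n y z
  have h4 := cd_tri n x y z
  have h5 := cd_nonneg n x z
  rw [div_mul_div_comm, div_le_div_iff₀ (by positivity) (by positivity)]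
  have : LL n J * (LL n J + cd n x z) ≤ (LL n J + cd n x y) * (LL n J + cd n y z) := by nlinarith [mul_nonneg h2 h3]
  nlinarith

lemma sum_int_aux (L : ℝ) (hL : 1 ≤ L) (R : ℕ) :
    ∑ a ∈ Finset.Icc (-(R:ℤ)) R, (L/(L+|(a:ℝ)|))^2 ≤ 1 + 2*(L - L^2/(L+R)) := by
  induction R with
  | zero =>
    simp
    rw [div_self (by linarith)]
    have : L^2/L = L := by field_simp
    rw [this]; norm_num
  | succ R ih =>
    have e : Finset.Icc (-((R+1:ℕ):ℤ)) ((R+1:ℕ):ℤ) = insert (-((R+1:ℕ):ℤ)) (insert ((R+1:ℕ):ℤ) (Finset.Icc (-(R:ℤ)) R)) := by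
      ext a; simp only [Finset.mem_Icc, Finset.mem_insert]; omega
    rw [e, Finset.sum_insert (by simp only [Finset.mem_Icc, Finset.mem_insert]; omega),
      Finset.sum_insert (by simp only [Finset.mem_Icc]; omega)]
    have hR : (0:ℝ) ≤ R := by positivity
    have a1 : |((-((R+1:ℕ):ℤ) : ℤ):ℝ)| = R+1 := by
      push_cast; rw [abs_neg, abs_of_nonneg (by positivity)]
    have a2 : |((((R+1:ℕ):ℤ) : ℤ):ℝ)| = R+1 := by
      push_cast; rw [abs_of_nonneg (by positivity)]
    rw [a1, a2]
    have key : (L/(L+(R+1)))^2 ≤ L^2/(L+R) - L^2/(L+(R+1)) := by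
      have p1 : 0 < L + R := by linarith
      have p2 : 0 < L + (R+1) := by linarith
      rw [div_pow, div_sub_div _ _ p1.ne' p2.ne', div_le_div_iff₀ (by positivity) (by positivity)]
      have : 0 ≤ L^2 * (L+(R+1)) := by positivity
      nlinarith
    push_cast
    linarith

lemma sum_int (L : ℝ) (hL : 1 ≤ L) (S : Finset ℤ) :
    ∑ a ∈ S, (L/(L+|(a:ℝ)|))^2 ≤ 3*L := by
  obtain ⟨R, hR⟩ : ∃ R : ℕ, S ⊆ Finset.Icc (-(R:ℤ)) R := by
    refine ⟨S.sup Int.natAbs, fun a ha => ?_⟩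
    have : a.natAbs ≤ S.sup Int.natAbs := Finset.le_sup (f := Int.natAbs) ha
    simp only [Finset.mem_Icc]; omega
  refine (Finset.sum_le_sum_of_subset_of_nonneg hR fun a _ _ => by positivity).trans ?_
  refine (sum_int_aux L hL R).trans ?_
  have : 0 ≤ L^2/(L+R) := by positivity
  linarith

lemma W_sum {n K x : ℕ} (hx : x < 16^n) :
    ∑ y ∈ range (16^n), (W n K x y)^2 ≤ 9 * LL n K := by
  have hL := one_le_LL n K
  have h1 : ∀ y ∈ range (16^n), (W n K x y)^2 ≤
      ∑ j ∈ ({-1,0,1} : Finset ℤ), (LL n K/(LL n K+|(((x:ℤ) - y + j * 16^n : ℤ) : ℝ)|))^2 := by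
    intro y hy
    obtain ⟨j, hj, e⟩ := cd_rep hx (Finset.mem_range.1 hy)
    unfold W
    rw [e]
    exact Finset.single_le_sum (f := fun j : ℤ => (LL n K/(LL n K+|(((x:ℤ) - y + j * 16^n : ℤ) : ℝ)|))^2)
      (fun _ _ => by positivity) (by simp; tauto)
  refine (Finset.sum_le_sum h1).trans ?_
  rw [Finset.sum_comm]
  have h2 : ∀ j ∈ ({-1,0,1} : Finset ℤ), ∑ y ∈ range (16^n), (LL n K/(LL n K+|(((x:ℤ) - y + j * 16^n : ℤ) : ℝ)|))^2 ≤ 3 * LL n K := by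
    intro j _
    rw [← Finset.sum_image (s := range (16^n)) (g := fun y : ℕ => ((x:ℤ) - y + j * 16^n : ℤ)) (f := fun a : ℤ => (LL n K/(LL n K+|(a:ℝ)|))^2)
      (by intro a _ b _ h; simp at h; exact h)]
    exact sum_int _ hL _
  refine (Finset.sum_le_sum h2).trans ?_
  simp
  linarith

lemma W_sum' {n K x : ℕ} (hx : x < 16^n) :
    ∑ y ∈ range (16^n), (W n K y x)^2 ≤ 9 * LL n K := by
  simp_rw [W_comm n K _ x]; exact W_sum hx

/-- in the same interval -/
lemma cd_lt_of_div {n K x x' : ℕ} (h : x / LN n K = x' / LN n K) : cd n x x' < LL n K := by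
  refine (cd_le_abs n x x').trans_lt ?_
  rw [← LN_cast]
  have h1 := Nat.div_add_mod x (LN n K)
  have h2 := Nat.div_add_mod x' (LN n K)
  have h3 := Nat.mod_lt x (LN_pos n K)
  have h4 := Nat.mod_lt x' (LN_pos n K)
  rw [h] at h1
  have h5 : (x:ℤ) - x' < LN n K := by omega
  have h6 : -(LN n K : ℤ) < (x:ℤ) - x' := by omega
  rw [abs_lt]
  constructor
  · have : ((-(LN n K : ℤ) : ℤ):ℝ) < (((x:ℤ) - x' : ℤ):ℝ) := by exact_mod_cast h6
    push_cast at this; linarith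
  · have : (((x:ℤ) - x' : ℤ):ℝ) < (((LN n K : ℤ) : ℤ):ℝ) := by exact_mod_cast h5
    push_cast at this; linarith

lemma W_half_of_cd {n K x y : ℕ} (h : cd n x y ≤ LL n K) : 1/2 ≤ W n K x y := by
  unfold W
  have := LL_pos n K
  have := cd_nonneg n x y
  rw [div_le_div_iff₀ (by norm_num) (by linarith)]
  linarith

lemma W_half {n K x x' : ℕ} (h : x / LN n K = x' / LN n K) : 1/2 ≤ W n K x x' :=
  W_half_of_cd (cd_lt_of_div h).le

lemma W_le_two {n J K x x' : ℕ} (hJ : J ≤ K) (h : x / LN n K = x' / LN n K) (y : ℕ) :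
    W n J x y ≤ 2 * W n J x' y := by
  have h1 := W_mul_le (n := n) hJ x' x y
  have h2 := W_half (n := n) h.symm
  have := W_pos n J x y
  nlinarith

lemma LN_mul {n K : ℕ} (h : K ≤ n) : 16^K * LN n K = 16^n := by
  unfold LN; rw [← pow_add]; congr 1; omega
lemma LN_mul_LN {n k K : ℕ} (h : k ≤ K) (h' : K ≤ n) : 16^(K-k) * LN n K = LN n k := by
  unfold LN; rw [← pow_add]; congr 1; omega

lemma nest_time {n k K x x' : ℕ} (h : k ≤ K) (h' : K ≤ n) (e : x / LN n K = x' / LN n K) :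
    x / LN n k = x' / LN n k := by
  rw [← LN_mul_LN h h', mul_comm, ← Nat.div_div_eq_div_mul, ← Nat.div_div_eq_div_mul, e]

lemma nest_freq {k K x x' : ℕ} (h : k ≤ K) (e : x / 16^k = x' / 16^k) :
    x / 16^K = x' / 16^K := by
  have : 16^K = 16^k * 16^(K-k) := by rw [← pow_add]; congr 1; omega
  rw [this, ← Nat.div_div_eq_div_mul, ← Nat.div_div_eq_div_mul, e]

lemma mul_LN_div (n K i : ℕ) : i * LN n K / LN n K = i := Nat.mul_div_cancel _ (LN_pos n K)

/-- sums over the points of an interval -/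
lemma card_block {n K i : ℕ} (hK : K ≤ n) (hi : i < 16^K) :
    ((range (16^n)).filter (fun y => y / LN n K = i)).card = LN n K := by
  have : (range (16^n)).filter (fun y => y / LN n K = i) = Finset.Ico (i * LN n K) ((i+1) * LN n K) := by
    ext y
    simp only [mem_filter, mem_range, Finset.mem_Ico]
    rw [Nat.div_eq_iff (LN_pos n K)]
    have h1 : (i+1) * LN n K ≤ 16^n := by
      rw [← LN_mul hK]; exact Nat.mul_le_mul_right _ hi
    have := LN_pos n K
    constructor
    · rintro ⟨_, h2, h3⟩
      refine ⟨h2, ?_⟩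
      rw [add_mul, one_mul]
      omega
    · rintro ⟨h2, h3⟩
      refine ⟨by omega, h2, ?_⟩
      rw [add_mul, one_mul] at h3
      omega
  rw [this, Nat.card_Ico, add_mul]; simp

lemma div_lt_of {n K y : ℕ} (hK : K ≤ n) (hy : y < 16^n) : y / LN n K < 16^K := by
  rw [Nat.div_lt_iff_lt_mul (LN_pos n K), LN_mul hK]; exact hy

lemma mul_LN_lt {n K i : ℕ} (hK : K ≤ n) (hi : i < 16^K) : i * LN n K < 16^n := by
  rw [← LN_mul hK]; exact Nat.mul_lt_mul_of_pos_right hi (LN_pos n K)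

/-- comparison of sum over grid points with sum over all points -/
lemma grid_sum {n K : ℕ} (hK : K ≤ n) (S : Finset ℕ) (hS : ∀ i ∈ S, i < 16^K) (F G : ℕ → ℝ)
    (hFG : ∀ i ∈ S, ∀ y < 16^n, y / LN n K = i → F i ≤ G y) :
    LL n K * ∑ i ∈ S, F i ≤ ∑ y ∈ (range (16^n)).filter (fun y => y / LN n K ∈ S), G y := by
  rw [← Finset.sum_fiberwise_of_maps_to (s := (range (16^n)).filter (fun y => y / LN n K ∈ S)) (t := S) (g := fun y => y / LN n K)
    (fun y hy => (mem_filter.1 hy).2), Finset.mul_sum]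
  refine Finset.sum_le_sum fun i hi => ?_
  have e : (((range (16^n)).filter (fun y => y / LN n K ∈ S)).filter (fun y => y / LN n K = i)) = (range (16^n)).filter (fun y => y / LN n K = i) := by
    ext y; simp only [mem_filter, mem_range]
    constructor
    · rintro ⟨⟨a, _⟩, c⟩; exact ⟨a, c⟩
    · rintro ⟨a, c⟩; exact ⟨⟨a, c ▸ hi⟩, c⟩
  rw [e]
  have := Finset.card_nsmul_le_sum ((range (16^n)).filter (fun y => y / LN n K = i)) G (F i)
    (fun y hy => by rw [mem_filter, mem_range] at hy; exact hFG i hi y hy.1 hy.2)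
  rw [card_block hK (hS i hi), nsmul_eq_mul, LN_cast] at this
  exact this

lemma W5 {n J K x : ℕ} (hJ : J ≤ K) (hK : K ≤ n) (hx : x < 16^n) :
    LL n K * ∑ i ∈ range (16^K), (W n J x (i * LN n K))^2 ≤ 36 * LL n J := by
  refine (grid_sum hK (range (16^K)) (by simp) _ (fun y => 4 * (W n J x y)^2) ?_).trans ?_
  · intro i hi y hy e
    have h := W_le_two (n := n) (x := i * LN n K) (x' := y) hJ (by rw [mul_LN_div, e]) x
    rw [W_comm n J _ x, W_comm n J _ x] at h
    have := W_pos n J x (i * LN n K)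
    nlinarith
  · refine (Finset.sum_le_sum_of_subset_of_nonneg (filter_subset _ _) fun _ _ _ => by positivity).trans ?_
    rw [← Finset.mul_sum]
    linarith [W_sum (n := n) (K := J) hx]

lemma W7 {n J K x z : ℕ} (h : J ≤ K) (hx : x < 16^n) (hz : z < 16^n) :
    ∑ y ∈ range (16^n), (W n K x y)^2 * (W n J y z)^2 ≤ 200 * LL n K * (W n J x z)^2 := by
  have hLK := LL_pos n K
  have hLJ := LL_pos n J
  have hl : LL n K ≤ LL n J := LL_anti h
  have key : ∀ y ∈ range (16^n), (W n K x y)^2 * (W n J y z)^2 ≤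
      4 * (W n J x z)^2 * (W n K x y)^2 + 16 * (LL n K / LL n J)^2 * (W n J x z)^2 * (W n J y z)^2 := by
    intro y _
    have a1 := cd_nonneg n x y
    have a2 := cd_nonneg n y z
    have a3 := cd_nonneg n x z
    have a4 := cd_tri n x y z
    have p1 := W_pos n K x y
    have p2 := W_pos n J y z
    have p3 := W_pos n J x z
    have q2 := W_le_one n J y z
    by_cases c : W n J y z ≤ 2 * W n J x z
    · have : (W n J y z)^2 ≤ 4 * (W n J x z)^2 := by nlinarith
      have t : 0 ≤ 16 * (LL n K / LL n J)^2 * (W n J x z)^2 * (W n J y z)^2 := by positivity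
      nlinarith [sq_nonneg (W n K x y)]
    · have c1 : cd n y z < cd n x z / 2 := by
        by_contra hc
        push Not at hc
        apply c
        unfold W
        rw [mul_div_assoc', div_le_div_iff₀ (by linarith) (by linarith)]
        nlinarith
      have c2 : LL n J ≤ cd n x z := by
        by_contra hc
        push Not at hc
        apply c
        have := W_half_of_cd hc.le
        linarith
      have c3 : W n K x y ≤ 4 * (LL n K / LL n J) * W n J x z := by
        unfold W
        rw [show 4 * (LL n K / LL n J) * (LL n J / (LL n J + cd n x z)) = 4 * LL n K / (LL n J + cd n x z) by field_simp]
        rw [div_le_div_iff₀ (by linarith) (by linarith)]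
        nlinarith
      have c4 : (W n K x y)^2 ≤ (4 * (LL n K / LL n J) * W n J x z)^2 := by gcongr
      have t : 0 ≤ 4 * (W n J x z)^2 * (W n K x y)^2 := by positivity
      nlinarith [mul_le_mul_of_nonneg_right c4 (sq_nonneg (W n J y z))]
  refine (Finset.sum_le_sum key).trans ?_
  rw [Finset.sum_add_distrib, ← Finset.mul_sum, ← Finset.mul_sum]
  have s1 := W_sum (n := n) (K := K) hx
  have s2 := W_sum' (n := n) (K := J) hz
  have t1 : 4 * (W n J x z)^2 * ∑ y ∈ range (16^n), (W n K x y)^2 ≤ 4 * (W n J x z)^2 * (9 * LL n K) := by gcongr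
  have t2 : 16 * (LL n K / LL n J)^2 * (W n J x z)^2 * ∑ y ∈ range (16^n), (W n J y z)^2 ≤ 16 * (LL n K / LL n J)^2 * (W n J x z)^2 * (9 * LL n J) := by gcongr
  have t3 : (LL n K / LL n J)^2 * LL n J ≤ LL n K := by
    rw [div_pow, div_mul_eq_mul_div, div_le_iff₀ (by positivity)]
    nlinarith [mul_pos hLK hLJ]
  nlinarith [sq_nonneg (W n J x z), mul_le_mul_of_nonneg_right t3 (sq_nonneg (W n J x z))]

/-- W6: interaction of an interval and its complement -/
lemma cd_cross {n a b x y : ℕ} (ha : a ≤ y) (hb : y ≤ b) (hbM : b < 16^n) (hx : x < 16^n) (hxa : x < a ∨ b < x) :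
    cd n y a ≤ cd n y x ∨ cd n y b ≤ cd n y x := by
  obtain ⟨j, hj, e⟩ := cd_rep (n := n) (x := y) (y := x) (by omega) hx
  have h1 := cd_le_abs n y a
  have h2 := cd_le_abs n y b
  rw [e]
  have A1 : |(y:ℝ) - a| = (((y:ℤ) - a : ℤ):ℝ) := by
    push_cast; apply abs_of_nonneg
    have : (a:ℝ) ≤ y := by exact_mod_cast ha
    linarith
  have A2 : |(y:ℝ) - b| = (((b:ℤ) - y : ℤ):ℝ) := by
    push_cast
    rw [abs_sub_comm]; apply abs_of_nonneg
    have : (y:ℝ) ≤ b := by exact_mod_cast hb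
    linarith
  rw [A1] at h1
  rw [A2] at h2
  have hbM' : (b:ℤ) < 16^n := by exact_mod_cast hbM
  have hxM' : (x:ℤ) < 16^n := by exact_mod_cast hx
  rw [← Int.cast_abs]
  suffices (y:ℤ) - a ≤ |(y:ℤ) - x + j * 16^n| ∨ (b:ℤ) - y ≤ |(y:ℤ) - x + j * 16^n| by
    rcases this with h | h
    · left; refine h1.trans ?_; exact_mod_cast h
    · right; refine h2.trans ?_; exact_mod_cast h
  generalize (16:ℤ)^n = M at *
  have := le_abs_self ((y:ℤ) - x + j * M)
  have := neg_le_abs ((y:ℤ) - x + j * M)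
  rcases hj with rfl | rfl | rfl <;> rcases hxa with h | h <;> omega

lemma W6 {n k i K : ℕ} (hk : k ≤ n) (hi : i < 16^k) :
    ∑ y ∈ (range (16^n)).filter (fun y => y / LN n k = i),
      ∑ x ∈ (range (16^n)).filter (fun x => x / LN n k ≠ i), (W n K y x)^4 ≤ 162 * (LL n K)^2 := by
  set a := i * LN n k
  set b := i * LN n k + (LN n k - 1)
  have hLp := LN_pos n k
  have hbM : b < 16^n := by
    have : (i+1) * LN n k ≤ 16^n := by
      rw [← LN_mul hk]; exact Nat.mul_le_mul_right _ hi
    rw [add_mul, one_mul] at this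
    simp only [b]; omega
  have haM : a < 16^n := mul_LN_lt hk hi
  have hI : ∀ y, y / LN n k = i ↔ a ≤ y ∧ y ≤ b := by
    intro y
    rw [Nat.div_eq_iff hLp]
    simp only [a, b]
    constructor <;> rintro ⟨h1, h2⟩ <;> constructor <;> omega
  have key : ∀ y ∈ (range (16^n)).filter (fun y => y / LN n k = i),
      ∑ x ∈ (range (16^n)).filter (fun x => x / LN n k ≠ i), (W n K y x)^4 ≤
       9 * LL n K * ((W n K y a)^2 + (W n K y b)^2) := by
    intro y hy
    rw [mem_filter, mem_range, hI] at hy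
    have : ∀ x ∈ (range (16^n)).filter (fun x => x / LN n k ≠ i), (W n K y x)^4 ≤
        ((W n K y a)^2 + (W n K y b)^2) * (W n K y x)^2 := by
      intro x hx
      rw [mem_filter, mem_range, ne_eq, hI] at hx
      have c := cd_cross (n := n) hy.2.1 hy.2.2 hbM hx.1 (by omega)
      have p := W_pos n K y x
      have : (W n K y x)^2 ≤ (W n K y a)^2 + (W n K y b)^2 := by
        rcases c with c | c
        · have := W_le_of_cd (K := K) c
          nlinarith [sq_nonneg (W n K y b)]
        · have := W_le_of_cd (K := K) c
          nlinarith [sq_nonneg (W n K y a)]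
      nlinarith [sq_nonneg (W n K y x)]
    refine (Finset.sum_le_sum this).trans ?_
    rw [← Finset.mul_sum, mul_comm]
    gcongr
    exact (Finset.sum_le_sum_of_subset_of_nonneg (filter_subset _ _) fun _ _ _ => by positivity).trans (W_sum hy.1)
  refine (Finset.sum_le_sum key).trans ?_
  rw [← Finset.mul_sum, Finset.sum_add_distrib]
  have h1 : ∑ y ∈ (range (16^n)).filter (fun y => y / LN n k = i), (W n K y a)^2 ≤ 9 * LL n K :=
    (Finset.sum_le_sum_of_subset_of_nonneg (filter_subset _ _) fun _ _ _ => by positivity).trans (W_sum' haM)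
  have h2 : ∑ y ∈ (range (16^n)).filter (fun y => y / LN n k = i), (W n K y b)^2 ≤ 9 * LL n K :=
    (Finset.sum_le_sum_of_subset_of_nonneg (filter_subset _ _) fun _ _ _ => by positivity).trans (W_sum' hbM)
  have := LL_pos n K
  nlinarith

end Carl

namespace Carl
open Finset

lemma max_step {S : Finset ℕ} {t : ℕ → ℕ → ℝ} (ht : ∀ x y, 0 ≤ t x y) {c : ℝ} (hc : 0 < c)
    (h : ∀ x ∈ S, ∀ x' ∈ S, ∑ y ∈ S, t x y * t x' y ≤ c * (t x x' + t x' x))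
    {a : ℝ} (ha : 0 ≤ a)
    (hv : ∀ u : ℕ → ℝ, (∀ y, 0 ≤ u y) → ∑ x ∈ S, (∑ y ∈ S, t x y * u y)^2 ≤ a * ∑ y ∈ S, (u y)^2) :
    ∀ u : ℕ → ℝ, (∀ y, 0 ≤ u y) →
      ∑ x ∈ S, (∑ y ∈ S, t x y * u y)^2 ≤ (2 * c * √a) * ∑ y ∈ S, (u y)^2 := by
  have hs : ∀ v : ℕ → ℝ, (∀ y, 0 ≤ v y) →
      ∑ y ∈ S, (∑ x ∈ S, t x y * v x)^2 ≤ (2 * c * √a) * ∑ y ∈ S, (v y)^2 := by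
    intro v hv0
    have e1 : ∑ y ∈ S, (∑ x ∈ S, t x y * v x)^2 =
        ∑ x ∈ S, ∑ x' ∈ S, v x * v x' * ∑ y ∈ S, t x y * t x' y := by
      simp_rw [sq, Finset.sum_mul_sum, Finset.mul_sum]
      rw [Finset.sum_comm]
      refine Finset.sum_congr rfl fun x _ => ?_
      rw [Finset.sum_comm]
      refine Finset.sum_congr rfl fun x' _ => Finset.sum_congr rfl fun y _ => by ring
    have e2 : ∑ x ∈ S, ∑ x' ∈ S, v x * v x' * ∑ y ∈ S, t x y * t x' y ≤
        ∑ x ∈ S, ∑ x' ∈ S, v x * v x' * (c * (t x x' + t x' x)) := by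
      refine Finset.sum_le_sum fun x hx => Finset.sum_le_sum fun x' hx' => ?_
      exact mul_le_mul_of_nonneg_left (h x hx x' hx') (mul_nonneg (hv0 x) (hv0 x'))
    have e3 : ∑ x ∈ S, ∑ x' ∈ S, v x * v x' * (c * (t x x' + t x' x)) =
        2 * c * ∑ x ∈ S, v x * ∑ x' ∈ S, t x x' * v x' := by
      have : ∑ x ∈ S, ∑ x' ∈ S, v x * v x' * (c * (t x x' + t x' x)) =
        c * (∑ x ∈ S, ∑ x' ∈ S, v x * (t x x' * v x')) + c * (∑ x ∈ S, ∑ x' ∈ S, v x' * (t x' x * v x)) := by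
        simp_rw [Finset.mul_sum, ← Finset.sum_add_distrib]
        refine Finset.sum_congr rfl fun x _ => Finset.sum_congr rfl fun y _ => by ring
      rw [this, Finset.sum_comm (f := fun x x' => v x' * (t x' x * v x))]
      simp_rw [Finset.mul_sum]
      rw [← Finset.sum_add_distrib]
      refine Finset.sum_congr rfl fun x _ => ?_
      rw [← Finset.sum_add_distrib]
      refine Finset.sum_congr rfl fun y _ => by ring
    have e4 : ∑ x ∈ S, v x * ∑ x' ∈ S, t x x' * v x' ≤ √a * ∑ y ∈ S, (v y)^2 := by
      have cs := Finset.sum_mul_sq_le_sq_mul_sq S v (fun x => ∑ x' ∈ S, t x x' * v x')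
      have hq : 0 ≤ ∑ y ∈ S, (v y)^2 := Finset.sum_nonneg fun _ _ => sq_nonneg _
      refine le_of_sq_le_sq ?_ (by positivity)
      rw [mul_pow, Real.sq_sqrt ha]
      nlinarith [mul_le_mul_of_nonneg_left (hv v hv0) hq]
    rw [e1]
    refine e2.trans ?_
    rw [e3, mul_assoc (2 * c)]
    exact mul_le_mul_of_nonneg_left e4 (by positivity)
  intro u hu
  set P := ∑ x ∈ S, (∑ y ∈ S, t x y * u y)^2 with hP
  have hP0 : 0 ≤ P := Finset.sum_nonneg fun _ _ => sq_nonneg _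
  have f1 : P = ∑ y ∈ S, u y * ∑ x ∈ S, t x y * (∑ y' ∈ S, t x y' * u y') := by
    rw [hP]
    simp_rw [sq]
    conv_lhs => enter [2, x]; rw [Finset.sum_mul]
    rw [Finset.sum_comm]
    refine Finset.sum_congr rfl fun y _ => ?_
    rw [Finset.mul_sum]
    refine Finset.sum_congr rfl fun x _ => by ring
  have cs := Finset.sum_mul_sq_le_sq_mul_sq S u (fun y => ∑ x ∈ S, t x y * (∑ y' ∈ S, t x y' * u y'))
  rw [← f1] at cs
  have g := hs (fun x => ∑ y' ∈ S, t x y' * u y') (fun x => Finset.sum_nonneg fun y _ => mul_nonneg (ht _ _) (hu _))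
  rw [← hP] at g
  have hq : 0 ≤ ∑ y ∈ S, (u y)^2 := Finset.sum_nonneg fun _ _ => sq_nonneg _
  have g2 := cs.trans (mul_le_mul_of_nonneg_left g hq)
  rcases hP0.eq_or_lt with h0 | h0
  · rw [← h0]; positivity
  · nlinarith

lemma max_abs {S : Finset ℕ} {t : ℕ → ℕ → ℝ} (ht : ∀ x y, 0 ≤ t x y) {c : ℝ} (hc : 0 < c)
    (h : ∀ x ∈ S, ∀ x' ∈ S, ∑ y ∈ S, t x y * t x' y ≤ c * (t x x' + t x' x))
    (u : ℕ → ℝ) (hu : ∀ y, 0 ≤ u y) :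
    ∑ x ∈ S, (∑ y ∈ S, t x y * u y)^2 ≤ 4 * c^2 * ∑ y ∈ S, (u y)^2 := by
  set V : Set ℝ := {a | 0 ≤ a ∧ ∀ u : ℕ → ℝ, (∀ y, 0 ≤ u y) → ∑ x ∈ S, (∑ y ∈ S, t x y * u y)^2 ≤ a * ∑ y ∈ S, (u y)^2} with hV
  have hne : V.Nonempty := by
    refine ⟨∑ x ∈ S, ∑ y ∈ S, (t x y)^2, Finset.sum_nonneg fun _ _ => Finset.sum_nonneg fun _ _ => sq_nonneg _, ?_⟩
    intro u _
    rw [Finset.sum_mul]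
    exact Finset.sum_le_sum fun x _ => Finset.sum_mul_sq_le_sq_mul_sq _ _ _
  have hbd : BddBelow V := ⟨0, fun a ha => ha.1⟩
  have hi0 : 0 ≤ sInf V := le_csInf hne fun a ha => ha.1
  have hst : ∀ a ∈ V, sInf V ≤ 2 * c * √a := fun a ha =>
    csInf_le hbd ⟨by positivity, max_step ht hc h ha.1 ha.2⟩
  have h2 : (sInf V)^2 / (4 * c^2) ≤ sInf V := by
    refine le_csInf hne fun a ha => ?_
    rw [div_le_iff₀ (by positivity)]
    have := hst a ha
    have : (sInf V)^2 ≤ (2 * c * √a)^2 := by gcongr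
    rw [mul_pow, Real.sq_sqrt ha.1] at this
    linarith
  have h3 : sInf V ≤ 4 * c^2 := by
    rw [div_le_iff₀ (by positivity)] at h2
    by_contra hc'
    push Not at hc'
    have : 0 < sInf V := lt_of_le_of_lt (by positivity) hc'
    nlinarith
  have hq : 0 ≤ ∑ y ∈ S, (u y)^2 := Finset.sum_nonneg fun _ _ => sq_nonneg _
  rcases hq.eq_or_lt with h0 | h0
  · obtain ⟨a, ha⟩ := hne
    have := ha.2 u hu
    rw [← h0] at this ⊢
    linarith
  · have : (∑ x ∈ S, (∑ y ∈ S, t x y * u y)^2) / ∑ y ∈ S, (u y)^2 ≤ sInf V := by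
      refine le_csInf hne fun a ha => ?_
      rw [div_le_iff₀ h0]
      exact ha.2 u hu
    rw [div_le_iff₀ h0] at this
    nlinarith

lemma maximal {n : ℕ} (κ : ℕ → ℕ) (u : ℕ → ℝ) (hu : ∀ y, 0 ≤ u y) :
    ∑ x ∈ range (16^n), ((LL n (κ x))⁻¹ * ∑ y ∈ range (16^n), (W n (κ x) x y)^2 * u y)^2 ≤
      160000 * ∑ y ∈ range (16^n), (u y)^2 := by
  have := max_abs (S := range (16^n)) (t := fun x y => (LL n (κ x))⁻¹ * (W n (κ x) x y)^2)
    (fun x y => by have := LL_pos n (κ x); positivity) (c := 200) (by norm_num) ?_ u hu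
  · refine le_trans (le_of_eq ?_) (this.trans (le_of_eq (by norm_num)))
    refine Finset.sum_congr rfl fun x _ => ?_
    rw [Finset.mul_sum]
    simp_rw [mul_assoc]
  · have half : ∀ x ∈ range (16^n), ∀ x' ∈ range (16^n), κ x ≤ κ x' →
      ∑ y ∈ range (16^n), (LL n (κ x))⁻¹ * (W n (κ x) x y)^2 * ((LL n (κ x'))⁻¹ * (W n (κ x') x' y)^2) ≤
        200 * ((LL n (κ x))⁻¹ * (W n (κ x) x x')^2) := by
      intro x hx x' hx' hk
      have h7 := W7 (n := n) hk (mem_range.1 hx') (mem_range.1 hx)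
      have p1 := LL_pos n (κ x)
      have p2 := LL_pos n (κ x')
      calc _ = (LL n (κ x))⁻¹ * (LL n (κ x'))⁻¹ * ∑ y ∈ range (16^n), (W n (κ x') x' y)^2 * (W n (κ x) y x)^2 := by
            rw [Finset.mul_sum]
            refine Finset.sum_congr rfl fun y _ => ?_
            rw [W_comm n (κ x) y x]; ring
        _ ≤ (LL n (κ x))⁻¹ * (LL n (κ x'))⁻¹ * (200 * LL n (κ x') * (W n (κ x) x' x)^2) := by gcongr
        _ = _ := by rw [W_comm n (κ x) x' x]; field_simp
    intro x hx x' hx'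
    have p1 : 0 ≤ (LL n (κ x))⁻¹ * (W n (κ x) x x')^2 := by have := LL_pos n (κ x); positivity
    have p2 : 0 ≤ (LL n (κ x'))⁻¹ * (W n (κ x') x' x)^2 := by have := LL_pos n (κ x'); positivity
    rcases le_total (κ x) (κ x') with hk | hk
    · linarith [half x hx x' hx' hk]
    · have := half x' hx' x hx hk
      refine le_trans (le_of_eq ?_) (this.trans ?_)
      · refine Finset.sum_congr rfl fun y _ => by ring
      · linarith
end Carl

namespace Carl
open Finset
open scoped Classical ComplexConjugate

/-- tiles -/
structure Tile where
  /-- scale -/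
  K : ℕ
  /-- time index -/
  i : ℕ
  /-- frequency index -/
  w : ℕ

lemma Tile.ext' {p q : Tile} (h1 : p.K = q.K) (h2 : p.i = q.i) (h3 : p.w = q.w) : p = q := by
  cases p; cases q; simp_all

/-- left endpoint of the time interval -/
def Tile.y (n : ℕ) (p : Tile) : ℕ := p.i * LN n p.K

/-- valid tiles -/
def Valid (n : ℕ) (p : Tile) : Prop := 2 ≤ p.K ∧ p.K + 1 ≤ n ∧ p.i < 16^p.K

lemma Valid.y_lt {n : ℕ} {p : Tile} (h : Valid n p) : p.y n < 16^n := mul_LN_lt (by have := h.2.1; omega) h.2.2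
lemma Valid.K_le {n : ℕ} {p : Tile} (h : Valid n p) : p.K ≤ n := by have := h.2.1; omega

/-- tile under a top -/
def Under (n k i ξ : ℕ) (p : Tile) : Prop := k ≤ p.K ∧ p.y n / LN n k = i ∧ ξ / 16^p.K = p.w

lemma y_div (n : ℕ) (p : Tile) : p.y n / LN n p.K = p.i := mul_LN_div _ _ _

/-- the model data -/
structure Model (n : ℕ) (C0 : ℝ) where
  /-- frequency centers -/
  z : ℕ → ℕ → ℕ
  /-- wave packets -/
  φ : Tile → ℕ → ℂ
  /-- modified packets -/
  Θ : Tile → ℕ → ℕ → ℂ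
  /-- truncation kernels -/
  Ψ : ℕ → ℕ → ℕ → ℕ → ℂ
  hC0 : 1 ≤ C0
  hz : ∀ p, Valid n p → z p.K p.w / 16^p.K = p.w
  phi_le : ∀ p, Valid n p → ∀ x < 16^n, ‖φ p x‖ ≤ C0 * (LL n p.K)⁻¹ * (W n p.K x (p.y n))^8
  th_le : ∀ p, Valid n p → ∀ N, ∀ x < 16^n, ‖Θ p N x‖ ≤ C0 * (W n p.K x (p.y n))^8
  th_lip : ∀ p, Valid n p → ∀ N N', ∀ x < 16^n,
    ‖Θ p N x - Θ p N' x‖ ≤ C0 * (|(N:ℝ) - N'| / 16^p.K) * (W n p.K x (p.y n))^8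
  th_supp : ∀ p, Valid n p → ∀ N, ∀ x < 16^n, Θ p N x ≠ 0 →
    N / 16^p.K = p.w ∧ |(N:ℤ) - z p.K p.w| < 16^(p.K-2)
  phi_orth : ∀ p q, Valid n p → Valid n q → ∑ x ∈ range (16^n), φ p x * conj (φ q x) ≠ 0 →
    ∃ s : ℕ, s / 16^p.K = p.w ∧ s / 16^q.K = q.w ∧ s + 2 * 16^(p.K-2) ≤ z p.K p.w ∧
      s + 2 * 16^(q.K-2) ≤ z q.K q.w
  th_sq : ∀ K w ξ, 2 ≤ K → K + 1 ≤ n → ∀ b : ℕ → ℂ,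
    ∑ x ∈ range (16^n), ‖∑ i ∈ range (16^K), b i * Θ ⟨K, i, w⟩ ξ x‖^2 ≤
      C0 * LL n K * ∑ i ∈ range (16^K), ‖b i‖^2
  th_orth : ∀ p q, Valid n p → Valid n q → ∀ ξ, p.K + 3 ≤ q.K →
    ∑ x ∈ range (16^n), Θ p ξ x * conj (Θ q ξ x) = 0
  psi_le : ∀ K, K + 1 ≤ n → ∀ ξ, ∀ x < 16^n, ∀ y < 16^n, ‖Ψ K ξ x y‖ ≤ C0 * (LL n K)⁻¹ * (W n K x y)^2
  psi_id : ∀ K, K + 1 ≤ n → ∀ p, Valid n p → ∀ ξ, p.K ≤ K → ∀ x < 16^n,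
    ∑ y ∈ range (16^n), Ψ K ξ x y * Θ p ξ y = Θ p ξ x
  psi_zero : ∀ K, K + 1 ≤ n → ∀ p, Valid n p → ∀ ξ, K + 3 ≤ p.K → ∀ x < 16^n,
    ∑ y ∈ range (16^n), Ψ K ξ x y * Θ p ξ y = 0

/-- mass of a top -/
noncomputable def massTop (n : ℕ) (g : ℕ → ℂ) (N : ℕ → ℕ) (k i ξ : ℕ) : ℝ :=
  ∑ x ∈ range (16^n), if N x / 16^k = ξ / 16^k then ‖g x‖ * (W n k x (i * LN n k))^3 else 0

/-- mass bound for a set of tiles -/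
def MassLe (n : ℕ) (g : ℕ → ℂ) (N : ℕ → ℕ) (P : Finset Tile) (μ : ℝ) : Prop :=
  ∀ p ∈ P, ∀ k i ξ, Under n k i ξ p → massTop n g N k i ξ ≤ μ * LL n k

/-- lacunary condition -/
def Lac {n : ℕ} {C0 : ℝ} (D : Model n C0) (ξ : ℕ) (p : Tile) : Prop :=
  |(ξ:ℤ) - D.z p.K p.w| < 16^(p.K-2)

/-- size bound -/
def SizeLe {n : ℕ} {C0 : ℝ} (D : Model n C0) (c : Tile → ℂ) (P : Finset Tile) (σ : ℝ) : Prop :=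
  ∀ k i ξ, k ≤ n → i < 16^k →
    ∑ p ∈ P.filter (fun p => Under n k i ξ p ∧ Lac D ξ p), LL n p.K * ‖c p‖^2 ≤ σ^2 * LL n k

/-- the model form -/
noncomputable def Lam {n : ℕ} {C0 : ℝ} (D : Model n C0) (c : Tile → ℂ) (g : ℕ → ℂ) (N : ℕ → ℕ)
    (P : Finset Tile) : ℂ :=
  ∑ x ∈ range (16^n), g x * ∑ p ∈ P, c p * D.Θ p (N x) x

lemma SizeLe.coef {n : ℕ} {C0 : ℝ} {D : Model n C0} {c : Tile → ℂ} {P : Finset Tile} {σ : ℝ}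
    (h : SizeLe D c P σ) (hσ : 0 ≤ σ) (hP : ∀ p ∈ P, Valid n p) {p : Tile} (hp : p ∈ P) : ‖c p‖ ≤ σ := by
  have h1 := h p.K p.i (D.z p.K p.w) (hP p hp).K_le (hP p hp).2.2
  have h2 : LL n p.K * ‖c p‖^2 ≤ ∑ q ∈ P.filter (fun q => Under n p.K p.i (D.z p.K p.w) q ∧ Lac D (D.z p.K p.w) q), LL n q.K * ‖c q‖^2 := by
    refine Finset.single_le_sum (f := fun q : Tile => LL n q.K * ‖c q‖^2) (fun q _ => by have := LL_pos n q.K; positivity) ?_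
    rw [mem_filter]
    refine ⟨hp, ⟨le_refl _, y_div n p, D.hz p (hP p hp)⟩, ?_⟩
    unfold Lac; simp
  have h3 := h2.trans h1
  have := LL_pos n p.K
  refine le_of_sq_le_sq ?_ hσ
  nlinarith

lemma SizeLe.mono {n : ℕ} {C0 : ℝ} {D : Model n C0} {c : Tile → ℂ} {P Q : Finset Tile} {σ : ℝ}
    (h : SizeLe D c P σ) (hQ : Q ⊆ P) : SizeLe D c Q σ := by
  intro k i ξ hk hi
  refine le_trans (Finset.sum_le_sum_of_subset_of_nonneg ?_ ?_) (h k i ξ hk hi)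
  · exact filter_subset_filter _ hQ
  · intro p _ _; have := LL_pos n p.K; positivity

lemma MassLe.mono {n : ℕ} {g : ℕ → ℂ} {N : ℕ → ℕ} {P Q : Finset Tile} {μ : ℝ}
    (h : MassLe n g N P μ) (hQ : Q ⊆ P) : MassLe n g N Q μ :=
  fun p hp => h p (hQ hp)

lemma massTop_nonneg (n : ℕ) (g : ℕ → ℂ) (N : ℕ → ℕ) (k i ξ : ℕ) : 0 ≤ massTop n g N k i ξ := by
  refine Finset.sum_nonneg fun x _ => ?_
  have := W_pos n k x (i * LN n k)
  split_ifs <;> positivity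

lemma geo (n k : ℕ) : ∑ K ∈ range n, (if k ≤ K then ((1:ℝ)/16)^(K-k) else 0) ≤ 2 := by
  rw [← Finset.sum_filter]
  have : (range n).filter (fun K => k ≤ K) = Finset.Ico k n := by
    ext a; simp only [mem_filter, mem_range, Finset.mem_Ico]; omega
  rw [this, Finset.sum_Ico_eq_sum_range]
  simp only [Nat.add_sub_cancel_left]
  rw [geom_sum_eq (by norm_num)]
  have : (0:ℝ) ≤ (1/16)^(n-k) := by positivity
  rw [div_le_iff_of_neg (by norm_num)]
  linarith

/-- sum over a tree by scales -/
lemma tree_sum {n ξ : ℕ} {T : Finset Tile} (hV : ∀ p ∈ T, Valid n p) (hw : ∀ p ∈ T, ξ / 16^p.K = p.w)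
    (F : ℕ → ℕ → ℝ) (hF : ∀ K i, 0 ≤ F K i) :
    ∑ p ∈ T, F p.K p.i ≤ ∑ K ∈ range n, ∑ i ∈ range (16^K), F K i := by
  rw [Finset.sum_sigma']
  have inj : Set.InjOn (fun p : Tile => (⟨p.K, p.i⟩ : Σ _ : ℕ, ℕ)) T := by
    intro p hp q hq h
    simp only [Sigma.mk.injEq, heq_eq_eq] at h
    refine Tile.ext' h.1 h.2 ?_
    rw [← hw p hp, ← hw q hq, h.1]
  rw [← Finset.sum_image (f := fun s : Σ _ : ℕ, ℕ => F s.1 s.2) inj]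
  refine Finset.sum_le_sum_of_subset_of_nonneg ?_ fun _ _ _ => hF _ _
  intro s hs
  obtain ⟨p, hp, rfl⟩ := Finset.mem_image.1 hs
  have := hV p hp
  simp only [Finset.mem_sigma, mem_range]
  exact ⟨by have := this.2.1; omega, this.2.2⟩

lemma geo_tree {n k ξ x J : ℕ} {T : Finset Tile} (hV : ∀ p ∈ T, Valid n p) (hw : ∀ p ∈ T, ξ / 16^p.K = p.w)
    (hx : x < 16^n) (hJ : J ≤ k) :
    ∑ p ∈ T.filter (fun p => k ≤ p.K), ((1:ℝ)/16)^(p.K-k) * (LL n p.K * (W n J x (p.y n))^2) ≤ 72 * LL n J := by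
  have h := tree_sum (n := n) (ξ := ξ) hV hw
    (fun K i => if k ≤ K then ((1:ℝ)/16)^(K-k) * (LL n K * (W n J x (i * LN n K))^2) else 0)
    (fun K i => by have := LL_pos n K; split_ifs <;> positivity)
  rw [Finset.sum_filter]
  refine h.trans ?_
  have : ∀ K ∈ range n, ∑ i ∈ range (16^K), (if k ≤ K then ((1:ℝ)/16)^(K-k) * (LL n K * (W n J x (i * LN n K))^2) else 0) ≤
      (if k ≤ K then ((1:ℝ)/16)^(K-k) else 0) * (36 * LL n J) := by
    intro K hK
    rw [mem_range] at hK
    split_ifs with hkK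
    · rw [← Finset.mul_sum, ← Finset.mul_sum]
      exact mul_le_mul_of_nonneg_left (W5 (by omega) (by omega) hx) (by positivity)
    · simp
  refine (Finset.sum_le_sum this).trans ?_
  rw [← Finset.sum_mul]
  have := geo n k
  have := LL_pos n J
  nlinarith

end Carl

namespace Carl
open Finset
open scoped Classical ComplexConjugate

lemma block_sum {A : Type*} [AddCommMonoid A] {n : ℕ} {T : Finset Tile} (hV : ∀ p ∈ T, Valid n p) (K w : ℕ) (F : Tile → A) :
    ∑ p ∈ T.filter (fun p => p.K = K ∧ p.w = w), F p =
      ∑ i ∈ range (16^K), if (⟨K, i, w⟩ : Tile) ∈ T then F ⟨K, i, w⟩ else 0 := by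
  rw [← Finset.sum_filter]
  refine Finset.sum_bij' (fun p _ => p.i) (fun i _ => ⟨K, i, w⟩) ?_ ?_ ?_ ?_ ?_
  · intro p hp
    obtain ⟨h1, rfl, rfl⟩ := mem_filter.1 hp
    rw [mem_filter, mem_range]
    exact ⟨(hV p h1).2.2, h1⟩
  · intro i hi
    rw [mem_filter] at hi ⊢
    exact ⟨hi.2, rfl, rfl⟩
  · intro p hp
    obtain ⟨h1, rfl, rfl⟩ := mem_filter.1 hp
    rfl
  · intro i hi; rfl
  · intro p hp
    obtain ⟨h1, rfl, rfl⟩ := mem_filter.1 hp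
    rfl

lemma norm_sq_sum {ι : Type*} (S : Finset ι) (R : Finset ℕ) (F : ι → ℕ → ℂ) :
    ((∑ x ∈ R, ‖∑ a ∈ S, F a x‖^2 : ℝ) : ℂ) = ∑ a ∈ S, ∑ b ∈ S, ∑ x ∈ R, F a x * conj (F b x) := by
  push_cast
  simp_rw [← Complex.mul_conj', map_sum, Finset.sum_mul_sum]
  rw [Finset.sum_comm]
  refine Finset.sum_congr rfl fun a _ => Finset.sum_comm

lemma pyth {ι : Type*} (S : Finset ι) (R : Finset ℕ) (F : ι → ℕ → ℂ)
    (h : ∀ a ∈ S, ∀ b ∈ S, a ≠ b → ∑ x ∈ R, F a x * conj (F b x) = 0) :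
    ∑ x ∈ R, ‖∑ a ∈ S, F a x‖^2 = ∑ a ∈ S, ∑ x ∈ R, ‖F a x‖^2 := by
  have h1 := norm_sq_sum S R F
  have h2 : ∑ a ∈ S, ∑ b ∈ S, ∑ x ∈ R, F a x * conj (F b x) = ((∑ a ∈ S, ∑ x ∈ R, ‖F a x‖^2 : ℝ) : ℂ) := by
    push_cast
    refine Finset.sum_congr rfl fun a ha => ?_
    rw [Finset.sum_eq_single a (fun b hb hab => h a ha b hb hab.symm) (fun h => absurd ha h)]
    refine Finset.sum_congr rfl fun x _ => ?_
    rw [Complex.mul_conj']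
  rw [h2] at h1
  exact_mod_cast h1

variable {n : ℕ} {C0 : ℝ}

lemma gamma_sq (D : Model n C0) {T : Finset Tile} {ξ r : ℕ} (hV : ∀ p ∈ T, Valid n p)
    (hr : ∀ p ∈ T, p.K % 3 = r) (hw : ∀ p ∈ T, ξ / 16^p.K = p.w) (c : Tile → ℂ) :
    ∑ x ∈ range (16^n), ‖∑ p ∈ T, c p * D.Θ p ξ x‖^2 ≤
      C0 * ∑ p ∈ T.filter (fun p => Lac D ξ p), LL n p.K * ‖c p‖^2 := by
  set T' := T.filter (fun p => Lac D ξ p) with hT'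
  have sub : T' ⊆ T := filter_subset _ _
  have e1 : ∀ x ∈ range (16^n), ‖∑ p ∈ T, c p * D.Θ p ξ x‖^2 =
      ‖∑ K ∈ range n, ∑ p ∈ T'.filter (fun p => p.K = K), c p * D.Θ p ξ x‖^2 := by
    intro x hx
    rw [Finset.sum_fiberwise_of_maps_to (s := T') (t := range n) (g := fun p => p.K)
      (fun p hp => by rw [mem_range]; have := (hV p (sub hp)).2.1; omega)]
    congr 2
    symm
    apply Finset.sum_subset sub
    intro p hp hp'
    by_contra hne
    apply hp'
    rw [hT', mem_filter]
    refine ⟨hp, (D.th_supp p (hV p hp) ξ x (mem_range.1 hx) ?_).2⟩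
    intro h0; apply hne; rw [h0, mul_zero]
  rw [Finset.sum_congr rfl e1, pyth]
  · rw [← Finset.sum_fiberwise_of_maps_to (s := T') (t := range n) (g := fun p => p.K)
      (fun p hp => by rw [mem_range]; have := (hV p (sub hp)).2.1; omega), Finset.mul_sum]
    refine Finset.sum_le_sum fun K _ => ?_
    by_cases hK : 2 ≤ K ∧ K + 1 ≤ n
    · have fe : T'.filter (fun p => p.K = K) = T'.filter (fun p => p.K = K ∧ p.w = ξ / 16^K) := by
        refine Finset.filter_congr fun p hp => ?_
        constructor
        · rintro rfl; exact ⟨rfl, (hw p (sub hp)).symm⟩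
        · exact fun h => h.1
      rw [fe]
      simp_rw [block_sum (fun p hp => hV p (sub hp))]
      have := D.th_sq K (ξ / 16^K) ξ hK.1 hK.2 (fun i => if (⟨K, i, ξ / 16^K⟩ : Tile) ∈ T' then c ⟨K, i, ξ / 16^K⟩ else 0)
      simp_rw [ite_mul, zero_mul] at this
      refine this.trans ?_
      rw [mul_assoc, Finset.mul_sum]
      refine mul_le_mul_of_nonneg_left (le_of_eq ?_) (by linarith [D.hC0])
      refine Finset.sum_congr rfl fun i _ => ?_
      split_ifs <;> simp
    · have fe : T'.filter (fun p => p.K = K) = ∅ := by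
        rw [Finset.filter_eq_empty_iff]
        rintro p hp rfl
        exact hK ⟨(hV p (sub hp)).1, (hV p (sub hp)).2.1⟩
      rw [fe]; simp
  · have aux : ∀ a b, a + 1 ≤ b → ∑ x ∈ range (16^n), (∑ p ∈ T'.filter (fun p => p.K = a), c p * D.Θ p ξ x) * conj (∑ p ∈ T'.filter (fun p => p.K = b), c p * D.Θ p ξ x) = 0 := by
      intro a b hab
      simp_rw [map_sum, Finset.sum_mul_sum]
      rw [Finset.sum_comm]
      refine Finset.sum_eq_zero fun p hp => ?_
      rw [Finset.sum_comm]
      refine Finset.sum_eq_zero fun q hq => ?_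
      rw [mem_filter] at hp hq
      have h1 := hr p (sub hp.1)
      have h2 := hr q (sub hq.1)
      have := D.th_orth p q (hV p (sub hp.1)) (hV q (sub hq.1)) ξ (by omega)
      calc _ = c p * conj (c q) * ∑ x ∈ range (16^n), D.Θ p ξ x * conj (D.Θ q ξ x) := by
            rw [Finset.mul_sum]
            refine Finset.sum_congr rfl fun x _ => ?_
            rw [map_mul]; ring
        _ = 0 := by rw [this, mul_zero]
    intro a _ b _ hab
    rcases Nat.lt_or_gt_of_ne hab with h | h
    · exact aux a b h
    · have := congrArg conj (aux b a h)
      rw [map_sum, map_zero] at this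
      rw [← this]
      refine Finset.sum_congr rfl fun x _ => ?_
      rw [map_mul, Complex.conj_conj, mul_comm]

/-- stopped condition -/
def Good (n : ℕ) (T : Finset Tile) (k x : ℕ) : Prop :=
  ∀ p ∈ T, ∀ x' < 16^n, x' / LN n k = x / LN n k → k ≤ p.K → LL n k ≤ cd n x' (p.y n)

/-- stopped scale -/
noncomputable def tstp (n k0 : ℕ) (T : Finset Tile) (x : ℕ) : ℕ := sInf {k | k0 ≤ k ∧ Good n T k x}

lemma tstp_spec {k0 : ℕ} {T : Finset Tile} (hV : ∀ p ∈ T, Valid n p) (hk0 : k0 ≤ n) (x : ℕ) :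
    k0 ≤ tstp n k0 T x ∧ Good n T (tstp n k0 T x) x ∧ tstp n k0 T x ≤ n := by
  have hn : n ∈ {k | k0 ≤ k ∧ Good n T k x} := by
    refine ⟨hk0, ?_⟩
    intro p hp x' _ _ h
    have := (hV p hp).2.1
    omega
  have h1 := Nat.sInf_mem (⟨n, hn⟩ : Set.Nonempty {k | k0 ≤ k ∧ Good n T k x})
  exact ⟨h1.1, h1.2, Nat.sInf_le hn⟩

lemma tstp_min {k0 k : ℕ} {T : Finset Tile} {x : ℕ} (h : k0 ≤ k) (h' : k < tstp n k0 T x) : ¬ Good n T k x :=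
  fun hg => absurd (Nat.sInf_le (s := {k | k0 ≤ k ∧ Good n T k x}) ⟨h, hg⟩) (by unfold tstp at h'; omega)

lemma tstp_const {k0 : ℕ} {T : Finset Tile} (hV : ∀ p ∈ T, Valid n p) (hk0 : k0 ≤ n) {x x' : ℕ}
    (h : x' / LN n (tstp n k0 T x) = x / LN n (tstp n k0 T x)) : tstp n k0 T x' = tstp n k0 T x := by
  obtain ⟨a1, a2, a3⟩ := tstp_spec hV hk0 x
  obtain ⟨b1, b2, b3⟩ := tstp_spec hV hk0 x'
  have le1 : tstp n k0 T x' ≤ tstp n k0 T x := by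
    refine Nat.sInf_le ⟨a1, ?_⟩
    intro p hp z hz e
    exact a2 p hp z hz (e.trans h)
  have e2 : x / LN n (tstp n k0 T x') = x' / LN n (tstp n k0 T x') := nest_time le1 a3 h.symm
  refine le_antisymm le1 (Nat.sInf_le ⟨b1, ?_⟩)
  intro p hp z hz e
  exact b2 p hp z hz (e.trans e2)

/-- pointwise bound by average over block -/
lemma le_avg {k x : ℕ} (hk : k ≤ n) (hx : x < 16^n) (a : ℝ) (G : ℕ → ℝ)
    (h : ∀ y < 16^n, y / LN n k = x / LN n k → a ≤ G y) :
    a ≤ (LL n k)⁻¹ * ∑ y ∈ (range (16^n)).filter (fun y => y / LN n k = x / LN n k), G y := by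
  have := Finset.card_nsmul_le_sum ((range (16^n)).filter (fun y => y / LN n k = x / LN n k)) G a
    (fun y hy => by rw [mem_filter, mem_range] at hy; exact h y hy.1 hy.2)
  rw [card_block hk (div_lt_of hk hx), nsmul_eq_mul, LN_cast] at this
  have p := LL_pos n k
  rw [inv_mul_eq_div, le_div_iff₀ p]
  linarith

lemma LL_ratio {k K : ℕ} (h : k ≤ K) (h' : K ≤ n) : LL n K = (1/16)^(K-k) * LL n k := by
  unfold LL
  have : n - k = (n - K) + (K - k) := by omega
  rw [this, pow_add, one_div, inv_pow]; field_simp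

lemma y_under {k i ξ : ℕ} {p : Tile} (h : Under n k i ξ p) : p.y n / LN n k = (i * LN n k) / LN n k := by
  rw [mul_LN_div]; exact h.2.1

/-- Part 1 of the tree lemma -/
lemma tree_part1 (D : Model n C0) {T : Finset Tile} {k0 i0 ξ : ℕ} (hV : ∀ p ∈ T, Valid n p)
    (hk0 : k0 ≤ n) (hi0 : i0 < 16^k0) (hU : ∀ p ∈ T, Under n k0 i0 ξ p) {c : Tile → ℂ} {σ μ : ℝ}
    (hσ : 0 ≤ σ) (hc : ∀ p ∈ T, ‖c p‖ ≤ σ) {g : ℕ → ℂ} {N : ℕ → ℕ} (hμ : 0 ≤ μ) (hm : MassLe n g N T μ) :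
    ∑ x ∈ range (16^n), ‖g x‖ * ∑ p ∈ T.filter (fun p => tstp n k0 T x ≤ p.K), ‖c p * D.Θ p (N x) x‖ ≤
      41472 * C0 * σ * μ * LL n k0 := by
  have hC := D.hC0
  -- per tile right hand side
  set R : Tile → ℝ := fun p => 64 * ∑ y ∈ range (16^n), if tstp n k0 T y ≤ p.K then
      (LL n (tstp n k0 T y))⁻¹ * ((1/16)^(p.K - tstp n k0 T y) * (W n (tstp n k0 T y) y (p.y n))^2 * (W n k0 y (i0 * LN n k0))^2) else 0 with hR
  have hR0 : ∀ p, 0 ≤ R p := by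
    intro p
    refine mul_nonneg (by norm_num) (Finset.sum_nonneg fun y _ => ?_)
    have := LL_pos n (tstp n k0 T y)
    split_ifs <;> positivity
  have key : ∀ p ∈ T, ∀ x < 16^n, tstp n k0 T x ≤ p.K → (W n p.K x (p.y n))^5 ≤ R p := by
    intro p hp x hx hk
    obtain ⟨a1, a2, a3⟩ := tstp_spec hV hk0 x
    set k := tstp n k0 T x with hkdef
    have hd := a2 p hp x hx rfl hk
    have w1 : W n p.K x (p.y n) ≤ (1/16)^(p.K - k) := by
      have hl := LL_ratio (n := n) hk (hV p hp).K_le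
      have := LL_pos n k
      have := LL_pos n p.K
      unfold W
      rw [div_le_iff₀ (by linarith)]
      have t : (0:ℝ) ≤ (1/16)^(p.K-k) := by positivity
      nlinarith
    have hav := le_avg (n := n) (k := k) (x := x) a3 hx ((W n p.K x (p.y n))^5)
      (fun y => (1/16)^(p.K - k) * (4 * (W n k y (p.y n))^2) * (16 * (W n k0 y (i0 * LN n k0))^2)) ?_
    · refine hav.trans ?_
      rw [hR]
      simp only
      rw [Finset.mul_sum, Finset.mul_sum]
      rw [Finset.sum_filter]
      refine Finset.sum_le_sum fun y hy => ?_
      have pos : 0 ≤ 64 * (if tstp n k0 T y ≤ p.K then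
        (LL n (tstp n k0 T y))⁻¹ * ((1/16)^(p.K - tstp n k0 T y) * (W n (tstp n k0 T y) y (p.y n))^2 * (W n k0 y (i0 * LN n k0))^2) else 0) := by
        have := LL_pos n (tstp n k0 T y)
        split_ifs <;> positivity
      by_cases h1 : y / LN n k = x / LN n k
      · have e := tstp_const hV hk0 (x := x) (x' := y) h1
        rw [if_pos h1, e, if_pos hk]
        apply le_of_eq; ring
      · rw [if_neg h1]; exact pos
    · intro y hy e
      have p0 := W_pos n p.K x (p.y n)
      have w2 : W n p.K x (p.y n) ≤ 2 * W n k y (p.y n) :=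
        (W_anti hk _ _).trans (W_le_two le_rfl e.symm _)
      have w3 : W n p.K x (p.y n) ≤ 4 * W n k0 y (i0 * LN n k0) := by
        have u1 : W n p.K x (p.y n) ≤ W n k0 x (p.y n) := W_anti (a1.trans hk) _ _
        have u2 : W n k0 x (p.y n) ≤ 2 * W n k0 y (p.y n) := W_le_two a1 e.symm _
        have u3 := W_le_two (n := n) (J := k0) le_rfl (y_under (hU p hp)) y
        rw [W_comm n k0 _ y, W_comm n k0 _ y] at u3
        linarith
      have w2' : (W n p.K x (p.y n))^2 ≤ (2 * W n k y (p.y n))^2 := by gcongr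
      have w3' : (W n p.K x (p.y n))^2 ≤ (4 * W n k0 y (i0 * LN n k0))^2 := by gcongr
      calc (W n p.K x (p.y n))^5 = W n p.K x (p.y n) * (W n p.K x (p.y n))^2 * (W n p.K x (p.y n))^2 := by ring
        _ ≤ (1/16)^(p.K - k) * (2 * W n k y (p.y n))^2 * (4 * W n k0 y (i0 * LN n k0))^2 := by gcongr
        _ = _ := by ring
  have step1 : ∑ x ∈ range (16^n), ‖g x‖ * ∑ p ∈ T.filter (fun p => tstp n k0 T x ≤ p.K), ‖c p * D.Θ p (N x) x‖ ≤
      ∑ p ∈ T, (C0 * σ) * (R p * massTop n g N p.K p.i ξ) := by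
    simp_rw [Finset.mul_sum, Finset.sum_filter]
    rw [Finset.sum_comm]
    refine Finset.sum_le_sum fun p hp => ?_
    unfold massTop
    rw [Finset.mul_sum, Finset.mul_sum]
    refine Finset.sum_le_sum fun x hx => ?_
    rw [mem_range] at hx
    have p0 := W_pos n p.K x (p.y n)
    have pos : 0 ≤ C0 * σ * (R p * (if N x / 16^p.K = ξ / 16^p.K then ‖g x‖ * (W n p.K x (p.i * LN n p.K))^3 else 0)) := by
      have := hR0 p
      have := W_pos n p.K x (p.i * LN n p.K)
      split_ifs <;> positivity
    split_ifs at pos ⊢ with h1 h2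
    · rw [norm_mul]
      have t1 := D.th_le p (hV p hp) (N x) x hx
      have t2 := key p hp x hx h1
      have t3 := hc p hp
      calc ‖g x‖ * (‖c p‖ * ‖D.Θ p (N x) x‖) ≤ ‖g x‖ * (σ * (C0 * (W n p.K x (p.y n))^8)) := by gcongr
        _ = (C0 * σ) * ((W n p.K x (p.y n))^5 * (‖g x‖ * (W n p.K x (p.y n))^3)) := by ring
        _ ≤ (C0 * σ) * (R p * (‖g x‖ * (W n p.K x (p.y n))^3)) := by gcongr
        _ = _ := rfl
    · have : D.Θ p (N x) x = 0 := by
        by_contra hne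
        exact h2 ((D.th_supp p (hV p hp) (N x) x hx hne).1.trans (hU p hp).2.2.symm)
      rw [this]; simp
    · exact pos
    · exact pos
  have step2 : ∑ p ∈ T, (C0 * σ) * (R p * massTop n g N p.K p.i ξ) ≤ C0 * σ * μ * ∑ p ∈ T, LL n p.K * R p := by
    rw [Finset.mul_sum]
    refine Finset.sum_le_sum fun p hp => ?_
    have := hm p hp p.K p.i ξ ⟨le_rfl, y_div n p, (hU p hp).2.2⟩
    calc _ ≤ (C0 * σ) * (R p * (μ * LL n p.K)) := by have := hR0 p; gcongr
      _ = _ := by ring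
  have step3 : ∑ p ∈ T, LL n p.K * R p ≤ 41472 * LL n k0 := by
    have e : ∑ p ∈ T, LL n p.K * R p = 64 * ∑ y ∈ range (16^n), (LL n (tstp n k0 T y))⁻¹ * (W n k0 y (i0 * LN n k0))^2 *
        ∑ p ∈ T.filter (fun p => tstp n k0 T y ≤ p.K), (1/16)^(p.K - tstp n k0 T y) * (LL n p.K * (W n (tstp n k0 T y) y (p.y n))^2) := by
      rw [hR]
      simp_rw [Finset.mul_sum, Finset.sum_filter]
      rw [Finset.sum_comm]
      refine Finset.sum_congr rfl fun y _ => Finset.sum_congr rfl fun p _ => ?_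
      split_ifs
      · ring
      · simp
    rw [e]
    have : ∀ y ∈ range (16^n), (LL n (tstp n k0 T y))⁻¹ * (W n k0 y (i0 * LN n k0))^2 *
        ∑ p ∈ T.filter (fun p => tstp n k0 T y ≤ p.K), ((1:ℝ)/16)^(p.K - tstp n k0 T y) * (LL n p.K * (W n (tstp n k0 T y) y (p.y n))^2) ≤ 72 * (W n k0 y (i0 * LN n k0))^2 := by
      intro y hy
      have h := geo_tree (n := n) (k := tstp n k0 T y) (J := tstp n k0 T y) (ξ := ξ) hV (fun p hp => (hU p hp).2.2) (mem_range.1 hy) le_rfl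
      have pl := LL_pos n (tstp n k0 T y)
      calc _ ≤ (LL n (tstp n k0 T y))⁻¹ * (W n k0 y (i0 * LN n k0))^2 * (72 * LL n (tstp n k0 T y)) := by gcongr
        _ = _ := by field_simp
    have h2 := Finset.sum_le_sum this
    rw [← Finset.mul_sum] at h2
    have h3 := W_sum' (n := n) (K := k0) (mul_LN_lt hk0 hi0)
    linarith
  refine step1.trans (step2.trans ?_)
  calc _ ≤ C0 * σ * μ * (41472 * LL n k0) := by gcongr
    _ = _ := by ring

end Carl

namespace Carl
open Finset
open scoped Classical ComplexConjugate
variable {n : ℕ} {C0 : ℝ}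

lemma trunc_bound (D : Model n C0) {T : Finset Tile} {ξ r : ℕ} (hV : ∀ p ∈ T, Valid n p)
    (hr : ∀ p ∈ T, p.K % 3 = r) (c : Tile → ℂ) {k b x x' : ℕ} {m : ℝ} (hm0 : 0 ≤ m) (hb : b ≤ k) (hx : x < 16^n)
    (hxx : x / LN n k = x' / LN n k)
    (hm : ∀ K, K + 1 ≤ n → (LL n K)⁻¹ * ∑ y ∈ range (16^n), (W n K x' y)^2 * ‖∑ p ∈ T, c p * D.Θ p ξ y‖ ≤ m) :
    ‖∑ p ∈ T.filter (fun p => p.K < b), c p * D.Θ p ξ x‖ ≤ 4 * C0 * m := by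
  have hC := D.hC0
  by_cases hne : (T.filter (fun p => p.K < b)).Nonempty
  · obtain ⟨q, hq, hmax⟩ := Finset.exists_max_image _ (fun p : Tile => p.K) hne
    rw [mem_filter] at hq
    have hqV := hV q hq.1
    have e : ∑ p ∈ T.filter (fun p => p.K < b), c p * D.Θ p ξ x =
        ∑ y ∈ range (16^n), D.Ψ q.K ξ x y * ∑ p ∈ T, c p * D.Θ p ξ y := by
      simp_rw [Finset.mul_sum]
      rw [Finset.sum_comm, Finset.sum_filter]
      refine Finset.sum_congr rfl fun p hp => ?_
      have e2 : ∑ y ∈ range (16^n), D.Ψ q.K ξ x y * (c p * D.Θ p ξ y) = c p * ∑ y ∈ range (16^n), D.Ψ q.K ξ x y * D.Θ p ξ y := by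
        rw [Finset.mul_sum]; exact Finset.sum_congr rfl fun y _ => by ring
      rw [e2]
      split_ifs with h
      · rw [D.psi_id q.K hqV.2.1 p (hV p hp) ξ (hmax p (mem_filter.2 ⟨hp, h⟩)) x hx]
      · have h1 := hr p hp
        have h2 := hr q hq.1
        rw [D.psi_zero q.K hqV.2.1 p (hV p hp) ξ (by omega) x hx, mul_zero]
    rw [e]
    refine (norm_sum_le _ _).trans ?_
    have h1 : ∀ y ∈ range (16^n), ‖D.Ψ q.K ξ x y * ∑ p ∈ T, c p * D.Θ p ξ y‖ ≤
        4 * C0 * ((LL n q.K)⁻¹ * ((W n q.K x' y)^2 * ‖∑ p ∈ T, c p * D.Θ p ξ y‖)) := by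
      intro y hy
      rw [norm_mul]
      have a := D.psi_le q.K hqV.2.1 ξ x hx y (mem_range.1 hy)
      have b1 := W_le_two (n := n) (J := q.K) (K := k) (by omega) hxx y
      have pl := LL_pos n q.K
      have pw := W_pos n q.K x y
      have b2 : (W n q.K x y)^2 ≤ (2 * W n q.K x' y)^2 := by gcongr
      calc _ ≤ (C0 * (LL n q.K)⁻¹ * (2 * W n q.K x' y)^2) * ‖∑ p ∈ T, c p * D.Θ p ξ y‖ := by
            gcongr
            refine a.trans ?_
            gcongr
        _ = _ := by ring
    refine (Finset.sum_le_sum h1).trans ?_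
    rw [← Finset.mul_sum, ← Finset.mul_sum]
    exact mul_le_mul_of_nonneg_left (hm q.K hqV.2.1) (by linarith)
  · rw [Finset.not_nonempty_iff_eq_empty] at hne
    rw [hne]; simp; positivity

lemma F_bound (D : Model n C0) {T : Finset Tile} {k ξ r : ℕ} (hV : ∀ p ∈ T, Valid n p)
    (hr : ∀ p ∈ T, p.K % 3 = r) (hw : ∀ p ∈ T, ξ / 16^p.K = p.w) {c : Tile → ℂ} {σ : ℝ}
    (hσ : 0 ≤ σ) (hc : ∀ p ∈ T, ‖c p‖ ≤ σ) {N x x' : ℕ} {m : ℝ} (hm0 : 0 ≤ m) (hx : x < 16^n)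
    (hN : N / 16^(k-1) = ξ / 16^(k-1)) (hk : 1 ≤ k)
    (hxx : x / LN n k = x' / LN n k)
    (hm : ∀ K, K + 1 ≤ n → (LL n K)⁻¹ * ∑ y ∈ range (16^n), (W n K x' y)^2 * ‖∑ p ∈ T, c p * D.Θ p ξ y‖ ≤ m) :
    ‖∑ p ∈ T.filter (fun p => p.K < k), c p * D.Θ p N x‖ ≤ 72 * C0 * σ + 8 * C0 * m := by
  have hC := D.hC0
  have hex : ∃ K, N / 16^K = ξ / 16^K := ⟨_, hN⟩
  set K0 := Nat.find hex with hK0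
  have s1 : N / 16^K0 = ξ / 16^K0 := Nat.find_spec hex
  have s2 : K0 ≤ k - 1 := Nat.find_min' hex hN
  -- split
  have e1 : ∑ p ∈ T.filter (fun p => p.K < k), c p * D.Θ p N x =
      ∑ p ∈ T.filter (fun p => p.K < k), (if K0 ≤ p.K then c p * (D.Θ p N x - D.Θ p ξ x) else 0) +
      (∑ p ∈ T.filter (fun p => p.K < k), c p * D.Θ p ξ x - ∑ p ∈ T.filter (fun p => p.K < K0), c p * D.Θ p ξ x) := by
    have e2 : ∑ p ∈ T.filter (fun p => p.K < K0), c p * D.Θ p ξ x =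
        ∑ p ∈ T.filter (fun p => p.K < k), if K0 ≤ p.K then 0 else c p * D.Θ p ξ x := by
      rw [Finset.sum_filter, Finset.sum_filter]
      refine Finset.sum_congr rfl fun p _ => ?_
      by_cases h1 : K0 ≤ p.K
      · rw [if_neg (by omega), if_pos h1]; simp
      · rw [if_pos (by omega), if_pos (by omega), if_neg h1]
    rw [e2, ← Finset.sum_sub_distrib, ← Finset.sum_add_distrib]
    refine Finset.sum_congr rfl fun p hp => ?_
    have hpT := (mem_filter.1 hp).1
    split_ifs with h
    · ring
    · have : D.Θ p N x = 0 := by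
        by_contra hne
        have h3 := (D.th_supp p (hV p hpT) N x hx hne).1
        rw [← hw p hpT] at h3
        exact h (Nat.find_min' hex h3)
      rw [this]; ring
  rw [e1]
  have b1 : ‖∑ p ∈ T.filter (fun p => p.K < k), (if K0 ≤ p.K then c p * (D.Θ p N x - D.Θ p ξ x) else 0)‖ ≤ 72 * C0 * σ := by
    refine (norm_sum_le _ _).trans ?_
    have hNξ : |(N:ℝ) - ξ| ≤ 16^K0 := by
      have h1 := Nat.div_add_mod N (16^K0)
      have h2 := Nat.div_add_mod ξ (16^K0)
      have h3 := Nat.mod_lt N (show 0 < 16^K0 by positivity)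
      have h4 := Nat.mod_lt ξ (show 0 < 16^K0 by positivity)
      rw [s1] at h1
      have h5 : N ≤ ξ + 16^K0 := by omega
      have h6 : ξ ≤ N + 16^K0 := by omega
      have h5' : (N:ℝ) ≤ ξ + 16^K0 := by exact_mod_cast h5
      have h6' : (ξ:ℝ) ≤ N + 16^K0 := by exact_mod_cast h6
      rw [abs_le]; constructor <;> linarith
    have t : ∀ p ∈ T.filter (fun p => p.K < k), ‖if K0 ≤ p.K then c p * (D.Θ p N x - D.Θ p ξ x) else 0‖ ≤
        if K0 ≤ p.K then (C0 * σ * (LL n 0)⁻¹) * ((1/16)^(p.K - 0) * (LL n 0 * (16^K0 * 1)) * (W n p.K x (p.y n))^2) else 0 := by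
      intro p hp
      have hpT := (mem_filter.1 hp).1
      have hpV := hV p hpT
      split_ifs with h
      · rw [norm_mul]
        have t1 := D.th_lip p hpV N ξ x hx
        have pw := W_pos n p.K x (p.y n)
        have t2 : (W n p.K x (p.y n))^8 ≤ (W n p.K x (p.y n))^2 := pow_le_pow_of_le_one pw.le (W_le_one _ _ _ _) (by norm_num)
        have pl := LL_pos n 0
        calc _ ≤ σ * (C0 * (16^K0 / 16^p.K) * (W n p.K x (p.y n))^2) := by
              refine mul_le_mul (hc p hpT) (t1.trans ?_) (norm_nonneg _) hσ
              gcongr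
          _ = _ := by
              rw [Nat.sub_zero, one_div, inv_pow]; field_simp
      · simp
    refine (Finset.sum_le_sum t).trans ?_
    -- regroup
    have t' : ∀ p ∈ T.filter (fun p => p.K < k), (if K0 ≤ p.K then (C0 * σ * (LL n 0)⁻¹) * ((1/16)^(p.K - 0) * (LL n 0 * (16^K0 * 1)) * (W n p.K x (p.y n))^2) else 0) =
        C0 * σ * (if K0 ≤ p.K then (1/16)^(p.K - K0) * (W n p.K x (p.y n))^2 else 0) := by
      intro p hp
      split_ifs with h
      · have pl := LL_pos n 0
        have e : (1/16:ℝ)^(p.K - 0) * 16^K0 = (1/16)^(p.K-K0) := by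
          have : p.K - 0 = (p.K - K0) + K0 := by omega
          rw [this, pow_add, mul_assoc, ← mul_pow]; norm_num
        rw [← e]
        field_simp
      · simp
    rw [Finset.sum_congr rfl t', ← Finset.mul_sum]
    have t3 : ∑ p ∈ T.filter (fun p => p.K < k), (if K0 ≤ p.K then ((1:ℝ)/16)^(p.K - K0) * (W n p.K x (p.y n))^2 else 0) ≤ 72 := by
      refine (Finset.sum_le_sum_of_subset_of_nonneg (filter_subset _ _) fun p _ _ => by split_ifs <;> positivity).trans ?_
      refine (tree_sum (n := n) (ξ := ξ) hV hw (fun K i => if K0 ≤ K then ((1:ℝ)/16)^(K - K0) * (W n K x (i * LN n K))^2 else 0)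
        (fun K i => by split_ifs <;> positivity)).trans ?_
      have u : ∀ K ∈ range n, ∑ i ∈ range (16^K), (if K0 ≤ K then ((1:ℝ)/16)^(K - K0) * (W n K x (i * LN n K))^2 else 0) ≤
          (if K0 ≤ K then ((1:ℝ)/16)^(K-K0) else 0) * 36 := by
        intro K hK
        rw [mem_range] at hK
        split_ifs
        · rw [← Finset.mul_sum]
          refine mul_le_mul_of_nonneg_left ?_ (by positivity)
          have := W5 (n := n) (J := K) (K := K) le_rfl (by omega) hx
          have pl := LL_pos n K
          nlinarith
        · simp
      refine (Finset.sum_le_sum u).trans ?_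
      rw [← Finset.sum_mul]
      linarith [geo n K0]
    have : 0 ≤ C0 * σ := by positivity
    nlinarith
  have b2 := trunc_bound D hV hr c (ξ := ξ) (b := k) hm0 le_rfl hx hxx hm
  have b3 := trunc_bound D hV hr c (ξ := ξ) (b := K0) (k := k) hm0 (by omega) hx hxx hm
  refine (norm_add_le _ _).trans ?_
  have b4 := norm_sub_le (∑ p ∈ T.filter (fun p => p.K < k), c p * D.Θ p ξ x) (∑ p ∈ T.filter (fun p => p.K < K0), c p * D.Θ p ξ x)
  linarith

/-- Part 2 of the tree lemma -/
lemma tree_part2 (D : Model n C0) {T : Finset Tile} {k0 i0 ξ r : ℕ} (hV : ∀ p ∈ T, Valid n p)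
    (hr : ∀ p ∈ T, p.K % 3 = r)
    (hk0 : k0 ≤ n) (hi0 : i0 < 16^k0) (hU : ∀ p ∈ T, Under n k0 i0 ξ p) {c : Tile → ℂ} {σ μ : ℝ}
    (hσ : 0 ≤ σ) (hs : SizeLe D c T σ) {g : ℕ → ℂ} {N : ℕ → ℕ} (hμ : 0 ≤ μ) (hm : MassLe n g N T μ) :
    ∑ x ∈ range (16^n), ‖g x‖ * ‖∑ p ∈ T.filter (fun p => p.K < tstp n k0 T x), c p * D.Θ p (N x) x‖ ≤
      50000000 * C0^2 * σ * μ * LL n k0 := by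
  have hC := D.hC0
  have hw : ∀ p ∈ T, ξ / 16^p.K = p.w := fun p hp => (hU p hp).2.2
  have hc : ∀ p ∈ T, ‖c p‖ ≤ σ := fun p hp => hs.coef hσ hV hp
  have hLpos := LL_pos n k0
  set Γ : ℕ → ℝ := fun y => ‖∑ p ∈ T, c p * D.Θ p ξ y‖ with hΓ
  set A : ℕ → ℕ → ℝ := fun K x => (LL n K)⁻¹ * ∑ y ∈ range (16^n), (W n K x y)^2 * Γ y with hA
  have hA0 : ∀ K x, 0 ≤ A K x := by
    intro K x
    have := LL_pos n K
    exact mul_nonneg (by positivity) (Finset.sum_nonneg fun y _ => mul_nonneg (sq_nonneg _) (norm_nonneg _))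
  have hκ : ∀ x, ∃ K, ∀ K', K' + 1 ≤ n → A K' x ≤ A K x := by
    intro x
    obtain ⟨K, _, h⟩ := Finset.exists_max_image (range (n+1)) (fun K => A K x) ⟨0, by simp⟩
    exact ⟨K, fun K' h' => h K' (by rw [mem_range]; omega)⟩
  choose κ hκ using hκ
  set M : ℕ → ℝ := fun x => A (κ x) x with hM
  have hM0 : ∀ x, 0 ≤ M x := fun x => hA0 _ _
  have hMsq : ∑ x ∈ range (16^n), (M x)^2 ≤ 160000 * (C0 * (σ^2 * LL n k0)) := by
    have h1 := maximal (n := n) κ Γ (fun y => norm_nonneg _)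
    have h2 := gamma_sq D hV hr hw c
    have h3 : ∑ p ∈ T.filter (fun p => Lac D ξ p), LL n p.K * ‖c p‖^2 ≤ σ^2 * LL n k0 := by
      refine le_trans (le_of_eq ?_) (hs k0 i0 ξ hk0 hi0)
      congr 1
      refine Finset.filter_congr fun p hp => ?_
      simp [hU p hp]
    have h4 : C0 * ∑ p ∈ T.filter (fun p => Lac D ξ p), LL n p.K * ‖c p‖^2 ≤ C0 * (σ^2 * LL n k0) := by gcongr
    refine h1.trans ?_
    have := h2.trans h4
    simp only [hΓ]
    linarith
  set E := (range (16^n)).filter (fun x => k0 < tstp n k0 T x) with hE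
  have hEc : (E.card : ℝ) ≤ 144 * LL n k0 := by
    have h1 : ∀ x ∈ E, (1:ℝ)/16 ≤ (W n k0 x (i0 * LN n k0))^2 := by
      intro x hx
      rw [hE, mem_filter, mem_range] at hx
      have h2 := tstp_min (n := n) le_rfl hx.2
      unfold Good at h2
      push Not at h2
      obtain ⟨p, hp, x', hx', e, hkK, hd⟩ := h2
      have d1 := cd_lt_of_div (n := n) e
      have d2 := cd_lt_of_div (n := n) (y_under (hU p hp))
      have d3 := cd_tri n x x' (i0 * LN n k0)
      have d4 := cd_tri n x' (p.y n) (i0 * LN n k0)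
      rw [cd_comm n x x'] at d3
      have : (1:ℝ)/4 ≤ W n k0 x (i0 * LN n k0) := by
        unfold W
        rw [div_le_div_iff₀ (by norm_num) (by linarith [cd_nonneg n x (i0 * LN n k0)])]
        linarith
      nlinarith
    have h2 := Finset.sum_le_sum h1
    have h3 : ∑ x ∈ E, (W n k0 x (i0 * LN n k0))^2 ≤ 9 * LL n k0 :=
      (Finset.sum_le_sum_of_subset_of_nonneg (filter_subset _ _) fun _ _ _ => by positivity).trans (W_sum' (mul_LN_lt hk0 hi0))
    rw [Finset.sum_const, nsmul_eq_mul] at h2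
    linarith
  have hEM : ∑ x ∈ E, M x ≤ 4800 * C0 * σ * LL n k0 := by
    have cs := Finset.sum_mul_sq_le_sq_mul_sq E (fun _ => (1:ℝ)) M
    simp only [one_mul, one_pow, Finset.sum_const, nsmul_eq_mul, mul_one] at cs
    have h1 : ∑ x ∈ E, (M x)^2 ≤ 160000 * (C0 * (σ^2 * LL n k0)) :=
      (Finset.sum_le_sum_of_subset_of_nonneg (filter_subset _ _) fun _ _ _ => by positivity).trans hMsq
    refine le_of_sq_le_sq (cs.trans ?_) (by positivity)
    calc _ ≤ (144 * LL n k0) * (160000 * (C0 * (σ^2 * LL n k0))) := by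
          refine mul_le_mul hEc h1 (Finset.sum_nonneg fun _ _ => sq_nonneg _) (by positivity)
      _ = 4800^2 * C0 * (σ^2 * (LL n k0)^2) := by ring
      _ ≤ 4800^2 * C0^2 * (σ^2 * (LL n k0)^2) := by
          gcongr; nlinarith
      _ = _ := by ring
  -- mass of the maximal intervals
  set G : ℕ → Prop := fun x => k0 < tstp n k0 T x ∧ N x / 16^(tstp n k0 T x - 1) = ξ / 16^(tstp n k0 T x - 1) with hG
  have hmass : ∀ x ∈ E, ∑ x' ∈ (range (16^n)).filter (fun x' => x' / LN n (tstp n k0 T x) = x / LN n (tstp n k0 T x)), (if G x' then ‖g x'‖ else 0) ≤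
      1024 * μ * LL n (tstp n k0 T x) := by
    intro x hx
    rw [hE, mem_filter, mem_range] at hx
    obtain ⟨a1, a2, a3⟩ := tstp_spec hV hk0 x
    have h2 := tstp_min (n := n) (k := tstp n k0 T x - 1) (by omega) (show tstp n k0 T x - 1 < tstp n k0 T x by omega)
    unfold Good at h2
    push Not at h2
    obtain ⟨p, hp, z, hz, e, hkK, hd⟩ := h2
    set k := tstp n k0 T x with hkd
    have hms := hm p hp (k-1) (p.y n / LN n (k-1)) ξ ⟨hkK, rfl, hw p hp⟩
    have hL : LL n (k-1) = 16 * LL n k := by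
      unfold LL
      have : n - (k-1) = (n-k) + 1 := by omega
      rw [this, pow_succ]; ring
    have h3 : ∑ x' ∈ (range (16^n)).filter (fun x' => x' / LN n k = x / LN n k), (if G x' then ‖g x'‖ else 0) ≤ 64 * massTop n g N (k-1) (p.y n / LN n (k-1)) ξ := by
      unfold massTop
      rw [Finset.mul_sum, Finset.sum_filter]
      refine Finset.sum_le_sum fun x' hx' => ?_
      have wp := W_pos n (k-1) x' (p.y n / LN n (k-1) * LN n (k-1))
      have pos : 0 ≤ 64 * (if N x' / 16^(k-1) = ξ / 16^(k-1) then ‖g x'‖ * (W n (k-1) x' (p.y n / LN n (k-1) * LN n (k-1)))^3 else 0) := by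
        split_ifs <;> positivity
      by_cases h1 : x' / LN n k = x / LN n k
      · rw [if_pos h1]
        by_cases h2 : G x'
        · rw [if_pos h2]
          have es := tstp_const hV hk0 (x := x) (x' := x') h1
          have h2' := h2.2
          rw [es, ← hkd] at h2'
          rw [if_pos h2']
          have c1 := cd_lt_of_div (n := n) (nest_time (n := n) (k := k-1) (by omega) a3 h1)
          have c2 := cd_lt_of_div (n := n) e
          have c4 := cd_lt_of_div (n := n) (K := k-1) (x := p.y n) (x' := p.y n / LN n (k-1) * LN n (k-1)) (by rw [mul_LN_div])
          have d1 := cd_tri n x' x (p.y n / LN n (k-1) * LN n (k-1))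
          have d2 := cd_tri n x z (p.y n / LN n (k-1) * LN n (k-1))
          have d3 := cd_tri n z (p.y n) (p.y n / LN n (k-1) * LN n (k-1))
          have c5 := cd_lt_of_div (n := n) (K := k-1) (x := x') (x' := z) ((nest_time (n := n) (k := k-1) (by omega) a3 h1).trans e.symm)
          have d4 := cd_tri n x' z (p.y n / LN n (k-1) * LN n (k-1))
          have pl := LL_pos n (k-1)
          have : (1:ℝ)/4 ≤ W n (k-1) x' (p.y n / LN n (k-1) * LN n (k-1)) := by
            unfold W
            rw [div_le_div_iff₀ (by norm_num) (by linarith [cd_nonneg n x' (p.y n / LN n (k-1) * LN n (k-1))])]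
            linarith
          have t : ((1:ℝ)/4)^3 ≤ (W n (k-1) x' (p.y n / LN n (k-1) * LN n (k-1)))^3 := by gcongr
          nlinarith [norm_nonneg (g x')]
        · rw [if_neg h2]; exact pos
      · rw [if_neg h1]; exact pos
    refine h3.trans ?_
    rw [hL] at hms
    linarith
  -- pointwise bound
  have hpt : ∀ x ∈ range (16^n), ‖g x‖ * ‖∑ p ∈ T.filter (fun p => p.K < tstp n k0 T x), c p * D.Θ p (N x) x‖ ≤
      ∑ y ∈ E, if x / LN n (tstp n k0 T y) = y / LN n (tstp n k0 T y) then
        (LL n (tstp n k0 T y))⁻¹ * (72 * C0 * σ + 8 * C0 * M y) * (if G x then ‖g x‖ else 0) else 0 := by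
    intro x hx
    rw [mem_range] at hx
    have rhs0 : ∀ y ∈ E, 0 ≤ if x / LN n (tstp n k0 T y) = y / LN n (tstp n k0 T y) then
        (LL n (tstp n k0 T y))⁻¹ * (72 * C0 * σ + 8 * C0 * M y) * (if G x then ‖g x‖ else 0) else 0 := by
      intro y _
      have := LL_pos n (tstp n k0 T y)
      have := hM0 y
      split_ifs <;> positivity
    obtain ⟨a1, a2, a3⟩ := tstp_spec hV hk0 x
    by_cases hz : ∑ p ∈ T.filter (fun p => p.K < tstp n k0 T x), c p * D.Θ p (N x) x = 0
    · rw [hz]; simp only [norm_zero, mul_zero]; exact Finset.sum_nonneg rhs0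
    · obtain ⟨p, hp, hne⟩ := Finset.exists_ne_zero_of_sum_ne_zero hz
      rw [mem_filter] at hp
      have h1 := (D.th_supp p (hV p hp.1) (N x) x hx (right_ne_zero_of_mul hne)).1
      rw [← hw p hp.1] at h1
      have hGx : G x := ⟨lt_of_le_of_lt (hU p hp.1).1 hp.2, nest_freq (by omega) h1⟩
      have hav := le_avg (n := n) (k := tstp n k0 T x) (x := x) a3 hx (‖∑ p ∈ T.filter (fun p => p.K < tstp n k0 T x), c p * D.Θ p (N x) x‖)
        (fun y => 72 * C0 * σ + 8 * C0 * M y) (fun y hy e => F_bound D hV hr hw hσ hc (hM0 y) hx hGx.2 (by have := hGx.1; omega) e.symm (fun K hK => hκ y K hK))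
      calc _ ≤ ‖g x‖ * ((LL n (tstp n k0 T x))⁻¹ * ∑ y ∈ (range (16^n)).filter (fun y => y / LN n (tstp n k0 T x) = x / LN n (tstp n k0 T x)), (72 * C0 * σ + 8 * C0 * M y)) := by gcongr
        _ = ∑ y ∈ (range (16^n)).filter (fun y => y / LN n (tstp n k0 T x) = x / LN n (tstp n k0 T x)), ‖g x‖ * ((LL n (tstp n k0 T x))⁻¹ * (72 * C0 * σ + 8 * C0 * M y)) := by
            rw [Finset.mul_sum, Finset.mul_sum]
        _ = ∑ y ∈ (range (16^n)).filter (fun y => y / LN n (tstp n k0 T x) = x / LN n (tstp n k0 T x)), if x / LN n (tstp n k0 T y) = y / LN n (tstp n k0 T y) then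
        (LL n (tstp n k0 T y))⁻¹ * (72 * C0 * σ + 8 * C0 * M y) * (if G x then ‖g x‖ else 0) else 0 := by
            refine Finset.sum_congr rfl fun y hy => ?_
            have e := (mem_filter.1 hy).2
            have es := tstp_const hV hk0 (x := x) (x' := y) e
            rw [es, if_pos e.symm, if_pos hGx]; ring
        _ ≤ _ := by
            refine Finset.sum_le_sum_of_subset_of_nonneg ?_ (fun y hy _ => rhs0 y hy)
            intro y hy
            rw [mem_filter] at hy
            rw [hE, mem_filter]
            refine ⟨hy.1, ?_⟩
            rw [tstp_const hV hk0 (x := x) (x' := y) hy.2]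
            exact hGx.1
  refine (Finset.sum_le_sum hpt).trans ?_
  rw [Finset.sum_comm]
  have hfin : ∀ y ∈ E, ∑ x ∈ range (16^n), (if x / LN n (tstp n k0 T y) = y / LN n (tstp n k0 T y) then
        (LL n (tstp n k0 T y))⁻¹ * (72 * C0 * σ + 8 * C0 * M y) * (if G x then ‖g x‖ else 0) else 0) ≤
      1024 * μ * (72 * C0 * σ + 8 * C0 * M y) := by
    intro y hy
    rw [← Finset.sum_filter, ← Finset.mul_sum]
    have pl := LL_pos n (tstp n k0 T y)
    have := hM0 y
    calc _ ≤ (LL n (tstp n k0 T y))⁻¹ * (72 * C0 * σ + 8 * C0 * M y) * (1024 * μ * LL n (tstp n k0 T y)) := by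
          gcongr; exact hmass y hy
      _ = _ := by field_simp
  refine (Finset.sum_le_sum hfin).trans ?_
  rw [← Finset.mul_sum, Finset.sum_add_distrib, Finset.sum_const, nsmul_eq_mul, ← Finset.mul_sum]
  have f1 : (E.card : ℝ) * (72 * C0 * σ) ≤ 144 * LL n k0 * (72 * C0 * σ) := by gcongr
  have f2 : 8 * C0 * ∑ y ∈ E, M y ≤ 8 * C0 * (4800 * C0 * σ * LL n k0) := by gcongr
  calc _ ≤ 1024 * μ * (144 * LL n k0 * (72 * C0 * σ) + 8 * C0 * (4800 * C0 * σ * LL n k0)) := by gcongr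
    _ = (10616832 * C0 + 39321600 * C0^2) * (σ * μ * LL n k0) := by ring
    _ ≤ (50000000 * C0^2) * (σ * μ * LL n k0) := by
        gcongr
        nlinarith
    _ = _ := by ring

lemma tree_lemma (D : Model n C0) {T : Finset Tile} {k0 i0 ξ r : ℕ} (hV : ∀ p ∈ T, Valid n p)
    (hr : ∀ p ∈ T, p.K % 3 = r)
    (hk0 : k0 ≤ n) (hi0 : i0 < 16^k0) (hU : ∀ p ∈ T, Under n k0 i0 ξ p) {c : Tile → ℂ} {σ μ : ℝ}
    (hσ : 0 ≤ σ) (hs : SizeLe D c T σ) {g : ℕ → ℂ} {N : ℕ → ℕ} (hμ : 0 ≤ μ) (hm : MassLe n g N T μ) :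
    ‖Lam D c g N T‖ ≤ 100000000 * C0^2 * σ * μ * LL n k0 := by
  have hC := D.hC0
  have h1 := tree_part1 D hV hk0 hi0 hU hσ (fun p hp => hs.coef hσ hV hp) hμ hm
  have h2 := tree_part2 D hV hr hk0 hi0 hU hσ hs hμ hm
  have h3 : ‖Lam D c g N T‖ ≤ ∑ x ∈ range (16^n), ‖g x‖ * ∑ p ∈ T.filter (fun p => tstp n k0 T x ≤ p.K), ‖c p * D.Θ p (N x) x‖ +
      ∑ x ∈ range (16^n), ‖g x‖ * ‖∑ p ∈ T.filter (fun p => p.K < tstp n k0 T x), c p * D.Θ p (N x) x‖ := by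
    unfold Lam
    refine (norm_sum_le _ _).trans ?_
    rw [← Finset.sum_add_distrib]
    refine Finset.sum_le_sum fun x _ => ?_
    rw [norm_mul, ← mul_add]
    refine mul_le_mul_of_nonneg_left ?_ (norm_nonneg _)
    rw [← Finset.sum_filter_add_sum_filter_not T (fun p => tstp n k0 T x ≤ p.K)]
    refine (norm_add_le _ _).trans ?_
    refine add_le_add (norm_sum_le _ _) (le_of_eq ?_)
    simp only [not_le]
  refine h3.trans ((add_le_add h1 h2).trans ?_)
  have pl := LL_pos n k0
  calc _ = (41472 * C0 + 50000000 * C0^2) * (σ * μ * LL n k0) := by ring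
    _ ≤ (100000000 * C0^2) * (σ * μ * LL n k0) := by
        gcongr
        nlinarith
    _ = _ := by ring
end Carl

namespace Carl
open Finset
open scoped Classical ComplexConjugate
variable {n : ℕ} {C0 : ℝ}

/-- the order on rectangles: `Above n q q'` iff q' is above q -/
def Above (n : ℕ) (q q' : Tile) : Prop :=
  q'.K ≤ q.K ∧ q.y n / LN n q'.K = q'.i ∧ (q'.w * 16^q'.K) / 16^q.K = q.w

/-- maximal-at-radius counting sum -/
noncomputable def Ar (n : ℕ) (g : ℕ → ℂ) (N : ℕ → ℕ) (r : ℕ) (q : Tile) : ℝ :=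
  ∑ x ∈ range (16^n), if cd n x (q.y n) ≤ 2^r * LL n q.K ∧ N x / 16^q.K = q.w then ‖g x‖ else 0

lemma cd_le_M {x y : ℕ} (hx : x < 16^n) (hy : y < 16^n) : cd n x y ≤ 16^n := by
  refine (cd_le_abs n x y).trans ?_
  have h1 : (x:ℝ) ≤ 16^n := by exact_mod_cast hx.le
  have h2 : (y:ℝ) ≤ 16^n := by exact_mod_cast hy.le
  have h3 : (0:ℝ) ≤ x := by positivity
  have h4 : (0:ℝ) ≤ y := by positivity
  rw [abs_le]; constructor <;> linarith

lemma W3_le {k x y : ℕ} (hx : x < 16^n) (hy : y < 16^n) :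
    (W n k x y)^3 ≤ 8 * ∑ r ∈ range (4*n+1), ((1:ℝ)/8)^r * (if cd n x y ≤ 2^r * LL n k then 1 else 0) := by
  have hL := LL_pos n k
  have hL1 := one_le_LL n k
  have hex : ∃ r, cd n x y ≤ 2^r * LL n k := by
    refine ⟨4*n, (cd_le_M hx hy).trans ?_⟩
    rw [pow_mul]; norm_num
    nlinarith [show (0:ℝ) < 16^n by positivity]
  set r := Nat.find hex with hr
  have s1 : cd n x y ≤ 2^r * LL n k := Nat.find_spec hex
  have s2 : r ≤ 4*n := by
    refine Nat.find_min' hex ((cd_le_M hx hy).trans ?_)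
    rw [pow_mul]; norm_num
    nlinarith [show (0:ℝ) < 16^n by positivity]
  have h1 : ((1:ℝ)/8)^r ≤ ∑ r ∈ range (4*n+1), ((1:ℝ)/8)^r * (if cd n x y ≤ 2^r * LL n k then 1 else 0) := by
    have := Finset.single_le_sum (f := fun r => ((1:ℝ)/8)^r * (if cd n x y ≤ 2^r * LL n k then 1 else 0))
      (s := range (4*n+1)) (fun i _ => by split_ifs <;> positivity) (mem_range.2 (by omega : r < 4*n+1))
    simp only [if_pos s1, mul_one] at this
    exact this
  have hp := W_pos n k x y
  have h2 : W n k x y ≤ 2 * (1/2)^r := by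
    rcases Nat.eq_zero_or_pos r with h0 | h0
    · rw [h0]; have := W_le_one n k x y; norm_num; linarith
    · have h3 := Nat.find_min hex (m := r - 1) (by omega)
      push Not at h3
      have e : (2:ℝ)^r = 2 * 2^(r-1) := by
        conv_lhs => rw [show r = (r-1)+1 by omega]
        rw [pow_succ]; ring
      have e2 : 2 * ((1:ℝ)/2)^r = 1 / 2^(r-1) := by
        rw [one_div, inv_pow, e]; field_simp
      rw [e2]
      unfold W
      rw [div_le_div_iff₀ (by linarith [cd_nonneg n x y]) (by positivity)]
      nlinarith
  have h3 : (W n k x y)^3 ≤ (2 * (1/2)^r)^3 := by gcongr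
  have h4 : (2 * ((1:ℝ)/2)^r)^3 = 8 * (1/8)^r := by
    rw [mul_pow, ← pow_mul, mul_comm r 3, pow_mul]; norm_num
  linarith

lemma mass_radius {g : ℕ → ℂ} {N : ℕ → ℕ} {μ : ℝ} (hμ : 0 < μ) {q : Tile} (hq : q.y n < 16^n)
    (h : μ * LL n q.K < massTop n g N q.K q.i (q.w * 16^q.K)) :
    ∃ r ∈ range (4*n+1), μ * 6^r * LL n q.K / 32 ≤ Ar n g N r q := by
  by_contra hcon
  push Not at hcon
  have hL := LL_pos n q.K
  have hd : q.w * 16^q.K / 16^q.K = q.w := Nat.mul_div_cancel _ (by positivity)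
  have h1 : massTop n g N q.K q.i (q.w * 16^q.K) ≤ 8 * ∑ r ∈ range (4*n+1), ((1:ℝ)/8)^r * Ar n g N r q := by
    unfold massTop Ar
    simp_rw [Finset.mul_sum]
    rw [Finset.sum_comm]
    refine Finset.sum_le_sum fun x hx => ?_
    rw [hd]
    split_ifs with h2
    · have := W3_le (k := q.K) (mem_range.1 hx) hq
      calc _ ≤ ‖g x‖ * (8 * ∑ r ∈ range (4*n+1), ((1:ℝ)/8)^r * (if cd n x (q.y n) ≤ 2^r * LL n q.K then 1 else 0)) := by
            refine mul_le_mul_of_nonneg_left this (norm_nonneg _)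
        _ = _ := by
            rw [Finset.mul_sum, Finset.mul_sum]
            refine Finset.sum_congr rfl fun r _ => ?_
            simp only [h2, and_true]
            split_ifs <;> ring
    · simp [h2]
  have h2 : ∑ r ∈ range (4*n+1), ((1:ℝ)/8)^r * Ar n g N r q ≤ ∑ r ∈ range (4*n+1), (μ * LL n q.K / 32) * (3/4)^r := by
    refine Finset.sum_le_sum fun r hr => ?_
    have e : (3/4:ℝ)^r = (1/8)^r * 6^r := by rw [← mul_pow]; norm_num
    calc _ ≤ ((1:ℝ)/8)^r * (μ * 6^r * LL n q.K / 32) := mul_le_mul_of_nonneg_left (hcon r hr).le (by positivity)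
      _ = _ := by rw [e]; ring
  rw [← Finset.mul_sum, geom_sum_eq (by norm_num)] at h2
  have h3 : ((3/4:ℝ)^(4*n+1) - 1) / (3/4 - 1) ≤ 4 := by
    have : (0:ℝ) ≤ (3/4)^(4*n+1) := by positivity
    rw [div_le_iff_of_neg (by norm_num)]; linarith
  have : (μ * LL n q.K / 32) * (((3/4:ℝ)^(4*n+1) - 1) / (3/4 - 1)) ≤ (μ * LL n q.K / 32) * 4 := by gcongr
  linarith

lemma count_ball {k y : ℕ} (hy : y < 16^n) (r : ℕ) :
    (((range (16^n)).filter (fun x => cd n x y ≤ 2^(r+2) * LL n k)).card : ℝ) ≤ 225 * 4^r * LL n k := by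
  have hL := LL_pos n k
  have h1 : ∀ x ∈ (range (16^n)).filter (fun x => cd n x y ≤ 2^(r+2) * LL n k), (1:ℝ) / (25 * 4^r) ≤ (W n k x y)^2 := by
    intro x hx
    have h2 := (mem_filter.1 hx).2
    have h3 : (1:ℝ) / (5 * 2^r) ≤ W n k x y := by
      unfold W
      rw [div_le_div_iff₀ (by positivity) (by linarith [cd_nonneg n x y])]
      have : (1:ℝ) ≤ 2^r := one_le_pow₀ (by norm_num)
      rw [pow_add] at h2
      nlinarith
    have h4 : ((1:ℝ) / (5 * 2^r))^2 ≤ (W n k x y)^2 := by gcongr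
    have e : ((1:ℝ) / (5 * 2^r))^2 = 1 / (25 * 4^r) := by
      rw [div_pow, mul_pow, ← pow_mul, mul_comm r 2, pow_mul]; norm_num
    linarith
  have h2 := Finset.sum_le_sum h1
  have h3 := (Finset.sum_le_sum_of_subset_of_nonneg (filter_subset (fun x => cd n x y ≤ 2^(r+2) * LL n k) (range (16^n))) (fun x _ _ => sq_nonneg (W n k x y))).trans (W_sum' hy)
  rw [Finset.sum_const, nsmul_eq_mul] at h2
  have h4 := h2.trans h3
  rw [mul_one_div, div_le_iff₀ (by positivity)] at h4
  linarith

/-- disjoint time intervals inside X -/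
lemma disj_sum (S : Finset Tile) (X : Finset ℕ) (hS : ∀ q ∈ S, q.K ≤ n ∧ q.i < 16^q.K)
    (hX : ∀ q ∈ S, ∀ x < 16^n, x / LN n q.K = q.i → x ∈ X)
    (hd : ∀ q ∈ S, ∀ q' ∈ S, q ≠ q' → ∀ x < 16^n, x / LN n q.K = q.i → x / LN n q'.K ≠ q'.i) :
    ∑ q ∈ S, LL n q.K ≤ X.card := by
  have h1 : (S.biUnion fun q => (range (16^n)).filter (fun x => x / LN n q.K = q.i)).card = ∑ q ∈ S, LN n q.K := by
    rw [Finset.card_biUnion]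
    · exact Finset.sum_congr rfl fun q hq => card_block (hS q hq).1 (hS q hq).2
    · intro q hq q' hq' hne
      rw [Function.onFun, Finset.disjoint_left]
      intro x hx hx'
      rw [mem_filter, mem_range] at hx hx'
      exact hd q hq q' hq' hne x hx.1 hx.2 hx'.2
  have h2 : (S.biUnion fun q => (range (16^n)).filter (fun x => x / LN n q.K = q.i)) ⊆ X := by
    intro x hx
    obtain ⟨q, hq, hx⟩ := Finset.mem_biUnion.1 hx
    rw [mem_filter, mem_range] at hx
    exact hX q hq x hx.1 hx.2
  have h3 := Finset.card_le_card h2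
  rw [h1] at h3
  have : ((∑ q ∈ S, LN n q.K : ℕ) : ℝ) ≤ X.card := by exact_mod_cast h3
  push_cast at this
  simp_rw [LN_cast] at this
  exact this

lemma mass_count {g : ℕ → ℂ} {N : ℕ → ℕ} {μ : ℝ} (hμ : 0 < μ) (Q : Finset Tile)
    (hQ : ∀ q ∈ Q, q.K ≤ n ∧ q.i < 16^q.K) (hanti : ∀ q ∈ Q, ∀ q' ∈ Q, Above n q q' → q = q') (r : ℕ)
    (hr : ∀ q ∈ Q, μ * 6^r * LL n q.K / 32 ≤ Ar n g N r q) :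
    ∑ q ∈ Q, LL n q.K ≤ 7200 * (2/3)^r * μ⁻¹ * ∑ x ∈ range (16^n), ‖g x‖ := by
  have hy : ∀ q ∈ Q, q.y n < 16^n := fun q hq => mul_LN_lt (hQ q hq).1 (hQ q hq).2
  set B : Tile → Set (ℕ × ℕ) := fun q => {s | s.1 < 16^n ∧ cd n s.1 (q.y n) ≤ 2^r * LL n q.K ∧ s.2 / 16^q.K = q.w} with hB
  obtain ⟨u, hu, hdis, hcov⟩ := Vitali.exists_disjoint_subfamily_covering_enlargement B (↑Q : Set Tile) (fun q => LL n q.K) 2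
    (by norm_num) (fun q _ => (LL_pos n q.K).le) (16^n) (fun q _ => by
      unfold LL; exact pow_le_pow_right₀ (by norm_num) (by omega))
    (fun q hq => by
      refine ⟨(q.y n, q.w * 16^q.K), hy q hq, ?_, Nat.mul_div_cancel _ (by positivity)⟩
      simp only [cd_self]
      have := LL_pos n q.K
      positivity)
  have hfin : u.Finite := Q.finite_toSet.subset hu
  set U := hfin.toFinset with hU
  have hUmem : ∀ b, b ∈ U ↔ b ∈ u := fun b => hfin.mem_toFinset
  choose! β hβ using hcov
  have hk : ∀ a ∈ Q, (β a).K ≤ a.K := by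
    intro a ha
    by_contra hlt
    push Not at hlt
    have h1 := (hβ a ha).2.2
    have hbQ : β a ∈ Q := hu (hβ a ha).1
    have h2 := (hQ _ hbQ).1
    have h3 := LL_ratio (n := n) hlt.le h2
    have h4 := LL_pos n a.K
    have h5 : ((1:ℝ)/16)^((β a).K - a.K) ≤ (1/16)^1 := pow_le_pow_of_le_one (by norm_num) (by norm_num) (by omega)
    nlinarith
  have hL : ∀ a ∈ Q, LL n a.K ≤ LL n (β a).K := fun a ha => LL_anti (hk a ha)
  have hω : ∀ a ∈ Q, ((β a).w * 16^(β a).K) / 16^a.K = a.w := by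
    intro a ha
    obtain ⟨s, hs1, hs2⟩ := (hβ a ha).2.1
    have h1 : s.2 / 16^(β a).K = ((β a).w * 16^(β a).K) / 16^(β a).K := by
      rw [Nat.mul_div_cancel _ (by positivity)]; exact hs2.2.2
    rw [← nest_freq (hk a ha) h1]; exact hs1.2.2
  have step : ∑ q ∈ Q, LL n q.K ≤ ∑ b ∈ U, 225 * 4^r * LL n b.K := by
    rw [← Finset.sum_fiberwise_of_maps_to (s := Q) (t := U) (g := β) (fun a ha => (hUmem _).2 (hβ a ha).1)]
    refine Finset.sum_le_sum fun b hb => ?_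
    have hbQ : b ∈ Q := hu ((hUmem b).1 hb)
    refine (disj_sum (n := n) (Q.filter (fun a => β a = b)) ((range (16^n)).filter (fun x => cd n x (b.y n) ≤ 2^(r+2) * LL n b.K)) ?_ ?_ ?_).trans (count_ball (hy b hbQ) r)
    · intro a ha; exact hQ a (mem_filter.1 ha).1
    · intro a ha x hx hxa
      rw [mem_filter] at ha
      obtain ⟨ha, rfl⟩ := ha
      rw [mem_filter, mem_range]
      refine ⟨hx, ?_⟩
      obtain ⟨s, hs1, hs2⟩ := (hβ a ha).2.1
      have d1 := hs1.2.1
      have d2 := hs2.2.1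
      have d3 := cd_lt_of_div (n := n) (x := x) (x' := a.y n) (K := a.K) (by rw [hxa, y_div])
      have d4 := cd_tri n x (a.y n) ((β a).y n)
      have d5 := cd_tri n (a.y n) s.1 ((β a).y n)
      rw [cd_comm n (a.y n) s.1] at d5
      have d6 := hL a ha
      have : (1:ℝ) ≤ 2^r := one_le_pow₀ (by norm_num)
      rw [pow_add]
      have := LL_pos n (β a).K
      nlinarith
    · intro a ha a' ha' hne x hx hxa hxa'
      rw [mem_filter] at ha ha'
      have w1 := hω a ha.1
      have w2 := hω a' ha'.1
      rw [ha.2] at w1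
      rw [ha'.2] at w2
      have aux : ∀ a ∈ Q, ∀ a' ∈ Q, x / LN n a.K = a.i → x / LN n a'.K = a'.i → (b.w * 16^b.K) / 16^a.K = a.w → (b.w * 16^b.K) / 16^a'.K = a'.w → a'.K ≤ a.K → a = a' := by
        intro a ha a' ha' h1 h2 h3 h4 h5
        refine hanti a ha a' ha' ⟨h5, ?_, ?_⟩
        · rw [← h2]
          exact nest_time h5 (hQ a ha).1 (by rw [y_div, h1])
        · rw [← h3]
          exact nest_freq h5 (by rw [Nat.mul_div_cancel _ (by positivity), h4])
      rcases le_total a'.K a.K with h | h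
      · exact hne (aux a ha.1 a' ha'.1 hxa hxa' w1 w2 h)
      · exact hne (aux a' ha'.1 a ha.1 hxa' hxa w2 w1 h).symm
  refine step.trans ?_
  have h2 : ∑ b ∈ U, 225 * 4^r * LL n b.K ≤ ∑ b ∈ U, (7200 * (2/3)^r * μ⁻¹) * Ar n g N r b := by
    refine Finset.sum_le_sum fun b hb => ?_
    have hbQ : b ∈ Q := hu ((hUmem b).1 hb)
    have h3 := hr b hbQ
    calc (225 * 4^r * LL n b.K : ℝ) = (7200 * (2/3)^r * μ⁻¹) * (μ * 6^r * LL n b.K / 32) := by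
          have : (4:ℝ)^r = (2/3)^r * 6^r := by rw [← mul_pow]; norm_num
          rw [this]; field_simp; ring
      _ ≤ _ := by gcongr
  refine h2.trans ?_
  rw [← Finset.mul_sum]
  refine mul_le_mul_of_nonneg_left ?_ (by positivity)
  unfold Ar
  rw [Finset.sum_comm]
  refine Finset.sum_le_sum fun x hx => ?_
  rw [mem_range] at hx
  by_cases hex : ∃ b ∈ U, cd n x (b.y n) ≤ 2^r * LL n b.K ∧ N x / 16^b.K = b.w
  · obtain ⟨b, hb, hb2⟩ := hex
    rw [Finset.sum_eq_single b]
    · rw [if_pos hb2]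
    · intro b' hb' hne
      rw [if_neg]
      intro hb2'
      have := hdis ((hUmem b').1 hb') ((hUmem b).1 hb) hne
      rw [Function.onFun, Set.disjoint_left] at this
      exact this (a := (x, N x)) ⟨hx, hb2'.1, hb2'.2⟩ ⟨hx, hb2.1, hb2.2⟩
    · exact fun h => absurd hb h
  · push Not at hex
    rw [Finset.sum_eq_zero]
    · exact norm_nonneg _
    · intro b hb
      rw [if_neg]
      exact fun h => hex b hb h.1 h.2

lemma Above.trans {a b c : Tile} (hK : a.K ≤ n) (h1 : Above n a b) (h2 : Above n b c) : Above n a c := by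
  refine ⟨h2.1.trans h1.1, ?_, ?_⟩
  · rw [← h2.2.1]
    exact nest_time h2.1 (h1.1.trans hK) (by rw [h1.2.1, y_div])
  · rw [← h1.2.2]
    exact nest_freq h1.1 (by rw [h2.2.2, Nat.mul_div_cancel _ (by positivity)])

/-- Mass lemma -/
lemma mass_lemma {g : ℕ → ℂ} {N : ℕ → ℕ} (hN : ∀ x < 16^n, N x < 16^n) (hg : ∀ x < 16^n, ‖g x‖ ≤ 1)
    {μ : ℝ} (hμ : 0 < μ) (P : Finset Tile) (hV : ∀ p ∈ P, Valid n p) :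
    ∃ l : List (ℕ × ℕ × ℕ), (∀ t ∈ l, t.1 ≤ n ∧ t.2.1 < 16^t.1) ∧
      (l.map (fun t => LL n t.1)).sum ≤ 21600 * μ⁻¹ * 16^n ∧
      MassLe n g N (P.filter (fun p => ∀ t ∈ l, ¬ Under n t.1 t.2.1 t.2.2 p)) μ := by
  -- candidates
  have hfin : {q : Tile | (q.K ≤ n ∧ q.i < 16^q.K) ∧ q.w < 16^n ∧ μ * LL n q.K < massTop n g N q.K q.i (q.w * 16^q.K)}.Finite := by
    refine Set.Finite.subset (((Finset.range (n+1) ×ˢ Finset.range (16^n) ×ˢ Finset.range (16^n)).image (fun s : ℕ × ℕ × ℕ => (⟨s.1, s.2.1, s.2.2⟩ : Tile))).finite_toSet) ?_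
    intro q hq
    simp only [Set.mem_setOf_eq] at hq
    rw [Finset.mem_coe, Finset.mem_image]
    refine ⟨(q.K, q.i, q.w), ?_, rfl⟩
    simp only [Finset.mem_product, mem_range]
    exact ⟨by omega, hq.1.2.trans_le (Nat.pow_le_pow_right (by norm_num) hq.1.1), hq.2.1⟩
  set Cand := hfin.toFinset with hCand
  have hCm : ∀ q, q ∈ Cand ↔ (q.K ≤ n ∧ q.i < 16^q.K) ∧ q.w < 16^n ∧ μ * LL n q.K < massTop n g N q.K q.i (q.w * 16^q.K) :=
    fun q => hfin.mem_toFinset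
  set Q := Cand.filter (fun q => ∀ q' ∈ Cand, Above n q q' → q = q') with hQ
  have hQb : ∀ q ∈ Q, q.K ≤ n ∧ q.i < 16^q.K := fun q hq => ((hCm q).1 (mem_filter.1 hq).1).1
  have hcov : ∀ q ∈ Cand, ∃ q' ∈ Q, Above n q q' := by
    intro q hq
    have hrefl : Above n q q := ⟨le_rfl, y_div n q, Nat.mul_div_cancel _ (by positivity)⟩
    obtain ⟨m, hm, hmin⟩ := Finset.exists_min_image (Cand.filter (fun q' => Above n q q')) (fun q => q.K) ⟨q, mem_filter.2 ⟨hq, hrefl⟩⟩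
    rw [mem_filter] at hm
    refine ⟨m, ?_, hm.2⟩
    rw [hQ, mem_filter]
    refine ⟨hm.1, fun q' hq' hab => ?_⟩
    have h1 := hmin q' (mem_filter.2 ⟨hq', hm.2.trans ((hCm q).1 hq).1.1 hab⟩)
    have hKe : q'.K = m.K := le_antisymm hab.1 h1
    have h2 := hab.2.1
    have h3 := hab.2.2
    rw [hKe, y_div] at h2
    rw [hKe, Nat.mul_div_cancel _ (by positivity)] at h3
    exact Tile.ext' hKe.symm h2 h3.symm
  refine ⟨Q.toList.map (fun q => (q.K, q.i, q.w * 16^q.K)), ?_, ?_, ?_⟩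
  · intro t ht
    rw [List.mem_map] at ht
    obtain ⟨q, hq, rfl⟩ := ht
    exact hQb q (Finset.mem_toList.1 hq)
  · rw [List.map_map]
    have e : (List.map ((fun t : ℕ × ℕ × ℕ => LL n t.1) ∘ fun q : Tile => (q.K, q.i, q.w * 16^q.K)) Q.toList).sum = ∑ q ∈ Q, LL n q.K := by
      rw [← Finset.sum_map_toList]; rfl
    rw [e]
    have h1 : ∀ q ∈ Q, ∃ r ∈ range (4*n+1), μ * 6^r * LL n q.K / 32 ≤ Ar n g N r q := fun q hq =>
      mass_radius hμ (mul_LN_lt (hQb q hq).1 (hQb q hq).2) ((hCm q).1 (mem_filter.1 hq).1).2.2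
    choose! ρ hρ using h1
    rw [← Finset.sum_fiberwise_of_maps_to (s := Q) (t := range (4*n+1)) (g := ρ) (fun q hq => (hρ q hq).1)]
    have h2 : ∀ r ∈ range (4*n+1), ∑ q ∈ Q.filter (fun q => ρ q = r), LL n q.K ≤ (2/3)^r * (7200 * μ⁻¹ * 16^n) := by
      intro r _
      refine (mass_count (g := g) (N := N) hμ (Q.filter (fun q => ρ q = r)) (fun q hq => hQb q (mem_filter.1 hq).1)
        (fun q hq q' hq' hab => (mem_filter.1 (mem_filter.1 hq).1).2 q' (mem_filter.1 (mem_filter.1 hq').1).1 hab) r ?_).trans ?_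
      · intro q hq
        rw [mem_filter] at hq
        obtain ⟨hq, rfl⟩ := hq
        exact (hρ q hq).2
      · have h3 : ∑ x ∈ range (16^n), ‖g x‖ ≤ 16^n := by
          refine (Finset.sum_le_sum (fun x hx => hg x (mem_range.1 hx))).trans ?_
          simp
        calc _ ≤ 7200 * (2/3)^r * μ⁻¹ * 16^n := by gcongr
          _ = _ := by ring
    refine (Finset.sum_le_sum h2).trans ?_
    rw [← Finset.sum_mul, geom_sum_eq (by norm_num)]
    have h3 : ((2/3:ℝ)^(4*n+1) - 1) / (2/3 - 1) ≤ 3 := by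
      have : (0:ℝ) ≤ (2/3)^(4*n+1) := by positivity
      rw [div_le_iff_of_neg (by norm_num)]; linarith
    calc _ ≤ 3 * (7200 * μ⁻¹ * 16^n) := by gcongr
      _ = _ := by ring
  · intro p hp k i ξ hU
    rw [mem_filter] at hp
    by_contra hgt
    push Not at hgt
    have hkn : k ≤ n := hU.1.trans (hV p hp.1).K_le
    have hmp : 0 < massTop n g N k i ξ := lt_of_le_of_lt (by have := LL_pos n k; positivity) hgt
    obtain ⟨x, hx, hne⟩ := Finset.exists_ne_zero_of_sum_ne_zero hmp.ne'
    have hNx : N x / 16^k = ξ / 16^k := by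
      by_contra h; exact hne (if_neg h)
    have hν : ξ / 16^k < 16^n := by
      rw [← hNx]; exact (Nat.div_le_self _ _).trans_lt (hN x (mem_range.1 hx))
    have hc : (⟨k, i, ξ / 16^k⟩ : Tile) ∈ Cand := by
      rw [hCm]
      refine ⟨⟨hkn, ?_⟩, hν, ?_⟩
      · rw [← hU.2.1]; exact div_lt_of hkn (hV p hp.1).y_lt
      · refine hgt.trans_le (le_of_eq ?_)
        unfold massTop
        simp only [Nat.mul_div_cancel _ (show 0 < 16^k by positivity)]
    obtain ⟨q', hq', hab⟩ := hcov _ hc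
    refine hp.2 (q'.K, q'.i, q'.w * 16^q'.K) (List.mem_map.2 ⟨q', Finset.mem_toList.2 hq', rfl⟩) ?_
    refine ⟨hab.1.trans hU.1, ?_, ?_⟩
    · rw [← hab.2.1]
      exact nest_time hab.1 hkn (by rw [hU.2.1]; exact (mul_LN_div _ _ _).symm)
    · rw [← hU.2.2]
      exact nest_freq hU.1 hab.2.2
end Carl

namespace Carl
open Finset
open scoped Classical ComplexConjugate
variable {n : ℕ} {C0 : ℝ}

/-- selection of trees for the size lemma -/
lemma size_select (D : Model n C0) (c : Tile → ℂ) {σ : ℝ} (m : ℕ) : ∀ (P : Finset Tile), P.card ≤ m →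
    ∃ (l : List (ℕ × ℕ × ℕ)) (U : Finset Tile) (top : Tile → ℕ × ℕ × ℕ), U ⊆ P ∧
      (∀ t ∈ l, t.1 ≤ n ∧ t.2.1 < 16^t.1) ∧
      (∀ p ∈ U, Under n (top p).1 (top p).2.1 (top p).2.2 p ∧ Lac D (top p).2.2 p ∧ (top p).1 ≤ n ∧
        (top p).2.1 < 16^(top p).1 ∧
        σ^2 * LL n (top p).1 < ∑ q ∈ P.filter (fun q => Under n (top p).1 (top p).2.1 (top p).2.2 q ∧ Lac D (top p).2.2 q), LL n q.K * ‖c q‖^2) ∧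
      (∀ p ∈ U, ∀ q ∈ U, (top p).2.2 < (top q).2.2 → ¬ Under n (top p).1 (top p).2.1 (top p).2.2 q) ∧
      σ^2 * (l.map (fun t => LL n t.1)).sum ≤ ∑ p ∈ U, LL n p.K * ‖c p‖^2 ∧
      (∀ (F : ℕ × ℕ × ℕ → Tile → ℝ) (B : ℝ), (∀ (t : ℕ × ℕ × ℕ), t.1 ≤ n → t.2.1 < 16^t.1 → ∀ T ⊆ P, (∀ p ∈ T, Under n t.1 t.2.1 t.2.2 p) →
        ∑ p ∈ T, F t p ≤ B * LL n t.1) → ∑ p ∈ U, F (top p) p ≤ B * (l.map (fun t => LL n t.1)).sum) ∧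
      SizeLe D c (P.filter (fun p => ∀ t ∈ l, ¬ Under n t.1 t.2.1 t.2.2 p)) σ := by
  induction m with
  | zero =>
    intro P hP
    have : P = ∅ := by simpa using hP
    subst this
    refine ⟨[], ∅, fun _ => (0,0,0), by simp, by simp, by simp, by simp, by simp, by simp, ?_⟩
    intro k i ξ _ _
    have := LL_pos n k
    simp; positivity
  | succ m ih =>
    intro P hP
    by_cases hs : SizeLe D c P σ
    · refine ⟨[], ∅, fun _ => (0,0,0), by simp, by simp, by simp, by simp, by simp, by simp, ?_⟩
      simpa using hs
    · have hex : ∃ ξ, ∃ k i, k ≤ n ∧ i < 16^k ∧ σ^2 * LL n k < ∑ q ∈ P.filter (fun q => Under n k i ξ q ∧ Lac D ξ q), LL n q.K * ‖c q‖^2 := by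
        unfold SizeLe at hs
        push Not at hs
        obtain ⟨k, i, ξ, h1, h2, h3⟩ := hs
        exact ⟨ξ, k, i, h1, h2, h3⟩
      set ξ := Nat.find hex with hξ
      obtain ⟨k, i, hk, hi, hb⟩ := Nat.find_spec hex
      rw [← hξ] at hb
      have hmin : ∀ ξ', (∃ k i, k ≤ n ∧ i < 16^k ∧ σ^2 * LL n k < ∑ q ∈ P.filter (fun q => Under n k i ξ' q ∧ Lac D ξ' q), LL n q.K * ‖c q‖^2) → ξ ≤ ξ' := fun ξ' h => Nat.find_min' hex h
      set T := P.filter (fun q => Under n k i ξ q ∧ Lac D ξ q) with hT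
      set P' := P.filter (fun q => ¬ Under n k i ξ q) with hP'
      have hsub : P' ⊆ P := filter_subset _ _
      have hTne : T.Nonempty := by
        rw [Finset.nonempty_iff_ne_empty]
        intro h
        rw [h, sum_empty] at hb
        have := LL_pos n k
        have : 0 ≤ σ^2 * LL n k := by positivity
        linarith
      have hcard : P'.card ≤ m := by
        obtain ⟨p, hp⟩ := hTne
        have hp' := mem_filter.1 hp
        have : P'.card < P.card := Finset.card_lt_card (Finset.ssubset_iff_of_subset hsub |>.2 ⟨p, hp'.1, fun h => (mem_filter.1 h).2 hp'.2.1⟩)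
        omega
      obtain ⟨l, U, top, h1, h2, h3, h4, h5, h6, h7⟩ := ih P' hcard
      have hd : Disjoint T U := by
        rw [Finset.disjoint_left]
        intro p hp hp'
        exact (mem_filter.1 (h1 hp')).2 (mem_filter.1 hp).2.1
      set top' : Tile → ℕ × ℕ × ℕ := fun p => if p ∈ T then (k, i, ξ) else top p with htop'
      have ht1 : ∀ p ∈ T, top' p = (k, i, ξ) := fun p hp => if_pos hp
      have ht2 : ∀ p ∈ U, top' p = top p := fun p hp => if_neg (fun h => Finset.disjoint_left.1 hd h hp)
      have hge : ∀ p ∈ U, σ^2 * LL n (top p).1 < ∑ q ∈ P.filter (fun q => Under n (top p).1 (top p).2.1 (top p).2.2 q ∧ Lac D (top p).2.2 q), LL n q.K * ‖c q‖^2 := by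
        intro p hp
        refine (h3 p hp).2.2.2.2.trans_le (Finset.sum_le_sum_of_subset_of_nonneg (filter_subset_filter _ hsub) ?_)
        intro q _ _; have := LL_pos n q.K; positivity
      refine ⟨(k,i,ξ) :: l, T ∪ U, top', ?_, ?_, ?_, ?_, ?_, ?_, ?_⟩
      · exact Finset.union_subset (filter_subset _ _) (h1.trans hsub)
      · intro t ht
        rcases List.mem_cons.1 ht with rfl | ht
        · exact ⟨hk, hi⟩
        · exact h2 t ht
      · intro p hp
        rcases mem_union.1 hp with hp | hp
        · rw [ht1 p hp]
          exact ⟨(mem_filter.1 hp).2.1, (mem_filter.1 hp).2.2, hk, hi, hb⟩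
        · rw [ht2 p hp]
          have := h3 p hp
          exact ⟨this.1, this.2.1, this.2.2.1, this.2.2.2.1, hge p hp⟩
      · intro p hp q hq
        rcases mem_union.1 hp with hp | hp <;> rcases mem_union.1 hq with hq | hq
        · rw [ht1 p hp, ht1 q hq]; intro h; exact absurd h (lt_irrefl _)
        · rw [ht1 p hp]; intro _; exact (mem_filter.1 (h1 hq)).2
        · rw [ht2 p hp, ht1 q hq]
          intro h
          have := hmin _ ⟨_, _, (h3 p hp).2.2.1, (h3 p hp).2.2.2.1, hge p hp⟩
          exact absurd h (not_lt.2 this)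
        · rw [ht2 p hp, ht2 q hq]; exact h4 p hp q hq
      · rw [sum_union hd, List.map_cons, List.sum_cons, mul_add]
        exact add_le_add hb.le h5
      · intro F B hF
        rw [sum_union hd, List.map_cons, List.sum_cons, mul_add]
        refine add_le_add ?_ ?_
        · rw [Finset.sum_congr rfl (fun p hp => by rw [ht1 p hp])]
          exact hF (k,i,ξ) hk hi T (filter_subset _ _) (fun p hp => (mem_filter.1 hp).2.1)
        · rw [Finset.sum_congr rfl (fun p hp => by rw [ht2 p hp])]
          exact h6 F B (fun t a b T' hT' => hF t a b T' (hT'.trans hsub))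
      · have e : P.filter (fun p => ∀ t ∈ (k,i,ξ) :: l, ¬ Under n t.1 t.2.1 t.2.2 p) = P'.filter (fun p => ∀ t ∈ l, ¬ Under n t.1 t.2.1 t.2.2 p) := by
          ext p; simp only [hP', mem_filter, List.forall_mem_cons]; tauto
        rw [e]; exact h7

/-- inner product bound -/
lemma ip_bound (D : Model n C0) {p q : Tile} (hp : Valid n p) (hq : Valid n q) (h : p.K ≤ q.K) :
    ‖∑ x ∈ range (16^n), D.φ p x * conj (D.φ q x)‖ ≤ 9 * C0^2 * (LL n p.K)⁻¹ * (W n p.K (p.y n) (q.y n))^4 := by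
  have hC := D.hC0
  have l1 := LL_pos n p.K
  have l2 := LL_pos n q.K
  have key : ∀ x ∈ range (16^n), ‖D.φ p x * conj (D.φ q x)‖ ≤
      C0^2 * (LL n p.K)⁻¹ * (LL n q.K)⁻¹ * (W n p.K (p.y n) (q.y n))^4 * (W n q.K x (q.y n))^2 := by
    intro x hx
    rw [mem_range] at hx
    have a1 := D.phi_le p hp x hx
    have a2 := D.phi_le q hq x hx
    rw [norm_mul, RCLike.norm_conj]
    refine (mul_le_mul a1 a2 (norm_nonneg _) (by have := W_pos n p.K x (p.y n); positivity)).trans ?_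
    have b1 := W_mul_le (n := n) h (q.y n) x (p.y n)
    rw [W_comm n q.K (q.y n) x, W_comm n p.K (q.y n)] at b1
    have w1 := W_pos n p.K x (p.y n)
    have w2 := W_pos n q.K x (q.y n)
    have w1' := W_le_one n p.K x (p.y n)
    have w2' := W_le_one n q.K x (q.y n)
    have b2 : (W n q.K x (q.y n) * W n p.K x (p.y n))^4 ≤ (W n p.K (p.y n) (q.y n))^4 := by gcongr
    have b3 : (W n p.K x (p.y n))^4 ≤ 1 := pow_le_one₀ w1.le w1'
    have b4 : (W n q.K x (q.y n))^4 ≤ (W n q.K x (q.y n))^2 := pow_le_pow_of_le_one w2.le w2' (by norm_num)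
    calc C0 * (LL n p.K)⁻¹ * W n p.K x (p.y n) ^ 8 * (C0 * (LL n q.K)⁻¹ * W n q.K x (q.y n) ^ 8)
        = C0^2 * (LL n p.K)⁻¹ * (LL n q.K)⁻¹ * (((W n q.K x (q.y n) * W n p.K x (p.y n))^4) * ((W n p.K x (p.y n))^4 * (W n q.K x (q.y n))^4)) := by ring
      _ ≤ C0^2 * (LL n p.K)⁻¹ * (LL n q.K)⁻¹ * ((W n p.K (p.y n) (q.y n))^4 * (1 * (W n q.K x (q.y n))^2)) := by
          gcongr
      _ = _ := by ring
  refine (norm_sum_le _ _).trans ((Finset.sum_le_sum key).trans ?_)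
  rw [← Finset.mul_sum]
  have := W_sum' (n := n) (K := q.K) hq.y_lt
  have w := W_pos n p.K (p.y n) (q.y n)
  calc _ ≤ C0^2 * (LL n p.K)⁻¹ * (LL n q.K)⁻¹ * (W n p.K (p.y n) (q.y n))^4 * (9 * LL n q.K) := by gcongr
    _ = _ := by field_simp

/-- outside sum -/
noncomputable def Out (n : ℕ) (t : ℕ × ℕ × ℕ) (K y : ℕ) : ℝ :=
  ∑ x ∈ (range (16^n)).filter (fun x => x / LN n t.1 ≠ t.2.1), (W n K y x)^4

lemma Out_nonneg (n : ℕ) (t : ℕ × ℕ × ℕ) (K y : ℕ) : 0 ≤ Out n t K y :=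
  Finset.sum_nonneg fun x _ => by have := W_pos n K y x; positivity

lemma out_tree {t : ℕ × ℕ × ℕ} (ht : t.1 ≤ n) (hi : t.2.1 < 16^t.1) {T : Finset Tile} (hV : ∀ p ∈ T, Valid n p)
    (hU : ∀ p ∈ T, Under n t.1 t.2.1 t.2.2 p) : ∑ p ∈ T, Out n t p.K (p.y n) ≤ 5184 * LL n t.1 := by
  have h := tree_sum (n := n) (ξ := t.2.2) hV (fun p hp => (hU p hp).2.2)
    (fun K i => if t.1 ≤ K ∧ (i * LN n K) / LN n t.1 = t.2.1 then Out n t K (i * LN n K) else 0)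
    (fun K i => by split_ifs; exacts [Out_nonneg _ _ _ _, le_rfl])
  have e : ∑ p ∈ T, Out n t p.K (p.y n) = ∑ p ∈ T, (if t.1 ≤ p.K ∧ (p.i * LN n p.K) / LN n t.1 = t.2.1 then Out n t p.K (p.i * LN n p.K) else 0) := by
    refine Finset.sum_congr rfl fun p hp => ?_
    rw [if_pos ⟨(hU p hp).1, (hU p hp).2.1⟩]; rfl
  rw [e]
  refine h.trans ?_
  have hL := LL_pos n t.1
  have key : ∀ K ∈ range n, ∑ i ∈ range (16^K), (if t.1 ≤ K ∧ (i * LN n K) / LN n t.1 = t.2.1 then Out n t K (i * LN n K) else 0)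
      ≤ 2592 * LL n t.1 * (if t.1 ≤ K then ((1:ℝ)/16)^(K-t.1) else 0) := by
    intro K hK
    rw [mem_range] at hK
    by_cases hk : t.1 ≤ K
    · rw [if_pos hk, ← Finset.sum_filter]
      have hLK := LL_pos n K
      have g := grid_sum (n := n) (K := K) hK.le ((range (16^K)).filter (fun i => t.1 ≤ K ∧ (i * LN n K) / LN n t.1 = t.2.1))
        (fun i hi => mem_range.1 (mem_filter.1 hi).1) (fun i => Out n t K (i * LN n K))
        (fun y => if y / LN n t.1 = t.2.1 then 16 * Out n t K y else 0) ?_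
      · have g2 : ∑ y ∈ (range (16^n)).filter (fun y => y / LN n K ∈ (range (16^K)).filter (fun i => t.1 ≤ K ∧ (i * LN n K) / LN n t.1 = t.2.1)),
            (if y / LN n t.1 = t.2.1 then 16 * Out n t K y else 0) ≤ 16 * (162 * (LL n K)^2) := by
          refine le_trans (Finset.sum_le_sum_of_subset_of_nonneg (filter_subset _ _) ?_) ?_
          · intro y _ _
            have := Out_nonneg n t K y
            split_ifs <;> positivity
          · rw [← Finset.sum_filter, ← Finset.mul_sum]
            exact mul_le_mul_of_nonneg_left (W6 ht hi) (by norm_num)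
        have g3 := g.trans g2
        rw [LL_ratio hk hK.le] at g3
        rw [LL_ratio hk hK.le] at hLK
        have : ∑ i ∈ (range (16^K)).filter (fun i => t.1 ≤ K ∧ (i * LN n K) / LN n t.1 = t.2.1), Out n t K (i * LN n K) ≤ 2592 * ((1/16)^(K-t.1) * LL n t.1) := by
          refine le_of_mul_le_mul_left ?_ hLK
          linarith
        linarith
      · intro i hi' y hy e
        obtain ⟨_, _, hi2⟩ := mem_filter.1 hi'
        have e2 : i * LN n K / LN n K = y / LN n K := by rw [mul_LN_div, e]
        have e3 := nest_time hk hK.le e2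
        rw [if_pos (by rw [← e3, hi2])]
        unfold Out
        rw [Finset.mul_sum]
        refine Finset.sum_le_sum fun x _ => ?_
        have := W_le_two (n := n) (J := K) le_rfl e2 x
        have w := W_pos n K (i * LN n K) x
        calc _ ≤ (2 * W n K y x)^4 := by gcongr
          _ = _ := by ring
    · rw [if_neg hk]
      refine le_of_eq ?_
      rw [mul_zero]
      refine Finset.sum_eq_zero fun i _ => ?_
      rw [if_neg (fun h => hk h.1)]
  refine (Finset.sum_le_sum key).trans ?_
  rw [← Finset.mul_sum]
  have := geo n t.1
  nlinarith

/-- key separation claim -/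
lemma sep_claim (D : Model n C0) {U : Finset Tile} {top : Tile → ℕ × ℕ × ℕ}
    (h3 : ∀ p ∈ U, Under n (top p).1 (top p).2.1 (top p).2.2 p ∧ Lac D (top p).2.2 p)
    (h4 : ∀ p ∈ U, ∀ q ∈ U, (top p).2.2 < (top q).2.2 → ¬ Under n (top p).1 (top p).2.1 (top p).2.2 q)
    {a b : Tile} (ha : a ∈ U) (hb : b ∈ U) (hK : a.K + 3 ≤ b.K) {s : ℕ} (s1 : s / 16^a.K = a.w)
    (s2 : s / 16^b.K = b.w) (s3 : s + 2 * 16^(b.K-2) ≤ D.z b.K b.w) : b.y n / LN n (top a).1 ≠ (top a).2.1 := by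
  intro hcon
  obtain ⟨⟨u1, u2, u3⟩, _⟩ := h3 a ha
  obtain ⟨_, v⟩ := h3 b hb
  have e : (top a).2.2 / 16^a.K = s / 16^a.K := by rw [u3, s1]
  have hlt : (top a).2.2 < (top b).2.2 := by
    have h1 : (top a).2.2 < s + 16^a.K := by
      have := Nat.div_add_mod (top a).2.2 (16^a.K)
      have h2 := Nat.div_add_mod s (16^a.K)
      have h3 := Nat.mod_lt (top a).2.2 (show 0 < 16^a.K by positivity)
      rw [e] at this
      omega
    have h2 : 16^a.K ≤ 16^(b.K-2) := Nat.pow_le_pow_right (by norm_num) (by omega)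
    unfold Lac at v
    have v' := (abs_lt.1 v).1
    have s3' : (s:ℤ) + 2 * 16^(b.K-2) ≤ (D.z b.K b.w : ℤ) := by exact_mod_cast s3
    have h2' : (16:ℤ)^a.K ≤ 16^(b.K-2) := by exact_mod_cast h2
    have h1' : ((top a).2.2 : ℤ) < s + 16^a.K := by exact_mod_cast h1
    have : ((top a).2.2 : ℤ) < (top b).2.2 := by linarith
    exact_mod_cast this
  refine h4 a ha b hb hlt ⟨by omega, hcon, ?_⟩
  rw [nest_freq (by omega : a.K ≤ b.K) e, s2]

lemma off_sum (D : Model n C0) {U : Finset Tile} {top : Tile → ℕ × ℕ × ℕ} {r : ℕ}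
    (hV : ∀ p ∈ U, Valid n p) (hr : ∀ p ∈ U, p.K % 3 = r)
    (h3 : ∀ p ∈ U, Under n (top p).1 (top p).2.1 (top p).2.2 p ∧ Lac D (top p).2.2 p)
    (h4 : ∀ p ∈ U, ∀ q ∈ U, (top p).2.2 < (top q).2.2 → ¬ Under n (top p).1 (top p).2.1 (top p).2.2 q)
    {p : Tile} (hp : p ∈ U) :
    ∑ q ∈ U.filter (fun q => p.K < q.K ∧ ∑ x ∈ range (16^n), D.φ p x * conj (D.φ q x) ≠ 0),
      LL n q.K * (W n p.K (p.y n) (q.y n))^4 ≤ 16 * Out n (top p) p.K (p.y n) := by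
  set Q := U.filter (fun q => p.K < q.K ∧ ∑ x ∈ range (16^n), D.φ p x * conj (D.φ q x) ≠ 0) with hQ
  set I : Tile → Finset ℕ := fun q => (range (16^n)).filter (fun x => x / LN n q.K = q.i) with hI
  have spec : ∀ q ∈ Q, q ∈ U ∧ p.K + 3 ≤ q.K ∧ ∃ s, s / 16^p.K = p.w ∧ s / 16^q.K = q.w ∧ s + 2 * 16^(q.K-2) ≤ D.z q.K q.w := by
    intro q hq
    obtain ⟨a, b, d⟩ := mem_filter.1 hq
    refine ⟨a, ?_, ?_⟩
    · have := hr p hp; have := hr q a; omega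
    · obtain ⟨s, s1, s2, _, s4⟩ := D.phi_orth p q (hV p hp) (hV q a) d
      exact ⟨s, s1, s2, s4⟩
  have hdis : ∀ q ∈ Q, ∀ q' ∈ Q, q.K ≤ q'.K → q ≠ q' → Disjoint (I q) (I q') := by
    intro q hq q' hq' hle hne
    obtain ⟨a, b, s, s1, s2, s3⟩ := spec q hq
    obtain ⟨a', b', s', s1', s2', s3'⟩ := spec q' hq'
    rw [Finset.disjoint_left]
    intro y hy hy'
    have hy := (mem_filter.1 hy).2
    have hy' := (mem_filter.1 hy').2
    have ess : s / 16^q.K = s' / 16^q.K := nest_freq (by omega : p.K ≤ q.K) (s1.trans s1'.symm)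
    rcases eq_or_lt_of_le hle with h | h
    · refine hne (Tile.ext' h ?_ ?_)
      · rw [← hy, ← hy', h]
      · rw [← s2, ← s2', ess, h]
    · have hK : q.K + 3 ≤ q'.K := by have := hr q a; have := hr q' a'; omega
      refine sep_claim D h3 h4 a a' hK (s := s') (by rw [← ess, s2]) s2' s3' ?_
      obtain ⟨⟨u1, u2, u3⟩, _⟩ := h3 q a
      have e1 : q'.y n / LN n q'.K = y / LN n q'.K := by rw [y_div, hy']
      have e2 := nest_time (by omega : q.K ≤ q'.K) (hV q' a').K_le e1
      have e3 : q'.y n / LN n q.K = q.y n / LN n q.K := by rw [e2, hy, y_div]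
      rw [nest_time u1 (hV q a).K_le e3, u2]
  have hpd : (Q : Set Tile).PairwiseDisjoint I := by
    intro q hq q' hq' hne
    rcases le_total q.K q'.K with h | h
    · exact hdis q hq q' hq' h hne
    · exact (hdis q' hq' q hq h hne.symm).symm
  have one : ∀ q ∈ Q, LL n q.K * (W n p.K (p.y n) (q.y n))^4 ≤ ∑ x ∈ I q, 16 * (W n p.K (p.y n) x)^4 := by
    intro q hq
    obtain ⟨a, b, _⟩ := spec q hq
    have := Finset.card_nsmul_le_sum (I q) (fun x => 16 * (W n p.K (p.y n) x)^4) ((W n p.K (p.y n) (q.y n))^4) (fun x hx => by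
      have hx := (mem_filter.1 hx).2
      have := W_le_two (n := n) (J := p.K) (K := q.K) (x := q.y n) (x' := x) (by omega) (by rw [y_div, hx]) (p.y n)
      rw [W_comm n _ (q.y n), W_comm n _ x] at this
      have w := W_pos n p.K (p.y n) (q.y n)
      calc _ ≤ (2 * W n p.K (p.y n) x)^4 := by gcongr
        _ = _ := by ring)
    rwa [card_block (hV q a).K_le (hV q a).2.2, nsmul_eq_mul, LN_cast] at this
  refine (Finset.sum_le_sum one).trans ?_
  rw [← Finset.sum_biUnion hpd, ← Finset.mul_sum]
  refine mul_le_mul_of_nonneg_left ?_ (by norm_num)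
  unfold Out
  refine Finset.sum_le_sum_of_subset_of_nonneg ?_ (fun x _ _ => by have := W_pos n p.K (p.y n) x; positivity)
  intro x hx
  obtain ⟨q, hq, hx⟩ := Finset.mem_biUnion.1 hx
  obtain ⟨hx1, hx2⟩ := mem_filter.1 hx
  obtain ⟨a, b, s, s1, s2, s3⟩ := spec q hq
  rw [mem_filter]
  refine ⟨hx1, ?_⟩
  obtain ⟨⟨u1, u2, u3⟩, _⟩ := h3 p hp
  have e1 : q.y n / LN n q.K = x / LN n q.K := by rw [y_div, hx2]
  rw [← nest_time (by omega : (top p).1 ≤ q.K) (hV q a).K_le e1]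
  exact sep_claim D h3 h4 hp a b s1 s2 s3

lemma diag_sum (D : Model n C0) {U : Finset Tile} (hV : ∀ p ∈ U, Valid n p) {p : Tile} (hp : p ∈ U) :
    ∑ q ∈ U, (if p.K = q.K then LL n p.K * LL n q.K * ‖∑ x ∈ range (16^n), D.φ p x * conj (D.φ q x)‖ else 0) ≤ 324 * C0^2 * LL n p.K := by
  have hC := D.hC0
  have l1 := LL_pos n p.K
  have e : ∀ q ∈ U, (if p.K = q.K then LL n p.K * LL n q.K * ‖∑ x ∈ range (16^n), D.φ p x * conj (D.φ q x)‖ else 0) ≤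
      if q.K = p.K ∧ q.w = p.w then 9 * C0^2 * LL n p.K * (W n p.K (p.y n) (q.i * LN n p.K))^2 else 0 := by
    intro q hq
    by_cases h : p.K = q.K
    · rw [if_pos h]
      by_cases hw : q.w = p.w
      · rw [if_pos ⟨h.symm, hw⟩]
        have := ip_bound D (hV p hp) (hV q hq) h.le
        have hy : q.y n = q.i * LN n p.K := by rw [h]; rfl
        rw [hy] at this
        rw [← h]
        have w := W_pos n p.K (p.y n) (q.i * LN n p.K)
        have w' := W_le_one n p.K (p.y n) (q.i * LN n p.K)
        have w4 : (W n p.K (p.y n) (q.i * LN n p.K))^4 ≤ (W n p.K (p.y n) (q.i * LN n p.K))^2 := pow_le_pow_of_le_one w.le w' (by norm_num)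
        calc _ ≤ LL n p.K * LL n p.K * (9 * C0^2 * (LL n p.K)⁻¹ * (W n p.K (p.y n) (q.i * LN n p.K))^4) := by gcongr
          _ = 9 * C0^2 * LL n p.K * (W n p.K (p.y n) (q.i * LN n p.K))^4 := by field_simp
          _ ≤ _ := by gcongr
      · rw [if_neg (fun h => hw h.2)]
        by_cases h0 : ∑ x ∈ range (16^n), D.φ p x * conj (D.φ q x) = 0
        · rw [h0]; simp
        · obtain ⟨s, s1, s2, _⟩ := D.phi_orth p q (hV p hp) (hV q hq) h0
          exact absurd (by rw [← s2, ← s1, h]) hw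
    · rw [if_neg h, if_neg (fun h' => h h'.1.symm)]
  refine (Finset.sum_le_sum e).trans ?_
  rw [← Finset.sum_filter, block_sum hV p.K p.w (fun q => 9 * C0^2 * LL n p.K * (W n p.K (p.y n) (q.i * LN n p.K))^2)]
  calc _ ≤ ∑ i ∈ range (16^p.K), 9 * C0^2 * LL n p.K * (W n p.K (p.y n) (i * LN n p.K))^2 := by
        refine Finset.sum_le_sum fun i _ => ?_
        have w := W_pos n p.K (p.y n) (i * LN n p.K)
        split_ifs
        · exact le_rfl
        · positivity
    _ = 9 * C0^2 * (LL n p.K * ∑ i ∈ range (16^p.K), (W n p.K (p.y n) (i * LN n p.K))^2) := by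
        rw [Finset.mul_sum, Finset.mul_sum]; refine Finset.sum_congr rfl fun i _ => by ring
    _ ≤ 9 * C0^2 * (36 * LL n p.K) := by
        exact mul_le_mul_of_nonneg_left (W5 le_rfl (hV p hp).K_le (hV p hp).y_lt) (by positivity)
    _ = _ := by ring

/-- the coefficients -/
noncomputable def coef (D : Model n C0) (f : ℕ → ℂ) (p : Tile) : ℂ := ∑ x ∈ range (16^n), f x * conj (D.φ p x)

/-- TT-star step -/
lemma tt_star (D : Model n C0) (f : ℕ → ℂ) (U : Finset Tile) (hV : ∀ p ∈ U, Valid n p) :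
    (∑ p ∈ U, LL n p.K * ‖coef D f p‖^2)^2 ≤ (∑ x ∈ range (16^n), ‖f x‖^2) *
      (324 * C0^2 * (∑ p ∈ U, LL n p.K * ‖coef D f p‖^2) + 2 * ∑ p ∈ U, LL n p.K * ‖coef D f p‖ * ∑ q ∈ U.filter (fun q => p.K < q.K ∧ ∑ x ∈ range (16^n), D.φ p x * conj (D.φ q x) ≠ 0),
        LL n q.K * ‖coef D f q‖ * ‖∑ x ∈ range (16^n), D.φ p x * conj (D.φ q x)‖) := by
  set c := coef D f with hc
  set ip : Tile → Tile → ℂ := fun p q => ∑ x ∈ range (16^n), D.φ p x * conj (D.φ q x) with hip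
  set G : Tile → ℕ → ℂ := fun p x => (LL n p.K : ℂ) * c p * D.φ p x with hG
  have s1 : ((∑ p ∈ U, LL n p.K * ‖c p‖^2 : ℝ) : ℂ) = ∑ x ∈ range (16^n), f x * conj (∑ p ∈ U, G p x) := by
    push_cast
    simp_rw [map_sum, Finset.mul_sum]
    rw [Finset.sum_comm]
    refine Finset.sum_congr rfl fun p _ => ?_
    rw [← Complex.mul_conj', hc]
    conv_lhs => rw [coef, Finset.sum_mul, Finset.mul_sum]
    refine Finset.sum_congr rfl fun x _ => ?_
    simp only [hG, map_mul, Complex.conj_ofReal, hc, coef]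
    ring
  have A0 : 0 ≤ ∑ p ∈ U, LL n p.K * ‖c p‖^2 := Finset.sum_nonneg fun p _ => by have := LL_pos n p.K; positivity
  have s2 : ∑ p ∈ U, LL n p.K * ‖c p‖^2 ≤ ∑ x ∈ range (16^n), ‖f x‖ * ‖∑ p ∈ U, G p x‖ := by
    have := congrArg norm s1
    rw [Complex.norm_real, Real.norm_of_nonneg A0] at this
    rw [this]
    refine (norm_sum_le _ _).trans (Finset.sum_le_sum fun x _ => ?_)
    rw [norm_mul, RCLike.norm_conj]
  have s3 := Finset.sum_mul_sq_le_sq_mul_sq (range (16^n)) (fun x => ‖f x‖) (fun x => ‖∑ p ∈ U, G p x‖)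
  have s4 : (∑ p ∈ U, LL n p.K * ‖c p‖^2)^2 ≤ (∑ x ∈ range (16^n), ‖f x‖^2) * ∑ x ∈ range (16^n), ‖∑ p ∈ U, G p x‖^2 :=
    (pow_le_pow_left₀ A0 s2 2).trans s3
  refine s4.trans (mul_le_mul_of_nonneg_left ?_ (Finset.sum_nonneg fun x _ => by positivity))
  have s5 := congrArg norm (norm_sq_sum U (range (16^n)) G)
  rw [Complex.norm_real, Real.norm_of_nonneg (Finset.sum_nonneg fun x _ => by positivity)] at s5
  rw [s5]
  have s6 : ∀ p q, ∑ x ∈ range (16^n), G p x * conj (G q x) = (LL n p.K : ℂ) * c p * ((LL n q.K : ℂ) * conj (c q)) * ip p q := by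
    intro p q
    rw [hip, Finset.mul_sum]
    refine Finset.sum_congr rfl fun x _ => ?_
    simp only [hG, map_mul, Complex.conj_ofReal]
    ring
  have s7 : ∀ p q, ‖∑ x ∈ range (16^n), G p x * conj (G q x)‖ = (LL n p.K * ‖c p‖) * (LL n q.K * ‖c q‖) * ‖ip p q‖ := by
    intro p q
    rw [s6]
    simp only [norm_mul, Complex.norm_real, RCLike.norm_conj]
    rw [Real.norm_of_nonneg (LL_pos n p.K).le, Real.norm_of_nonneg (LL_pos n q.K).le]
  have ipsym : ∀ p q, ‖ip p q‖ = ‖ip q p‖ := by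
    intro p q
    rw [← RCLike.norm_conj (ip p q), hip]
    simp only [map_sum, map_mul, Complex.conj_conj]
    congr 1
    refine Finset.sum_congr rfl fun x _ => by ring
  set m : Tile → Tile → ℝ := fun p q => (LL n p.K * ‖c p‖) * (LL n q.K * ‖c q‖) * ‖ip p q‖ with hm
  have m0 : ∀ p q, 0 ≤ m p q := by
    intro p q
    have := LL_pos n p.K; have := LL_pos n q.K
    simp only [hm]; positivity
  have msym : ∀ p q, m p q = m q p := by
    intro p q; simp only [hm]; rw [ipsym p q]; ring
  have s8 : ‖∑ a ∈ U, ∑ b ∈ U, ∑ x ∈ range (16^n), G a x * conj (G b x)‖ ≤ ∑ p ∈ U, ∑ q ∈ U, m p q := by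
    refine (norm_sum_le _ _).trans (Finset.sum_le_sum fun p _ => (norm_sum_le _ _).trans (Finset.sum_le_sum fun q _ => ?_))
    rw [s7]
  refine s8.trans ?_
  have s9 : ∑ p ∈ U, ∑ q ∈ U, m p q = ∑ p ∈ U, ∑ q ∈ U, (if p.K = q.K then m p q else 0) + 2 * ∑ p ∈ U, ∑ q ∈ U, (if p.K < q.K then m p q else 0) := by
    have t1 : ∑ p ∈ U, ∑ q ∈ U, (if p.K < q.K then m p q else 0) = ∑ p ∈ U, ∑ q ∈ U, (if q.K < p.K then m p q else 0) := by
      rw [Finset.sum_comm]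
      refine Finset.sum_congr rfl fun p _ => Finset.sum_congr rfl fun q _ => ?_
      rw [msym]
    rw [two_mul]
    conv_rhs => rw [t1]
    conv_rhs => enter [2, 1]; rw [← t1]
    simp_rw [← Finset.sum_add_distrib]
    refine Finset.sum_congr rfl fun p _ => Finset.sum_congr rfl fun q _ => ?_
    rcases lt_trichotomy p.K q.K with h | h | h
    · simp [h, h.ne, h.not_gt]
    · simp [h]
    · simp [h, h.ne', h.not_gt]
  rw [s9]
  refine add_le_add ?_ (mul_le_mul_of_nonneg_left ?_ (by norm_num))
  · set M : Tile → Tile → ℝ := fun p q => if p.K = q.K then LL n p.K * LL n q.K * ‖ip p q‖ else 0 with hM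
    have M0 : ∀ p q, 0 ≤ M p q := by
      intro p q
      have := LL_pos n p.K; have := LL_pos n q.K
      simp only [hM]; split_ifs <;> positivity
    have Msym : ∀ p q, M p q = M q p := by
      intro p q; simp only [hM]; rw [ipsym p q]
      by_cases h : p.K = q.K
      · rw [if_pos h, if_pos h.symm]; ring
      · rw [if_neg h, if_neg (fun h' => h h'.symm)]
    have t1 : ∀ p q, (if p.K = q.K then m p q else 0) ≤ 1/2 * (M p q * ‖c p‖^2) + 1/2 * (M q p * ‖c q‖^2) := by
      intro p q
      have e : (if p.K = q.K then m p q else 0) = M p q * (‖c p‖ * ‖c q‖) := by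
        simp only [hM, hm]; split_ifs <;> ring
      rw [e, Msym q p]
      have := M0 p q
      nlinarith [mul_nonneg this (sq_nonneg (‖c p‖ - ‖c q‖))]
    calc _ ≤ ∑ p ∈ U, ∑ q ∈ U, (1/2 * (M p q * ‖c p‖^2) + 1/2 * (M q p * ‖c q‖^2)) :=
          Finset.sum_le_sum fun p _ => Finset.sum_le_sum fun q _ => t1 p q
      _ = ∑ p ∈ U, (∑ q ∈ U, M p q) * ‖c p‖^2 := by
          simp_rw [Finset.sum_add_distrib]
          rw [Finset.sum_comm (f := fun p q => 1/2 * (M q p * ‖c q‖^2)), ← Finset.sum_add_distrib]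
          refine Finset.sum_congr rfl fun p _ => ?_
          rw [← Finset.mul_sum, ← Finset.sum_mul]; ring
      _ ≤ ∑ p ∈ U, (324 * C0^2 * LL n p.K) * ‖c p‖^2 := by
          refine Finset.sum_le_sum fun p hp => mul_le_mul_of_nonneg_right (diag_sum D hV hp) (by positivity)
      _ = _ := by
          rw [Finset.mul_sum]; refine Finset.sum_congr rfl fun p _ => by ring
  · refine Finset.sum_le_sum fun p _ => ?_
    rw [Finset.mul_sum, Finset.sum_filter]
    refine Finset.sum_le_sum fun q _ => ?_
    by_cases h : p.K < q.K
    · rw [if_pos h]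
      by_cases h0 : ip p q = 0
      · rw [if_neg (fun h => h.2 h0)]; simp only [hm, h0]; simp
      · rw [if_pos ⟨h, h0⟩]; simp only [hm]; exact le_of_eq (by ring)
    · rw [if_neg h, if_neg (fun h' => h h'.1)]

/-- the size lemma -/
lemma size_lemma (D : Model n C0) (f : ℕ → ℂ) {P : Finset Tile} {r : ℕ} {σ : ℝ} (hV : ∀ p ∈ P, Valid n p)
    (hr : ∀ p ∈ P, p.K % 3 = r) (hσ : 0 < σ) (hs : SizeLe D (coef D f) P (2 * σ)) :
    ∃ l : List (ℕ × ℕ × ℕ), (∀ t ∈ l, t.1 ≤ n ∧ t.2.1 < 16^t.1) ∧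
      (l.map (fun t => LL n t.1)).sum ≤ 6000000 * C0^2 * (σ^2)⁻¹ * ∑ x ∈ range (16^n), ‖f x‖^2 ∧
      SizeLe D (coef D f) (P.filter (fun p => ∀ t ∈ l, ¬ Under n t.1 t.2.1 t.2.2 p)) σ := by
  obtain ⟨l, U, top, h1, h2, h3, h4, h5, h6, h7⟩ := size_select D (coef D f) (σ := σ) P.card P le_rfl
  refine ⟨l, h2, ?_, h7⟩
  have hC := D.hC0
  have hVU : ∀ p ∈ U, Valid n p := fun p hp => hV p (h1 hp)
  have h3' : ∀ p ∈ U, Under n (top p).1 (top p).2.1 (top p).2.2 p ∧ Lac D (top p).2.2 p := fun p hp => ⟨(h3 p hp).1, (h3 p hp).2.1⟩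
  have hcp : ∀ p ∈ U, ‖coef D f p‖ ≤ 2 * σ := fun p hp => hs.coef (by positivity) hV (h1 hp)
  have tt := tt_star D f U hVU
  set A := ∑ p ∈ U, LL n p.K * ‖coef D f p‖^2 with hA
  set S := (l.map (fun t => LL n t.1)).sum with hS
  have off : ∑ p ∈ U, LL n p.K * ‖coef D f p‖ * ∑ q ∈ U.filter (fun q => p.K < q.K ∧ ∑ x ∈ range (16^n), D.φ p x * conj (D.φ q x) ≠ 0),
        LL n q.K * ‖coef D f q‖ * ‖∑ x ∈ range (16^n), D.φ p x * conj (D.φ q x)‖ ≤ 576 * C0^2 * σ^2 * (5184 * S) := by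
    have step : ∀ p ∈ U, LL n p.K * ‖coef D f p‖ * ∑ q ∈ U.filter (fun q => p.K < q.K ∧ ∑ x ∈ range (16^n), D.φ p x * conj (D.φ q x) ≠ 0),
        LL n q.K * ‖coef D f q‖ * ‖∑ x ∈ range (16^n), D.φ p x * conj (D.φ q x)‖ ≤ 576 * C0^2 * σ^2 * Out n (top p) p.K (p.y n) := by
      intro p hp
      have l1 := LL_pos n p.K
      have i1 : ∑ q ∈ U.filter (fun q => p.K < q.K ∧ ∑ x ∈ range (16^n), D.φ p x * conj (D.φ q x) ≠ 0),
          LL n q.K * ‖coef D f q‖ * ‖∑ x ∈ range (16^n), D.φ p x * conj (D.φ q x)‖ ≤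
          18 * C0^2 * σ * (LL n p.K)⁻¹ * ∑ q ∈ U.filter (fun q => p.K < q.K ∧ ∑ x ∈ range (16^n), D.φ p x * conj (D.φ q x) ≠ 0), LL n q.K * (W n p.K (p.y n) (q.y n))^4 := by
        rw [Finset.mul_sum]
        refine Finset.sum_le_sum fun q hq => ?_
        obtain ⟨a, b, _⟩ := mem_filter.1 hq
        have l2 := LL_pos n q.K
        have := ip_bound D (hVU p hp) (hVU q a) b.le
        have cq := hcp q a
        calc _ ≤ LL n q.K * (2 * σ) * (9 * C0^2 * (LL n p.K)⁻¹ * (W n p.K (p.y n) (q.y n))^4) := by gcongr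
          _ = _ := by ring
      have i2 := off_sum D hVU (fun p hp => hr p (h1 hp)) h3' h4 hp
      have cp := hcp p hp
      have o := Out_nonneg n (top p) p.K (p.y n)
      calc _ ≤ LL n p.K * (2 * σ) * (18 * C0^2 * σ * (LL n p.K)⁻¹ * (16 * Out n (top p) p.K (p.y n))) := by
            refine mul_le_mul (by gcongr) (i1.trans (by gcongr)) ?_ (by positivity)
            exact Finset.sum_nonneg fun q _ => by have := LL_pos n q.K; positivity
        _ = _ := by field_simp; ring
    refine (Finset.sum_le_sum step).trans ?_
    rw [← Finset.mul_sum]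
    refine mul_le_mul_of_nonneg_left ?_ (by positivity)
    exact h6 (fun t p => Out n t p.K (p.y n)) 5184 (fun t a b T hT hU => out_tree a b (fun p hp => hV p (hT hp)) hU)
  set B := ∑ x ∈ range (16^n), ‖f x‖^2 with hB
  have B0 : 0 ≤ B := Finset.sum_nonneg fun x _ => by positivity
  have A0 : 0 ≤ A := Finset.sum_nonneg fun p _ => by have := LL_pos n p.K; positivity
  have t2 : A^2 ≤ B * (6000000 * C0^2 * A) := by
    refine tt.trans (mul_le_mul_of_nonneg_left ?_ B0)
    have : C0^2 * (σ^2 * S) ≤ C0^2 * A := by gcongr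
    have : 0 ≤ C0^2 * A := by positivity
    nlinarith
  have t3 : A ≤ 6000000 * C0^2 * B := by
    rcases eq_or_lt_of_le A0 with h | h
    · rw [← h]; positivity
    · refine le_of_mul_le_mul_left ?_ h
      nlinarith
  have s2 : 0 < σ^2 := by positivity
  have t4 : σ^2 * S ≤ 6000000 * C0^2 * B := h5.trans t3
  calc S = (σ^2)⁻¹ * (σ^2 * S) := by field_simp
    _ ≤ (σ^2)⁻¹ * (6000000 * C0^2 * B) := by gcongr
    _ = _ := by ring
end Carl

namespace Carl
open Finset
open scoped Classical ComplexConjugate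
variable {n : ℕ} {C0 : ℝ}

lemma Lam_split (D : Model n C0) (c : Tile → ℂ) (g : ℕ → ℂ) (N : ℕ → ℕ) (P : Finset Tile) (Q : Tile → Prop) :
    Lam D c g N P = Lam D c g N (P.filter Q) + Lam D c g N (P.filter (fun p => ¬ Q p)) := by
  unfold Lam
  rw [← Finset.sum_add_distrib]
  refine Finset.sum_congr rfl fun x _ => ?_
  rw [← Finset.sum_filter_add_sum_filter_not P Q, mul_add]

lemma cover (D : Model n C0) {c : Tile → ℂ} {g : ℕ → ℂ} {N : ℕ → ℕ} {r : ℕ} {σ μ : ℝ} (hσ : 0 ≤ σ) (hμ : 0 ≤ μ)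
    (l : List (ℕ × ℕ × ℕ)) (hl : ∀ t ∈ l, t.1 ≤ n ∧ t.2.1 < 16^t.1) : ∀ (P : Finset Tile), (∀ p ∈ P, Valid n p) →
    (∀ p ∈ P, p.K % 3 = r) → SizeLe D c P σ → MassLe n g N P μ →
    ‖Lam D c g N P‖ ≤ ‖Lam D c g N (P.filter (fun p => ∀ t ∈ l, ¬ Under n t.1 t.2.1 t.2.2 p))‖ +
      100000000 * C0^2 * σ * μ * (l.map (fun t => LL n t.1)).sum := by
  induction l with
  | nil => intro P _ _ _ _; simp
  | cons t l ih =>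
    intro P hV hr hs hm
    have h1 := tree_lemma D (T := P.filter (fun p => Under n t.1 t.2.1 t.2.2 p)) (k0 := t.1) (i0 := t.2.1) (ξ := t.2.2)
      (fun p hp => hV p (mem_filter.1 hp).1) (fun p hp => hr p (mem_filter.1 hp).1) (hl t (by simp)).1 (hl t (by simp)).2
      (fun p hp => (mem_filter.1 hp).2) hσ (hs.mono (filter_subset _ _)) hμ (hm.mono (filter_subset _ _))
    have h2 := ih (fun t ht => hl t (by simp [ht])) (P.filter (fun p => ¬ Under n t.1 t.2.1 t.2.2 p))
      (fun p hp => hV p (mem_filter.1 hp).1) (fun p hp => hr p (mem_filter.1 hp).1) (hs.mono (filter_subset _ _)) (hm.mono (filter_subset _ _))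
    have e : (P.filter (fun p => ¬ Under n t.1 t.2.1 t.2.2 p)).filter (fun p => ∀ t ∈ l, ¬ Under n t.1 t.2.1 t.2.2 p) =
        P.filter (fun p => ∀ s ∈ t :: l, ¬ Under n s.1 s.2.1 s.2.2 p) := by
      ext p; simp only [mem_filter, List.forall_mem_cons]; tauto
    rw [e] at h2
    rw [Lam_split D c g N P (fun p => Under n t.1 t.2.1 t.2.2 p), List.map_cons, List.sum_cons, mul_add]
    refine (norm_add_le _ _).trans ?_
    linarith

lemma mass_crude {g : ℕ → ℂ} {N : ℕ → ℕ} (hg : ∀ x < 16^n, ‖g x‖ ≤ 1) {P : Finset Tile} (hV : ∀ p ∈ P, Valid n p) :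
    MassLe n g N P 9 := by
  intro p hp k i ξ hU
  have hk : k ≤ n := hU.1.trans (hV p hp).K_le
  have hi : i < 16^k := by rw [← hU.2.1]; exact div_lt_of hk (hV p hp).y_lt
  refine le_trans ?_ (W_sum' (n := n) (K := k) (mul_LN_lt hk hi))
  refine Finset.sum_le_sum fun x hx => ?_
  have w := W_pos n k x (i * LN n k)
  have w' := W_le_one n k x (i * LN n k)
  have g1 := hg x (mem_range.1 hx)
  split_ifs
  · calc _ ≤ 1 * (W n k x (i * LN n k))^3 := by gcongr
      _ ≤ _ := by rw [one_mul]; exact pow_le_pow_of_le_one w.le w' (by norm_num)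
  · positivity

lemma size_crude (D : Model n C0) (c : Tile → ℂ) (P : Finset Tile) : ∃ a : ℕ, SizeLe D c P (2^a) := by
  obtain ⟨a, ha⟩ := pow_unbounded_of_one_lt (∑ p ∈ P, LL n p.K * ‖c p‖^2) (show (1:ℝ) < 2 by norm_num)
  refine ⟨a, fun k i ξ _ _ => ?_⟩
  refine (Finset.sum_le_sum_of_subset_of_nonneg (filter_subset _ _) (fun q _ _ => by have := LL_pos n q.K; positivity)).trans ?_
  have h1 := one_le_LL n k
  have h2 : (1:ℝ) ≤ 2^a := one_le_pow₀ (by norm_num)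
  calc _ ≤ (2:ℝ)^a * 1 * 1 := by linarith
    _ ≤ 2^a * 2^a * LL n k := by gcongr
    _ = _ := by ring

lemma phase1 (D : Model n C0) (f : ℕ → ℂ) {g : ℕ → ℂ} {N : ℕ → ℕ} {r : ℕ}
    (hf : ∑ x ∈ range (16^n), ‖f x‖^2 ≤ 16^n) (hg : ∀ x < 16^n, ‖g x‖ ≤ 1) (a : ℕ) :
    ∀ (P : Finset Tile), (∀ p ∈ P, Valid n p) → (∀ p ∈ P, p.K % 3 = r) → SizeLe D (coef D f) P (2^a) →
    ∃ Q ⊆ P, SizeLe D (coef D f) Q 1 ∧ ‖Lam D (coef D f) g N P‖ ≤ ‖Lam D (coef D f) g N Q‖ + 10800000000000000 * C0^4 * 16^n * (2 - 2 * ((2:ℝ)^a)⁻¹) := by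
  induction a with
  | zero => intro P _ _ hs; exact ⟨P, subset_rfl, by simpa using hs, by simp⟩
  | succ a ih =>
    intro P hV hr hs
    have hC := D.hC0
    have hs' : SizeLe D (coef D f) P (2 * 2^a) := by rwa [pow_succ, mul_comm] at hs
    obtain ⟨l, h1, h2, h3⟩ := size_lemma D f hV hr (by positivity) hs'
    have h4 := cover D (c := coef D f) (by positivity : (0:ℝ) ≤ 2 * 2^a) (by norm_num : (0:ℝ) ≤ 9) l h1 P hV hr hs' (mass_crude (N := N) hg hV)
    obtain ⟨Q, q1, q2, q3⟩ := ih (P.filter (fun p => ∀ t ∈ l, ¬ Under n t.1 t.2.1 t.2.2 p)) (fun p hp => hV p (mem_filter.1 hp).1) (fun p hp => hr p (mem_filter.1 hp).1) h3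
    refine ⟨Q, q1.trans (filter_subset _ _), q2, h4.trans ?_⟩
    have h5 : 100000000 * C0^2 * (2 * 2^a) * 9 * (l.map (fun t => LL n t.1)).sum ≤ 10800000000000000 * C0^4 * 16^n * ((2:ℝ)^a)⁻¹ := by
      calc _ ≤ 100000000 * C0^2 * (2 * 2^a) * 9 * (6000000 * C0^2 * (((2:ℝ)^a)^2)⁻¹ * 16^n) := by
            refine mul_le_mul_of_nonneg_left (h2.trans ?_) (by positivity)
            gcongr
        _ = _ := by field_simp; ring
    have h6 : ((2:ℝ)^(a+1))⁻¹ = ((2:ℝ)^a)⁻¹ / 2 := by rw [pow_succ, mul_inv]; ring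
    rw [h6]
    nlinarith

lemma phase2 (D : Model n C0) (f : ℕ → ℂ) {g : ℕ → ℂ} {N : ℕ → ℕ} {r : ℕ}
    (hf : ∑ x ∈ range (16^n), ‖f x‖^2 ≤ 16^n) (hg : ∀ x < 16^n, ‖g x‖ ≤ 1) (hN : ∀ x < 16^n, N x < 16^n)
    (P : Finset Tile) (hV : ∀ p ∈ P, Valid n p) (hr : ∀ p ∈ P, p.K % 3 = r) (hs : SizeLe D (coef D f) P 1) (j : ℕ) :
    ∃ Q ⊆ P, SizeLe D (coef D f) Q ((1/2)^j) ∧ MassLe n g N Q (9 * ((1/2)^j)^2) ∧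
      ‖Lam D (coef D f) g N P‖ ≤ ‖Lam D (coef D f) g N Q‖ + 50000000000000000 * C0^4 * 16^n * (1 - (1/2)^j) := by
  induction j with
  | zero => exact ⟨P, subset_rfl, by simpa using hs, by simpa using mass_crude (N := N) hg hV, by simp⟩
  | succ j ih =>
    obtain ⟨Q, q1, q2, q3, q4⟩ := ih
    have hC := D.hC0
    set σ : ℝ := (1/2)^(j+1) with hσ
    have hσ0 : 0 < σ := by positivity
    have e : ((1:ℝ)/2)^j = 2 * σ := by rw [hσ, pow_succ]; ring
    rw [e] at q2 q3 q4
    have hVQ : ∀ p ∈ Q, Valid n p := fun p hp => hV p (q1 hp)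
    have hrQ : ∀ p ∈ Q, p.K % 3 = r := fun p hp => hr p (q1 hp)
    obtain ⟨l, h1, h2, h3⟩ := size_lemma D f hVQ hrQ hσ0 q2
    have h4 := cover D (c := coef D f) (by positivity : (0:ℝ) ≤ 2 * σ) (by positivity : (0:ℝ) ≤ 9 * (2*σ)^2) l h1 Q hVQ hrQ q2 q3
    set R := Q.filter (fun p => ∀ t ∈ l, ¬ Under n t.1 t.2.1 t.2.2 p) with hR
    have hRQ : R ⊆ Q := filter_subset _ _
    obtain ⟨l', k1, k2, k3⟩ := mass_lemma (n := n) hN hg (by positivity : 0 < 9 * σ^2) R (fun p hp => hVQ p (hRQ hp))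
    have k4 := cover D (c := coef D f) hσ0.le (by positivity : (0:ℝ) ≤ 9 * (2*σ)^2) l' k1 R (fun p hp => hVQ p (hRQ hp)) (fun p hp => hrQ p (hRQ hp)) h3 (q3.mono hRQ)
    refine ⟨_, ((filter_subset _ _).trans hRQ).trans q1, h3.mono (filter_subset _ _), k3, ?_⟩
    have c1 : 100000000 * C0^2 * (2 * σ) * (9 * (2*σ)^2) * (l.map (fun t => LL n t.1)).sum ≤ 43200000000000000 * C0^4 * 16^n * σ := by
      calc _ ≤ 100000000 * C0^2 * (2 * σ) * (9 * (2*σ)^2) * (6000000 * C0^2 * (σ^2)⁻¹ * 16^n) := by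
            refine mul_le_mul_of_nonneg_left (h2.trans ?_) (by positivity)
            gcongr
        _ = _ := by field_simp; ring
    have c2 : 100000000 * C0^2 * σ * (9 * (2*σ)^2) * (l'.map (fun t => LL n t.1)).sum ≤ 8640000000000 * C0^2 * 16^n * σ := by
      calc _ ≤ 100000000 * C0^2 * σ * (9 * (2*σ)^2) * (21600 * (9 * σ^2)⁻¹ * 16^n) := by
            refine mul_le_mul_of_nonneg_left k2 (by positivity)
        _ = _ := by field_simp; ring
    have c3 : C0^2 * 16^n * σ ≤ C0^4 * 16^n * σ := by
      have : C0^2 ≤ C0^4 := pow_le_pow_right₀ hC (by norm_num)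
      gcongr
    have c4 : 0 ≤ C0^4 * 16^n * σ := by positivity
    nlinarith

/-- the model bound -/
theorem model_bound (D : Model n C0) (f : ℕ → ℂ) {g : ℕ → ℂ} {N : ℕ → ℕ} {r : ℕ}
    (hf : ∑ x ∈ range (16^n), ‖f x‖^2 ≤ 16^n) (hg : ∀ x < 16^n, ‖g x‖ ≤ 1) (hN : ∀ x < 16^n, N x < 16^n)
    (P : Finset Tile) (hV : ∀ p ∈ P, Valid n p) (hr : ∀ p ∈ P, p.K % 3 = r) :
    ‖Lam D (coef D f) g N P‖ ≤ 80000000000000000 * C0^4 * 16^n := by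
  have hC := D.hC0
  obtain ⟨a, ha⟩ := size_crude D (coef D f) P
  obtain ⟨Q, q1, q2, q3⟩ := phase1 D f (N := N) hf hg a P hV hr ha
  have hVQ : ∀ p ∈ Q, Valid n p := fun p hp => hV p (q1 hp)
  have crude : ∀ R ⊆ Q, ∀ σ : ℝ, 0 ≤ σ → SizeLe D (coef D f) R σ → ‖Lam D (coef D f) g N R‖ ≤ (16^n * (Q.card * C0)) * σ := by
    intro R hR σ hσ hs
    have hVR : ∀ p ∈ R, Valid n p := fun p hp => hVQ p (hR hp)
    unfold Lam
    calc _ ≤ ∑ x ∈ range (16^n), (Q.card * C0) * σ := by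
          refine (norm_sum_le _ _).trans (Finset.sum_le_sum fun x hx => ?_)
          rw [mem_range] at hx
          have h1 : ‖∑ p ∈ R, coef D f p * D.Θ p (N x) x‖ ≤ Q.card * C0 * σ := by
            refine (norm_sum_le _ _).trans ?_
            calc _ ≤ ∑ p ∈ R, C0 * σ := by
                  refine Finset.sum_le_sum fun p hp => ?_
                  rw [norm_mul, mul_comm]
                  have t1 := D.th_le p (hVR p hp) (N x) x hx
                  have w := W_pos n p.K x (p.y n)
                  have t2 : (W n p.K x (p.y n))^8 ≤ 1 := pow_le_one₀ w.le (W_le_one _ _ _ _)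
                  have t3 := hs.coef hσ hVR hp
                  have t4 : ‖D.Θ p (N x) x‖ ≤ C0 := by nlinarith
                  gcongr
              _ = R.card * (C0 * σ) := by rw [Finset.sum_const, nsmul_eq_mul]
              _ ≤ Q.card * (C0 * σ) := by
                  have : (R.card : ℝ) ≤ Q.card := by exact_mod_cast Finset.card_le_card hR
                  gcongr
              _ = _ := by ring
          rw [norm_mul]
          calc _ ≤ 1 * (Q.card * C0 * σ) := by
                have := hg x hx
                gcongr
            _ = _ := by ring
      _ = _ := by rw [Finset.sum_const, card_range, nsmul_eq_mul]; push_cast; ring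
  have lim : Filter.Tendsto (fun j : ℕ => (16^n * (Q.card * C0)) * ((1:ℝ)/2)^j + 50000000000000000 * C0^4 * 16^n) Filter.atTop (nhds ((16^n * (Q.card * C0)) * 0 + 50000000000000000 * C0^4 * 16^n)) :=
    ((tendsto_pow_atTop_nhds_zero_of_lt_one (by norm_num) (by norm_num)).const_mul _).add_const _
  have h2 : ‖Lam D (coef D f) g N Q‖ ≤ (16^n * (Q.card * C0)) * 0 + 50000000000000000 * C0^4 * 16^n := by
    refine ge_of_tendsto lim (Filter.Eventually.of_forall fun j => ?_)
    obtain ⟨R, r1, r2, _, r4⟩ := phase2 D f hf hg hN Q hVQ (fun p hp => hr p (q1 hp)) q2 j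
    have := crude R r1 _ (by positivity) r2
    have p1 : (0:ℝ) ≤ (1/2)^j := by positivity
    have p2 : 0 ≤ C0^4 * 16^n * ((1:ℝ)/2)^j := by positivity
    nlinarith
  have p1 : 0 ≤ C0^4 * 16^n * ((2:ℝ)^a)⁻¹ := by positivity
  have p2 : 0 ≤ C0^4 * (16:ℝ)^n := by positivity
  nlinarith
end Carl

namespace Carl
open Finset
open scoped Classical ComplexConjugate
variable {n : ℕ} {C0 : ℝ}

/-- the character of Z/16^n -/
noncomputable def ee (n : ℕ) (k : ℤ) : ℂ := Complex.exp (Complex.I * ((2 * Real.pi * k / 16^n : ℝ) : ℂ))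

lemma ee_add (n : ℕ) (a b : ℤ) : ee n (a + b) = ee n a * ee n b := by
  unfold ee
  rw [← Complex.exp_add]
  congr 1; push_cast; ring

lemma ee_zero (n : ℕ) : ee n 0 = 1 := by simp [ee]

lemma norm_ee (n : ℕ) (a : ℤ) : ‖ee n a‖ = 1 := by
  unfold ee; rw [mul_comm]; exact Complex.norm_exp_ofReal_mul_I _

lemma ee_conj (n : ℕ) (a : ℤ) : conj (ee n a) = ee n (-a) := by
  unfold ee
  rw [← Complex.exp_conj]
  congr 1
  rw [map_mul, Complex.conj_I, Complex.conj_ofReal]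
  push_cast; ring

lemma ee_M (n : ℕ) (j : ℤ) : ee n (j * 16^n) = 1 := by
  unfold ee
  rw [Complex.exp_eq_one_iff]
  refine ⟨j, ?_⟩
  push_cast
  have : (16:ℂ)^n ≠ 0 := pow_ne_zero _ (by norm_num)
  field_simp

lemma ee_periodic (n : ℕ) (a j : ℤ) : ee n (a + j * 16^n) = ee n a := by rw [ee_add, ee_M, mul_one]

lemma ee_nat_mul (n : ℕ) (a : ℤ) (m : ℕ) : ee n (a * m) = (ee n a)^m := by
  induction m with
  | zero => simp [ee_zero]
  | succ m ih => rw [pow_succ, ← ih, ← ee_add]; congr 1; push_cast; ring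

lemma ee_eq_one {n : ℕ} {a : ℤ} (h : ee n a = 1) : (16^n : ℤ) ∣ a := by
  unfold ee at h
  rw [Complex.exp_eq_one_iff] at h
  obtain ⟨j, hj⟩ := h
  refine ⟨j, ?_⟩
  have h16 : (16:ℂ)^n ≠ 0 := pow_ne_zero _ (by norm_num)
  have hI := Complex.I_ne_zero
  have hp : (Real.pi : ℂ) ≠ 0 := by exact_mod_cast Real.pi_ne_zero
  push_cast at hj
  field_simp at hj
  have : ((a:ℤ):ℂ) = ((16^n * j : ℤ) : ℂ) := by push_cast; exact hj
  exact_mod_cast this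

/-- geometric sum: character sum over a subgroup of order m with step -/
lemma ee_sum_gen {n : ℕ} (L m : ℕ) (hLm : L * m = 16^n) (k : ℤ) :
    ∑ x ∈ range m, ee n (k * ((x * L : ℕ) : ℤ)) = if (m : ℤ) ∣ k then (m:ℂ) else 0 := by
  have hL : 0 < L := Nat.pos_of_ne_zero (fun h => by rw [h, zero_mul] at hLm; exact absurd hLm.symm (by positivity))
  have e : ∀ x, ee n (k * ((x * L : ℕ) : ℤ)) = (ee n (k * L))^x := by
    intro x; rw [← ee_nat_mul]; congr 1; push_cast; ring
  simp_rw [e]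
  have hLm' : (L:ℤ) * m = 16^n := by exact_mod_cast hLm
  split_ifs with h
  · obtain ⟨j, rfl⟩ := h
    have : ee n (m * j * L) = 1 := by
      rw [show (m:ℤ) * j * L = j * 16^n by rw [← hLm']; ring, ee_M]
    rw [this]; simp
  · have hne : ee n (k * L) ≠ 1 := by
      intro h1
      obtain ⟨j, hj⟩ := ee_eq_one h1
      rw [← hLm'] at hj
      apply h
      refine ⟨j, ?_⟩
      have : (L:ℤ) ≠ 0 := by exact_mod_cast hL.ne'
      apply mul_left_cancel₀ this
      linarith
    rw [geom_sum_eq hne, ← ee_nat_mul, mul_assoc, hLm', ee_M]; simp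

lemma ee_sum (n : ℕ) (k : ℤ) : ∑ x ∈ range (16^n), ee n (k * x) = if (16^n : ℤ) ∣ k then (16^n : ℂ) else 0 := by
  have := ee_sum_gen (n := n) 1 (16^n) (by ring) k
  simpa using this

lemma cd_le_half (n x y : ℕ) : cd n x y ≤ 16^n / 2 := by
  have hM : (16:ℝ)^n ≠ 0 := by positivity
  have := AddCircle.norm_le_half_period (16^n : ℝ) (x := (((x:ℝ) - (y:ℝ) : ℝ) : AddCircle ((16:ℝ)^n))) hM
  rwa [abs_of_pos (by positivity)] at this

lemma ee_lower {n x y : ℕ} (hx : x < 16^n) (hy : y < 16^n) : 4 * cd n x y / 16^n ≤ ‖ee n (-((x:ℤ) - y)) - 1‖ := by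
  obtain ⟨j, _, hj⟩ := cd_rep hx hy
  set d : ℤ := (x:ℤ) - y + j * 16^n with hd
  have e : ee n (-((x:ℤ) - y)) = ee n (-d) := by
    rw [← ee_periodic n (-d) j]; congr 1; rw [hd]; ring
  have hh := cd_le_half n x y
  rw [e]
  unfold ee
  rw [Complex.norm_exp_I_mul_ofReal_sub_one, Real.norm_eq_abs, abs_mul, abs_two]
  have hM : (0:ℝ) < 16^n := by positivity
  have hp := Real.pi_pos
  have ha : |2 * Real.pi * ((-d : ℤ) : ℝ) / 16^n / 2| = Real.pi * cd n x y / 16^n := by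
    rw [hj, show 2 * Real.pi * ((-d : ℤ) : ℝ) / 16^n / 2 = -((Real.pi / 16^n) * (d:ℝ)) by push_cast; field_simp, abs_neg, abs_mul, abs_of_pos (by positivity)]
    ring
  have h1 : |2 * Real.pi * ((-d : ℤ) : ℝ) / 16^n / 2| ≤ Real.pi / 2 := by
    rw [ha, div_le_iff₀ hM]
    nlinarith
  have := Real.mul_abs_le_abs_sin h1
  rw [ha] at this
  have e2 : 2 / Real.pi * (Real.pi * cd n x y / 16^n) = 2 * cd n x y / 16^n := by field_simp
  rw [e2] at this
  calc 4 * cd n x y / 16^n = 2 * (2 * cd n x y / 16^n) := by ring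
    _ ≤ _ := by gcongr

lemma ee_upper {n x y : ℕ} (hx : x < 16^n) (hy : y < 16^n) (m : ℤ) : ‖ee n (m * ((x:ℤ) - y)) - 1‖ ≤ 2 * Real.pi * |(m:ℝ)| * cd n x y / 16^n := by
  obtain ⟨j, _, hj⟩ := cd_rep hx hy
  set d : ℤ := (x:ℤ) - y + j * 16^n with hd
  have e : ee n (m * ((x:ℤ) - y)) = ee n (m * d) := by
    rw [← ee_periodic n (m * ((x:ℤ) - y)) (m * j)]; congr 1; rw [hd]; ring
  rw [e]
  unfold ee
  refine (Real.norm_exp_I_mul_ofReal_sub_one_le).trans (le_of_eq ?_)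
  rw [hj, Real.norm_eq_abs]
  push_cast
  rw [show 2 * Real.pi * (m * (d:ℝ)) / 16^n = (2 * Real.pi / 16^n) * (m * d) by ring, abs_mul, abs_mul, abs_of_pos (by have := Real.pi_pos; positivity)]
  ring

/-- forward difference -/
def dd (h : ℝ) (H : ℝ → ℝ) : ℝ → ℝ := fun u => H (u + h) - H u

lemma dd_bound {h : ℝ} (hh : 0 ≤ h) (m : ℕ) : ∀ (F : ℕ → ℝ → ℝ) (B : ℝ), (∀ j u, HasDerivAt (F j) (F (j+1) u) u) →
    (∀ u, |F m u| ≤ B) → ∀ u, |(dd h)^[m] (F 0) u| ≤ h^m * B := by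
  induction m with
  | zero => intro F B _ hB u; simpa using hB u
  | succ m ih =>
    intro F B hF hB u
    rw [Function.iterate_succ_apply]
    have := ih (fun j => dd h (F j)) (h * B) ?_ ?_ u
    · refine this.trans (le_of_eq ?_); ring
    · intro j u
      exact ((hF j (u+h)).comp_add_const u h).sub (hF j u)
    · intro u
      have := Convex.norm_image_sub_le_of_norm_hasDerivWithin_le (f := F m) (f' := F (m+1)) (C := B) (s := Set.univ) (x := u) (y := u + h)
        (fun x _ => (hF m x).hasDerivWithinAt) (fun x _ => hB x) convex_univ (Set.mem_univ _) (Set.mem_univ _)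
      simp only [Real.norm_eq_abs, add_sub_cancel_left, abs_of_nonneg hh] at this
      simp only [dd]; linarith

lemma dd_supp {h : ℝ} (hh : 0 ≤ h) {H : ℝ → ℝ} (hH : ∀ u, 1 ≤ |u| → H u = 0) (m : ℕ) :
    ∀ u, 1 + m * h ≤ |u| → (dd h)^[m] H u = 0 := by
  induction m with
  | zero => intro u hu; exact hH u (by simpa using hu)
  | succ m ih =>
    intro u hu
    rw [Function.iterate_succ_apply']
    simp only [dd]
    push_cast at hu
    rw [ih, ih]
    · simp
    · nlinarith
    · have : |u| ≤ |u + h| + h := by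
        have := abs_sub_abs_le_abs_sub u (u+h)
        rw [show u - (u+h) = -h by ring, abs_neg, abs_of_nonneg hh] at this
        linarith
      nlinarith

/-- kernel sum -/
noncomputable def KS (n R : ℕ) (H : ℝ → ℝ) (x : ℤ) : ℂ :=
  ∑ ξ ∈ Icc (-(R + 9 : ℤ)) (R + 9), (H (ξ / R) : ℂ) * ee n (ξ * x)

lemma KS_dd {R : ℕ} (hR : 0 < R) {G : ℝ → ℝ} (h1 : G ((R + 10) / R) = 0) (h2 : G (-(R + 9) / R) = 0) (x : ℤ) :
    KS n R (dd (1/R) G) x = (ee n (-x) - 1) * KS n R G x := by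
  unfold KS dd
  have hR' : (R:ℝ) ≠ 0 := by positivity
  have e1 : ∑ ξ ∈ Icc (-(R + 9 : ℤ)) (R + 9), (G ((ξ:ℝ) / R + 1 / R) : ℂ) * ee n (ξ * x) =
      ∑ ξ ∈ Icc (-(R + 9 : ℤ) + 1) (R + 9 + 1), (G ((ξ:ℝ) / R) : ℂ) * ee n (ξ * x) * ee n (-x) := by
    rw [← Finset.image_add_right_Icc, Finset.sum_image (by intro a _ b _ h; simpa using h)]
    refine Finset.sum_congr rfl fun ξ _ => ?_
    rw [mul_assoc, ← ee_add]
    congr 2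
    · push_cast; congr 2; field_simp
    · congr 1; ring
  have e2 : ∑ ξ ∈ Icc (-(R + 9 : ℤ) + 1) (R + 9 + 1), (G ((ξ:ℝ) / R) : ℂ) * ee n (ξ * x) * ee n (-x) =
      ∑ ξ ∈ Icc (-(R + 9 : ℤ)) (R + 9), (G ((ξ:ℝ) / R) : ℂ) * ee n (ξ * x) * ee n (-x) := by
    have a1 : ∑ ξ ∈ Icc (-(R + 9 : ℤ)) (R + 9 + 1), (G ((ξ:ℝ) / R) : ℂ) * ee n (ξ * x) * ee n (-x) = ∑ ξ ∈ Icc (-(R + 9 : ℤ) + 1) (R + 9 + 1), (G ((ξ:ℝ) / R) : ℂ) * ee n (ξ * x) * ee n (-x) := by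
      refine (Finset.sum_subset (Finset.Icc_subset_Icc_left (by omega)) ?_).symm
      intro ξ h3 h4
      rw [Finset.mem_Icc] at h3 h4
      have : ξ = -(R + 9) := by omega
      rw [this]; push_cast; rw [h2]; simp
    have a2 : ∑ ξ ∈ Icc (-(R + 9 : ℤ)) (R + 9 + 1), (G ((ξ:ℝ) / R) : ℂ) * ee n (ξ * x) * ee n (-x) = ∑ ξ ∈ Icc (-(R + 9 : ℤ)) (R + 9), (G ((ξ:ℝ) / R) : ℂ) * ee n (ξ * x) * ee n (-x) := by
      refine (Finset.sum_subset (Finset.Icc_subset_Icc_right (by omega)) ?_).symm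
      intro ξ h3 h4
      rw [Finset.mem_Icc] at h3 h4
      have : ξ = R + 10 := by omega
      rw [this]; push_cast; rw [h1]; simp
    rw [← a1, a2]
  push_cast
  simp_rw [sub_mul]
  rw [Finset.sum_sub_distrib, e1, e2, ← Finset.sum_mul]
  ring

lemma KS_iter {R : ℕ} (hR : 0 < R) {H : ℝ → ℝ} (hH : ∀ u, 1 ≤ |u| → H u = 0) (x : ℤ) (m : ℕ) (hm : m ≤ 9) :
    KS n R ((dd (1/R))^[m] H) x = (ee n (-x) - 1)^m * KS n R H x := by
  have hR' : (0:ℝ) < R := by positivity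
  induction m with
  | zero => simp
  | succ m ih =>
    rw [Function.iterate_succ_apply', KS_dd hR, ih (by omega), pow_succ]
    · ring
    · refine dd_supp (by positivity) hH m _ ?_
      rw [abs_of_pos (by positivity)]
      have : (m:ℝ) ≤ 8 := by exact_mod_cast (by omega : m ≤ 8)
      rw [add_div, div_self hR'.ne']
      have : (m:ℝ) * (1/R) ≤ 10 / R := by rw [mul_one_div]; gcongr; linarith
      linarith
    · refine dd_supp (by positivity) hH m _ ?_
      rw [neg_div, abs_neg, abs_of_pos (by positivity)]
      have : (m:ℝ) ≤ 8 := by exact_mod_cast (by omega : m ≤ 8)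
      rw [add_div, div_self hR'.ne']
      have : (m:ℝ) * (1/R) ≤ 9 / R := by rw [mul_one_div]; gcongr; linarith
      linarith

lemma KS_bound {R : ℕ} (hR : 0 < R) {G : ℝ → ℝ} {A : ℝ} (hA : ∀ u, |G u| ≤ A) (x : ℤ) : ‖KS n R G x‖ ≤ 21 * R * A := by
  have A0 : 0 ≤ A := (abs_nonneg _).trans (hA 0)
  unfold KS
  calc _ ≤ ∑ ξ ∈ Icc (-(R + 9 : ℤ)) (R + 9), A := by
        refine (norm_sum_le _ _).trans (Finset.sum_le_sum fun ξ _ => ?_)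
        rw [norm_mul, norm_ee, mul_one, Complex.norm_real]; exact hA _
    _ = ((2 * R + 19 : ℕ) : ℝ) * A := by
        rw [Finset.sum_const, Int.card_Icc, nsmul_eq_mul]
        congr 2; omega
    _ ≤ _ := by
        have : (1:ℝ) ≤ R := by exact_mod_cast hR
        push_cast
        gcongr; linarith

/-- kernel -/
noncomputable def ker (n K : ℕ) (H : ℝ → ℝ) (x : ℤ) : ℂ := ((16:ℂ)^n)⁻¹ * KS n (16^K) H x

/-- smooth cutoffs -/
def Cut (H : ℝ → ℝ) : Prop := ContDiff ℝ (⊤ : ℕ∞) H ∧ ∀ u, 1 ≤ |u| → H u = 0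

lemma Cut.deriv_bound {H : ℝ → ℝ} (h : Cut H) (m : ℕ) : ∃ A, ∀ u, |iteratedDeriv m H u| ≤ A := by
  have hc : HasCompactSupport H := by
    refine HasCompactSupport.intro (K := Set.Icc (-1) 1) isCompact_Icc ?_
    intro u hu
    refine h.2 u ?_
    by_contra hlt
    push Not at hlt
    exact hu ⟨(abs_lt.1 hlt).1.le, (abs_lt.1 hlt).2.le⟩
  have hs : HasCompactSupport (iteratedDeriv m H) := by
    induction m with
    | zero => simpa using hc
    | succ m ih => rw [iteratedDeriv_succ]; exact ih.deriv
  have hcont : Continuous (iteratedDeriv m H) := h.1.continuous_iteratedDeriv m (by exact_mod_cast le_top)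
  obtain ⟨A, hA⟩ := hs.exists_bound_of_continuous hcont
  exact ⟨A, fun u => hA u⟩

lemma ker_decay {H : ℝ → ℝ} (h : Cut H) : ∃ C : ℝ, 1 ≤ C ∧ ∀ n K : ℕ, K ≤ n → ∀ x : ℕ, x < 16^n → ∀ y : ℕ, y < 16^n →
    ‖ker n K H ((x:ℤ) - y)‖ ≤ C * (LL n K)⁻¹ * (W n K x y)^9 := by
  obtain ⟨A0, hA0⟩ := h.deriv_bound 0
  obtain ⟨A9, hA9⟩ := h.deriv_bound 9
  have p0 : 0 ≤ A0 := (abs_nonneg _).trans (hA0 0)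
  have p9 : 0 ≤ A9 := (abs_nonneg _).trans (hA9 0)
  refine ⟨1 + 5376 * (A0 + A9), by linarith [p0, p9], ?_⟩
  intro n K hK x hx y hy
  have hR : 0 < 16^K := by positivity
  have hRr : (0:ℝ) < ((16^K : ℕ) : ℝ) := by positivity
  have hL := LL_pos n K
  have hML : (16:ℝ)^n = (16:ℝ)^K * LL n K := by unfold LL; rw [← pow_add]; congr 1; omega
  set S := KS n (16^K) H ((x:ℤ) - y) with hS
  have b0 : ‖S‖ ≤ 21 * ((16^K : ℕ) : ℝ) * A0 := KS_bound hR (by simpa using hA0) _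
  have b9 : ‖(ee n (-((x:ℤ) - y)) - 1)^9 * S‖ ≤ 21 * ((16^K : ℕ) : ℝ) * ((1 / ((16^K : ℕ) : ℝ))^9 * A9) := by
    rw [hS, ← KS_iter hR h.2 _ 9 le_rfl]
    refine KS_bound hR ?_ _
    have := dd_bound (h := 1 / ((16^K : ℕ) : ℝ)) (by positivity) 9 (fun j => iteratedDeriv j H) A9 ?_ hA9
    · simpa using this
    · intro j u
      rw [iteratedDeriv_succ]
      exact (h.1.differentiable_iteratedDeriv j (by exact_mod_cast WithTop.coe_lt_top _) u).hasDerivAt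
  rw [norm_mul, norm_pow] at b9
  push_cast at b0 b9
  set v := cd n x y / LL n K with hv
  have v0 : 0 ≤ v := div_nonneg (cd_nonneg _ _ _) hL.le
  have hq : v / 16^K ≤ ‖ee n (-((x:ℤ) - y)) - 1‖ := by
    refine le_trans ?_ (ee_lower hx hy)
    rw [hML, hv]
    have := cd_nonneg n x y
    rw [div_div, mul_comm (LL n K)]
    gcongr; linarith
  have b9' : v^9 * ‖S‖ ≤ 21 * 16^K * A9 := by
    have h1 : (v/16^K)^9 * ‖S‖ ≤ 21 * 16^K * ((1/16^K)^9 * A9) := le_trans (by gcongr) b9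
    have h2 : (16^K:ℝ)^9 * ((v/16^K)^9 * ‖S‖) ≤ (16^K:ℝ)^9 * (21 * 16^K * ((1/16^K)^9 * A9)) := by gcongr
    calc v^9 * ‖S‖ = (16^K:ℝ)^9 * ((v/16^K)^9 * ‖S‖) := by field_simp
      _ ≤ _ := h2
      _ = _ := by field_simp
  have hW : W n K x y = (1 + v)⁻¹ := by
    unfold W; rw [hv]; field_simp
  have h3 : (1+v)^9 ≤ 2^8 * (1^9 + v^9) := add_pow_le zero_le_one v0 9
  have h4 : (1+v)^9 * ‖S‖ ≤ 5376 * (A0 + A9) * 16^K := by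
    calc _ ≤ (2^8 * (1^9 + v^9)) * ‖S‖ := by gcongr
      _ = 256 * (‖S‖ + v^9 * ‖S‖) := by ring
      _ ≤ 256 * (21 * 16^K * A0 + 21 * 16^K * A9) := by gcongr
      _ = _ := by ring
  unfold ker
  rw [norm_mul, norm_inv, norm_pow, hW, inv_pow, ← hS]
  have : ‖(16:ℂ)‖ = 16 := by simp
  rw [this, hML]
  have h5 : 0 < (1+v)^9 := by positivity
  rw [← div_eq_mul_inv, le_div_iff₀ h5]
  calc _ = (16^K * LL n K)⁻¹ * ((1+v)^9 * ‖S‖) := by ring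
    _ ≤ (16^K * LL n K)⁻¹ * (5376 * (A0 + A9) * 16^K) := by gcongr
    _ = (5376 * (A0 + A9)) * (LL n K)⁻¹ := by field_simp
    _ ≤ _ := by gcongr; linarith
end Carl

namespace Carl
open Finset
open scoped Classical ComplexConjugate
variable {n : ℕ} {C0 : ℝ}

lemma ker_conj (n K : ℕ) (H : ℝ → ℝ) (x : ℤ) : conj (ker n K H x) = ker n K H (-x) := by
  unfold ker KS
  rw [map_mul, map_sum, map_inv₀, map_pow]
  congr 1
  · rw [map_ofNat]
  · refine Finset.sum_congr rfl fun ξ _ => ?_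
    rw [map_mul, ee_conj, Complex.conj_ofReal]; congr 2; ring

lemma dvd_eq_zero_of_abs {M a : ℤ} (h : M ∣ a) (h' : |a| < M) : a = 0 := Int.eq_zero_of_abs_lt_dvd h h'

lemma Cut.lt_of_ne {H : ℝ → ℝ} (h : Cut H) {K : ℕ} {ξ : ℤ} (hne : H ((ξ:ℝ) / ((16^K : ℕ) : ℝ)) ≠ 0) : |ξ| < 16^K := by
  by_contra hc
  push Not at hc
  refine hne (h.2 _ ?_)
  have : (0:ℝ) < ((16^K : ℕ) : ℝ) := by positivity
  rw [abs_div, abs_of_pos this, le_div_iff₀ this, one_mul]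
  have : (((16^K : ℤ)) : ℝ) ≤ ((|ξ| : ℤ) : ℝ) := by exact_mod_cast hc
  push_cast at this ⊢; exact this

/-- convolution with a character -/
lemma conv_ee {H : ℝ → ℝ} (h : Cut H) {K : ℕ} {η : ℤ} (hη : |η| + 16^K < 16^n) (a : ℤ) :
    ∑ y ∈ range (16^n), ker n K H (a - y) * ee n (η * y) = (H ((η:ℝ) / ((16^K : ℕ) : ℝ)) : ℂ) * ee n (η * a) := by
  have hM : (16:ℂ)^n ≠ 0 := pow_ne_zero _ (by norm_num)
  have e1 : ∀ y ∈ range (16^n), ker n K H (a - y) * ee n (η * y) = ((16:ℂ)^n)⁻¹ * ∑ ξ ∈ Icc (-((16^K : ℕ) + 9 : ℤ)) ((16^K : ℕ) + 9),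
      (H ((ξ:ℝ) / ((16^K : ℕ) : ℝ)) : ℂ) * ee n (ξ * a) * ee n ((η - ξ) * y) := by
    intro y _
    unfold ker KS
    rw [mul_assoc, Finset.sum_mul]
    congr 1
    refine Finset.sum_congr rfl fun ξ _ => ?_
    rw [mul_assoc, mul_assoc, ← ee_add, ← ee_add]; congr 2; ring
  rw [Finset.sum_congr rfl e1, ← Finset.mul_sum, Finset.sum_comm]
  simp_rw [← Finset.mul_sum, ee_sum]
  have e2 : ∀ ξ ∈ Icc (-((16^K : ℕ) + 9 : ℤ)) ((16^K : ℕ) + 9), (H ((ξ:ℝ) / ((16^K : ℕ) : ℝ)) : ℂ) * ee n (ξ * a) * (if (16^n : ℤ) ∣ η - ξ then (16^n : ℂ) else 0)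
      = if ξ = η then (H ((η:ℝ) / ((16^K : ℕ) : ℝ)) : ℂ) * ee n (η * a) * 16^n else 0 := by
    intro ξ _
    by_cases hx : ξ = η
    · subst hx; simp
    rw [if_neg hx]
    by_cases h0 : H ((ξ:ℝ) / ((16^K : ℕ) : ℝ)) = 0
    · rw [h0]; simp
    rw [if_neg, mul_zero]
    intro hd
    have h1 := h.lt_of_ne h0
    have h2 := dvd_eq_zero_of_abs hd (lt_of_le_of_lt (abs_sub _ _) (by linarith))
    exact hx (by linarith)
  rw [Finset.sum_congr rfl e2, Finset.sum_ite_eq']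
  by_cases hm : η ∈ Icc (-((16^K : ℕ) + 9 : ℤ)) ((16^K : ℕ) + 9)
  · rw [if_pos hm]; field_simp
  · rw [if_neg hm, mul_zero]
    by_cases h0 : H ((η:ℝ) / ((16^K : ℕ) : ℝ)) = 0
    · rw [h0]; simp
    · exfalso
      apply hm
      have h1 := abs_lt.1 (h.lt_of_ne h0)
      rw [mem_Icc]; push_cast; constructor <;> linarith [h1.1, h1.2]

lemma conv_ker {H G : ℝ → ℝ} (h : Cut H) (hG : Cut G) {K J : ℕ} (hK : K + 1 ≤ n) (hJ : J + 1 ≤ n) (a b : ℤ) :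
    ∑ y ∈ range (16^n), ker n K H (a - y) * ker n J G (y - b) =
      ((16:ℂ)^n)⁻¹ * ∑ η ∈ Icc (-((16^J : ℕ) + 9 : ℤ)) ((16^J : ℕ) + 9),
        (G ((η:ℝ) / ((16^J : ℕ) : ℝ)) : ℂ) * ((H ((η:ℝ) / ((16^K : ℕ) : ℝ)) : ℂ)) * ee n (η * (a - b)) := by
  have e1 : ∀ y ∈ range (16^n), ker n K H (a - y) * ker n J G (y - b) = ((16:ℂ)^n)⁻¹ * ∑ η ∈ Icc (-((16^J : ℕ) + 9 : ℤ)) ((16^J : ℕ) + 9),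
      (G ((η:ℝ) / ((16^J : ℕ) : ℝ)) : ℂ) * ee n (- η * b) * (ker n K H (a - y) * ee n (η * y)) := by
    intro y _
    unfold ker KS
    rw [mul_left_comm]
    conv_lhs => rw [Finset.mul_sum]
    congr 1
    refine Finset.sum_congr rfl fun ξ _ => ?_
    have : ee n (ξ * (y - b)) = ee n (-ξ * b) * ee n (ξ * y) := by rw [← ee_add]; congr 1; ring
    rw [this]; ring
  rw [Finset.sum_congr rfl e1, ← Finset.mul_sum, Finset.sum_comm]
  congr 1
  refine Finset.sum_congr rfl fun η _ => ?_
  rw [← Finset.mul_sum]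
  by_cases h0 : G ((η:ℝ) / ((16^J : ℕ) : ℝ)) = 0
  · rw [h0]; simp
  have h1 := hG.lt_of_ne h0
  have h2 : (16:ℤ)^K ≤ 16^(n-1) := pow_le_pow_right₀ (by norm_num) (by omega)
  have h3 : (16:ℤ)^J ≤ 16^(n-1) := pow_le_pow_right₀ (by norm_num) (by omega)
  have h4 : (16:ℤ)^n = 16 * 16^(n-1) := by rw [← pow_succ']; congr 1; omega
  have h5 : (0:ℤ) < 16^(n-1) := by positivity
  rw [conv_ee h (by linarith)]
  have : ee n (η * (a - b)) = ee n (-η * b) * ee n (η * a) := by rw [← ee_add]; congr 1; ring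
  rw [this]; ring

lemma orth2 {H G : ℝ → ℝ} {K J : ℕ} {z z' a b : ℤ}
    (hne : ∑ x ∈ range (16^n), (ee n (z * (x - a)) * ker n K H (x - a)) * conj (ee n (z' * (x - b)) * ker n J G (x - b)) ≠ 0) :
    ∃ ξ η : ℤ, H ((ξ:ℝ) / ((16^K : ℕ) : ℝ)) ≠ 0 ∧ G ((η:ℝ) / ((16^J : ℕ) : ℝ)) ≠ 0 ∧ (16^n : ℤ) ∣ z + ξ - z' - η := by
  have e1 : ∀ x ∈ range (16^n), (ee n (z * (x - a)) * ker n K H (x - a)) * conj (ee n (z' * (x - b)) * ker n J G (x - b)) =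
      ∑ ξ ∈ Icc (-((16^K : ℕ) + 9 : ℤ)) ((16^K : ℕ) + 9), ∑ η ∈ Icc (-((16^J : ℕ) + 9 : ℤ)) ((16^J : ℕ) + 9),
        (((16:ℂ)^n)⁻¹ * ((16:ℂ)^n)⁻¹ * (H ((ξ:ℝ) / ((16^K : ℕ) : ℝ)) : ℂ) * (G ((η:ℝ) / ((16^J : ℕ) : ℝ)) : ℂ) *
          ee n (-z * a - ξ * a + z' * b + η * b)) * ee n ((z + ξ - z' - η) * x) := by
    intro x _
    rw [map_mul, ker_conj, ee_conj]
    unfold ker KS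
    have : ∀ A B c : ℂ, ∀ S T : ℂ, (A * (c * S)) * (B * (c * T)) = (c * c * A * B) * (S * T) := by intros; ring
    rw [this, Finset.sum_mul_sum, Finset.mul_sum]
    refine Finset.sum_congr rfl fun ξ _ => ?_
    rw [Finset.mul_sum]
    refine Finset.sum_congr rfl fun η _ => ?_
    have : ee n (-z * a - ξ * a + z' * b + η * b) * ee n ((z + ξ - z' - η) * x) =
        ee n (z * (x - a)) * ee n (-(z' * (x - b))) * ee n (ξ * (x - a)) * ee n (η * (-(x - b))) := by
      simp only [← ee_add]; congr 1; ring
    rw [mul_assoc _ (ee n (-z * a - ξ * a + z' * b + η * b)), this]; ring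
  rw [Finset.sum_congr rfl e1, Finset.sum_comm] at hne
  obtain ⟨ξ, _, h1⟩ := Finset.exists_ne_zero_of_sum_ne_zero hne
  rw [Finset.sum_comm] at h1
  obtain ⟨η, _, h2⟩ := Finset.exists_ne_zero_of_sum_ne_zero h1
  rw [← Finset.mul_sum, ee_sum] at h2
  refine ⟨ξ, η, ?_, ?_, ?_⟩
  · intro h; rw [h] at h2; simp at h2
  · intro h; rw [h] at h2; simp at h2
  · by_contra h; rw [if_neg h] at h2; simp at h2

/-- synthesis bound -/
lemma synth {K : ℕ} (hK : K ≤ n) {F : ℕ → ℕ → ℂ} {B : ℝ} (hB : 0 ≤ B)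
    (hF : ∀ i < 16^K, ∀ x < 16^n, ‖F i x‖ ≤ B * (W n K x (i * LN n K))^8) (b : ℕ → ℂ) :
    ∑ x ∈ range (16^n), ‖∑ i ∈ range (16^K), b i * F i x‖^2 ≤ 324 * B^2 * LL n K * ∑ i ∈ range (16^K), ‖b i‖^2 := by
  have hL := LL_pos n K
  have h1 : ∀ x ∈ range (16^n), ‖∑ i ∈ range (16^K), b i * F i x‖^2 ≤
      36 * B^2 * ∑ i ∈ range (16^K), ‖b i‖^2 * (W n K x (i * LN n K))^2 := by
    intro x hx
    rw [mem_range] at hx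
    have a1 : ‖∑ i ∈ range (16^K), b i * F i x‖ ≤ B * ∑ i ∈ range (16^K), (W n K x (i * LN n K)) * (‖b i‖ * W n K x (i * LN n K)) := by
      rw [Finset.mul_sum]
      refine (norm_sum_le _ _).trans (Finset.sum_le_sum fun i hi => ?_)
      rw [norm_mul]
      have w0 := W_pos n K x (i * LN n K)
      have w1 := W_le_one n K x (i * LN n K)
      calc ‖b i‖ * ‖F i x‖ ≤ ‖b i‖ * (B * (W n K x (i * LN n K))^8) := by
            gcongr; exact hF i (mem_range.1 hi) x hx
        _ ≤ ‖b i‖ * (B * (W n K x (i * LN n K))^2) := by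
            gcongr ‖b i‖ * (B * ?_)
            exact pow_le_pow_of_le_one w0.le w1 (by norm_num)
        _ = _ := by ring
    have a2 := Finset.sum_mul_sq_le_sq_mul_sq (range (16^K)) (fun i => W n K x (i * LN n K)) (fun i => ‖b i‖ * W n K x (i * LN n K))
    have a3 : ∑ i ∈ range (16^K), (W n K x (i * LN n K))^2 ≤ 36 := by
      have := W5 (le_refl K) hK hx
      rw [mul_comm] at this
      exact le_of_mul_le_mul_right this hL
    calc _ ≤ (B * ∑ i ∈ range (16^K), (W n K x (i * LN n K)) * (‖b i‖ * W n K x (i * LN n K)))^2 := by gcongr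
      _ = B^2 * (∑ i ∈ range (16^K), (W n K x (i * LN n K)) * (‖b i‖ * W n K x (i * LN n K)))^2 := by ring
      _ ≤ B^2 * (36 * ∑ i ∈ range (16^K), (‖b i‖ * W n K x (i * LN n K))^2) := by
          refine mul_le_mul_of_nonneg_left (a2.trans ?_) (by positivity)
          exact mul_le_mul_of_nonneg_right a3 (Finset.sum_nonneg fun i _ => by positivity)
      _ = _ := by
          rw [← mul_assoc, mul_comm (B^2)]; congr 1
          exact Finset.sum_congr rfl fun i _ => by ring
  refine (Finset.sum_le_sum h1).trans ?_
  rw [← Finset.mul_sum, Finset.sum_comm]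
  calc _ ≤ 36 * B^2 * ∑ i ∈ range (16^K), ‖b i‖^2 * (9 * LL n K) := by
        refine mul_le_mul_of_nonneg_left (Finset.sum_le_sum fun i hi => ?_) (by positivity)
        rw [← Finset.mul_sum]
        exact mul_le_mul_of_nonneg_left (W_sum' (mul_LN_lt hK (mem_range.1 hi))) (by positivity)
    _ = _ := by rw [← Finset.sum_mul]; ring
end Carl

namespace Carl
open Finset
open scoped Classical ComplexConjugate
variable {n : ℕ} {C0 : ℝ}

/-- one sided cutoff -/
noncomputable def tht (u : ℝ) : ℝ := Real.smoothTransition (-8 * u - 2)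
/-- annular cutoff -/
noncomputable def chi (u : ℝ) : ℝ := tht (16 * u) - tht u
/-- wide annular cutoff -/
noncomputable def rho (u : ℝ) : ℝ := Real.smoothTransition ((256 * u + 512/5) / 5) * Real.smoothTransition (-256 * u - 2)
/-- central cutoff -/
noncomputable def pcc (u : ℝ) : ℝ := Real.smoothTransition (2 - 2 * u) * Real.smoothTransition (2 + 2 * u)
/-- tent -/
noncomputable def hat (u : ℝ) : ℝ := max 0 (1 - |u|)

lemma tht_one {u : ℝ} (h : u ≤ -3/8) : tht u = 1 := Real.smoothTransition.one_of_one_le (by linarith)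
lemma tht_zero {u : ℝ} (h : -1/4 ≤ u) : tht u = 0 := Real.smoothTransition.zero_of_nonpos (by linarith)
lemma tht_nonneg (u : ℝ) : 0 ≤ tht u := Real.smoothTransition.nonneg _
lemma tht_le_one (u : ℝ) : tht u ≤ 1 := Real.smoothTransition.le_one _

lemma chi_supp {u : ℝ} (h : chi u ≠ 0) : -3/8 < u ∧ u < -1/64 := by
  constructor
  · by_contra hc; push Not at hc
    refine h ?_
    unfold chi; rw [tht_one hc, tht_one (by linarith)]; ring
  · by_contra hc; push Not at hc
    refine h ?_
    unfold chi; rw [tht_zero (by linarith), tht_zero (by linarith)]; ring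

lemma rho_supp {u : ℝ} (h : rho u ≠ 0) : -2/5 < u ∧ u < -2/256 := by
  constructor
  · by_contra hc; push Not at hc
    refine h ?_
    unfold rho; rw [Real.smoothTransition.zero_of_nonpos (by linarith)]; ring
  · by_contra hc; push Not at hc
    refine h ?_
    unfold rho; rw [Real.smoothTransition.zero_of_nonpos (x := -256 * u - 2) (by linarith)]; ring

lemma rho_one {u : ℝ} (h1 : -97/256 ≤ u) (h2 : u ≤ -3/256) : rho u = 1 := by
  unfold rho
  rw [Real.smoothTransition.one_of_one_le (by linarith), Real.smoothTransition.one_of_one_le (by linarith)]; ring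

lemma pcc_one {u : ℝ} (h1 : -1/2 ≤ u) (h2 : u ≤ 1/2) : pcc u = 1 := by
  unfold pcc
  rw [Real.smoothTransition.one_of_one_le (by linarith), Real.smoothTransition.one_of_one_le (by linarith)]; ring

lemma pcc_zero {u : ℝ} (h1 : u ≤ -1 ∨ 1 ≤ u) : pcc u = 0 := by
  unfold pcc
  rcases h1 with h1 | h1
  · rw [Real.smoothTransition.zero_of_nonpos (x := 2 + 2 * u) (by linarith)]; ring
  · rw [Real.smoothTransition.zero_of_nonpos (x := 2 - 2 * u) (by linarith)]; ring

lemma cut_chi : Cut chi := by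
  constructor
  · unfold chi tht
    exact (Real.smoothTransition.contDiff.comp (by fun_prop)).sub (Real.smoothTransition.contDiff.comp (by fun_prop))
  · intro u hu
    by_contra h
    have := chi_supp h
    have h2 : |u| < 1 := abs_lt.2 ⟨by linarith, by linarith⟩
    linarith

lemma cut_rho : Cut rho := by
  constructor
  · unfold rho
    exact (Real.smoothTransition.contDiff.comp (by fun_prop)).mul (Real.smoothTransition.contDiff.comp (by fun_prop))
  · intro u hu
    by_contra h
    have := rho_supp h
    have h2 : |u| < 1 := abs_lt.2 ⟨by linarith, by linarith⟩
    linarith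

lemma cut_pcc : Cut pcc := by
  constructor
  · unfold pcc
    exact (Real.smoothTransition.contDiff.comp (by fun_prop)).mul (Real.smoothTransition.contDiff.comp (by fun_prop))
  · intro u hu
    refine pcc_zero ?_
    rcases le_abs.1 hu with h | h
    · right; exact h
    · left; linarith

lemma hat_nonneg (u : ℝ) : 0 ≤ hat u := le_max_left _ _
lemma hat_le_one (u : ℝ) : hat u ≤ 1 := max_le zero_le_one (by linarith [abs_nonneg u])
lemma hat_lip (u v : ℝ) : |hat u - hat v| ≤ |u - v| := by
  unfold hat
  rw [max_comm 0, max_comm 0]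
  refine (abs_max_sub_max_le_abs (1 - |u|) (1 - |v|) 0).trans ?_
  rw [show 1 - |u| - (1 - |v|) = -(|u| - |v|) by ring, abs_neg]
  exact abs_abs_sub_abs_le _ _
lemma hat_supp {u : ℝ} (h : hat u ≠ 0) : |u| < 1 := by
  by_contra hc; push Not at hc
  exact h (max_eq_left (by linarith))

/-- center frequency -/
def zz (τ : ℕ → ℕ) (K w : ℕ) : ℕ := w * 16^K + τ K

/-- concrete packets -/
noncomputable def tphi (n : ℕ) (τ : ℕ → ℕ) (p : Tile) (x : ℕ) : ℂ :=
  if zz τ p.K p.w < 16^n then ee n ((zz τ p.K p.w : ℤ) * ((x:ℤ) - (p.y n : ℤ))) * ker n p.K rho ((x:ℤ) - (p.y n : ℤ)) else 0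

/-- the tent factor -/
noncomputable def hatp (τ : ℕ → ℕ) (K w N : ℕ) : ℝ := hat (((N:ℝ) - (zz τ K w : ℝ)) / 16^(K-2))

/-- concrete modified packets -/
noncomputable def tTh (n : ℕ) (τ : ℕ → ℕ) (p : Tile) (N x : ℕ) : ℂ :=
  ((LL n p.K * hatp τ p.K p.w N : ℝ) : ℂ) * (ee n ((N : ℤ) * ((x:ℤ) - (p.y n : ℤ))) * ker n p.K chi ((x:ℤ) - (p.y n : ℤ)))

/-- concrete truncation -/
noncomputable def tPsi (n K ξ x y : ℕ) : ℂ := ee n ((ξ:ℤ) * ((x:ℤ) - y)) * ker n K pcc ((x:ℤ) - y)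

lemma hatp_nonneg (τ : ℕ → ℕ) (K w N : ℕ) : 0 ≤ hatp τ K w N := hat_nonneg _
lemma hatp_le_one (τ : ℕ → ℕ) (K w N : ℕ) : hatp τ K w N ≤ 1 := hat_le_one _

lemma hatp_supp {τ : ℕ → ℕ} {K w N : ℕ} (h : hatp τ K w N ≠ 0) : |(N:ℤ) - zz τ K w| < 16^(K-2) := by
  have := hat_supp h
  rw [abs_div, abs_of_pos (a := (16:ℝ)^(K-2)) (by positivity), div_lt_one (by positivity)] at this
  exact_mod_cast this

lemma pow_split {K : ℕ} (hK : 2 ≤ K) : 16^K = 256 * 16^(K-2) := by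
  obtain ⟨m, rfl⟩ := Nat.exists_eq_add_of_le' hK
  simp [pow_add]; ring

lemma th_alg (n : ℕ) (τ : ℕ → ℕ) (K : ℕ) (p : Tile) (ξ x : ℕ) (H : ℝ → ℝ) (hH : Cut H) (hK : K + 1 ≤ n) (hp : Valid n p) :
    ∑ y ∈ range (16^n), (ee n ((ξ:ℤ) * ((x:ℤ) - (y:ℤ))) * ker n K H ((x:ℤ) - y)) * tTh n τ p ξ y =
      ((LL n p.K * hatp τ p.K p.w ξ : ℝ) : ℂ) * ee n ((ξ:ℤ) * ((x:ℤ) - (p.y n : ℤ))) *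
      (((16:ℂ)^n)⁻¹ * ∑ η ∈ Icc (-((16^p.K : ℕ) + 9 : ℤ)) ((16^p.K : ℕ) + 9),
        (chi ((η:ℝ) / ((16^p.K : ℕ) : ℝ)) : ℂ) * ((H ((η:ℝ) / ((16^K : ℕ) : ℝ)) : ℂ)) * ee n (η * ((x:ℤ) - (p.y n : ℤ)))) := by
  rw [← conv_ker hH cut_chi hK hp.2.1, Finset.mul_sum]
  refine Finset.sum_congr rfl fun y _ => ?_
  unfold tTh
  have : ee n ((ξ:ℤ) * ((x:ℤ) - (p.y n : ℤ))) = ee n ((ξ:ℤ) * ((x:ℤ) - (y:ℤ))) * ee n ((ξ:ℤ) * ((y:ℤ) - (p.y n : ℤ))) := by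
    rw [← ee_add]; congr 1; ring
  rw [this]; ring

lemma chi_int {K : ℕ} {ξ : ℤ} (h : chi ((ξ:ℝ) / ((16^K : ℕ) : ℝ)) ≠ 0) : -3 * 16^K < 8 * ξ ∧ 64 * ξ < - 16^K := by
  have := chi_supp h
  have p : (0:ℝ) < ((16^K : ℕ) : ℝ) := by positivity
  rw [lt_div_iff₀ p, div_lt_iff₀ p] at this
  push_cast at this
  constructor
  · have : (-3 * 16^K : ℝ) < 8 * ξ := by linarith [this.1]
    exact_mod_cast this
  · have : (64 * ξ : ℝ) < -16^K := by linarith [this.2]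
    exact_mod_cast this

lemma rho_int {K : ℕ} {ξ : ℤ} (h : rho ((ξ:ℝ) / ((16^K : ℕ) : ℝ)) ≠ 0) : -2 * 16^K < 5 * ξ ∧ 256 * ξ < - 2 * 16^K := by
  have := rho_supp h
  have p : (0:ℝ) < ((16^K : ℕ) : ℝ) := by positivity
  rw [lt_div_iff₀ p, div_lt_iff₀ p] at this
  push_cast at this
  constructor
  · have : (-2 * 16^K : ℝ) < 5 * ξ := by linarith [this.1]
    exact_mod_cast this
  · have : (256 * ξ : ℝ) < -2 * 16^K := by linarith [this.2]
    exact_mod_cast this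

lemma div_eq_w {s m w : ℕ} (h1 : w * m ≤ s) (h2 : s < w * m + m) : s / m = w :=
  Nat.div_eq_of_lt_le h1 (by rw [add_mul, one_mul]; exact h2)

/-- admissible shifts -/
def Adm (n : ℕ) (τ : ℕ → ℕ) : Prop := ∀ K, 2 ≤ K → K + 1 ≤ n → 2 * 16^K ≤ 5 * τ K ∧ τ K + 16^(K-2) ≤ 16^K

lemma tphi_orth {τ : ℕ → ℕ} (hτ : Adm n τ) (p q : Tile) (hp : Valid n p) (hq : Valid n q)
    (hne : ∑ x ∈ range (16^n), tphi n τ p x * conj (tphi n τ q x) ≠ 0) :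
    ∃ s : ℕ, s / 16^p.K = p.w ∧ s / 16^q.K = q.w ∧ s + 2 * 16^(p.K-2) ≤ zz τ p.K p.w ∧
      s + 2 * 16^(q.K-2) ≤ zz τ q.K q.w := by
  by_cases h1 : zz τ p.K p.w < 16^n
  swap
  · exfalso; apply hne; refine Finset.sum_eq_zero fun x _ => ?_
    unfold tphi; rw [if_neg h1, zero_mul]
  by_cases h2 : zz τ q.K q.w < 16^n
  swap
  · exfalso; apply hne; refine Finset.sum_eq_zero fun x _ => ?_
    unfold tphi; rw [if_neg h2, map_zero, mul_zero]
  unfold tphi at hne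
  simp only [if_pos h1, if_pos h2] at hne
  obtain ⟨ξ, η, hξ, hη, hd⟩ := orth2 hne
  have hξ := rho_int hξ
  have hη := rho_int hη
  have t1 := (hτ p.K hp.1 hp.2.1).1
  have t2 := (hτ q.K hq.1 hq.2.1).1
  have t3 := (hτ p.K hp.1 hp.2.1).2
  have t4 := (hτ q.K hq.1 hq.2.1).2
  have e1 := pow_split hp.1
  have e2 := pow_split hq.1
  unfold zz at *
  zify at t1 t2 t3 t4 e1 e2 h1 h2
  have w1 : (0:ℤ) ≤ p.w * 16^p.K := by positivity
  have w2 : (0:ℤ) ≤ q.w * 16^q.K := by positivity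
  push_cast at hd
  set A := (p.w:ℤ) * 16^p.K
  set B := (q.w:ℤ) * 16^q.K
  have q1 : 0 ≤ A + τ p.K + ξ := by linarith [hξ.1]
  have q2 : 0 ≤ B + τ q.K + η := by linarith [hη.1]
  have q5 : (0:ℤ) < 16^(p.K-2) := by positivity
  have q6 : (0:ℤ) < 16^(q.K-2) := by positivity
  have e0 := dvd_eq_zero_of_abs hd (abs_lt.2 ⟨by linarith [hξ.2, hη.2], by linarith [hξ.2, hη.2]⟩)
  obtain ⟨s, hs⟩ := Int.eq_ofNat_of_zero_le q1
  refine ⟨s, ?_, ?_, ?_, ?_⟩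
  · apply div_eq_w
    · zify; linarith [hξ.1, hξ.2]
    · zify; linarith [hξ.1, hξ.2]
  · apply div_eq_w
    · zify; linarith [hη.1, hη.2]
    · zify; linarith [hη.1, hη.2]
  · zify; linarith [hξ.1, hξ.2]
  · zify; linarith [hη.1, hη.2]

lemma tTh_supp {τ : ℕ → ℕ} (hτ : Adm n τ) (p : Tile) (hp : Valid n p) (N x : ℕ) (h : tTh n τ p N x ≠ 0) :
    N / 16^p.K = p.w ∧ |(N:ℤ) - zz τ p.K p.w| < 16^(p.K-2) := by
  have h0 : hatp τ p.K p.w N ≠ 0 := by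
    intro h0; apply h; unfold tTh; rw [h0]; simp
  have h1 := hatp_supp h0
  refine ⟨?_, h1⟩
  have h2 := abs_lt.1 h1
  have t1 := (hτ p.K hp.1 hp.2.1).1
  have t3 := (hτ p.K hp.1 hp.2.1).2
  have e1 := pow_split hp.1
  unfold zz at h2
  push_cast at h2
  zify at t1 t3 e1
  apply div_eq_w
  · zify; linarith [h2.1, h2.2]
  · zify; linarith [h2.1, h2.2]

lemma tTh_orth (τ : ℕ → ℕ) (p q : Tile) (hp : Valid n p) (hq : Valid n q) (ξ : ℕ) (h : p.K + 3 ≤ q.K) :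
    ∑ x ∈ range (16^n), tTh n τ p ξ x * conj (tTh n τ q ξ x) = 0 := by
  unfold tTh
  have e : ∀ x ∈ range (16^n), ∀ A B C D : ℂ, A * B * conj (C * D) = (A * conj C) * (B * conj D) := by
    intro x _ A B C D; rw [map_mul]; ring
  rw [Finset.sum_congr rfl fun x hx => e x hx _ _ _ _, ← Finset.mul_sum]
  by_contra hne
  obtain ⟨a, b, ha, hb, hd⟩ := orth2 (right_ne_zero_of_mul hne)
  have ha := chi_int ha
  have hb := chi_int hb
  have h2 : (16:ℤ)^p.K ≤ 16^(n-1) := pow_le_pow_right₀ (by norm_num) (by have := hp.2.1; omega)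
  have h3 : (16:ℤ)^q.K ≤ 16^(n-1) := pow_le_pow_right₀ (by norm_num) (by have := hq.2.1; omega)
  have h4 : (16:ℤ)^n = 16 * 16^(n-1) := by rw [← pow_succ']; congr 1; have := hp.2.1; omega
  have h5 : (0:ℤ) < 16^p.K := by positivity
  have h6 : (16:ℤ)^(p.K+3) ≤ 16^q.K := pow_le_pow_right₀ (by norm_num) h
  rw [pow_add] at h6
  have e0 := dvd_eq_zero_of_abs hd (abs_lt.2 ⟨by linarith [ha.1, hb.1, ha.2, hb.2], by linarith [ha.1, hb.1, ha.2, hb.2]⟩)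
  linarith [ha.1, hb.2]

lemma tPsi_id (τ : ℕ → ℕ) (K : ℕ) (hK : K + 1 ≤ n) (p : Tile) (hp : Valid n p) (ξ : ℕ) (h : p.K ≤ K) (x : ℕ) :
    ∑ y ∈ range (16^n), tPsi n K ξ x y * tTh n τ p ξ y = tTh n τ p ξ x := by
  unfold tPsi
  rw [th_alg n τ K p ξ x pcc cut_pcc hK hp]
  unfold tTh ker KS
  rw [mul_assoc]
  congr 3
  refine Finset.sum_congr rfl fun η _ => ?_
  by_cases h0 : chi ((η:ℝ) / ((16^p.K : ℕ) : ℝ)) = 0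
  · rw [h0]; simp
  have h1 := chi_int h0
  rw [pcc_one, Complex.ofReal_one, mul_one]
  · have p0 : (0:ℝ) < ((16^K : ℕ) : ℝ) := by positivity
    rw [le_div_iff₀ p0]
    have h2 : (16:ℤ)^p.K ≤ 16^K := pow_le_pow_right₀ (by norm_num) h
    have : (-1:ℤ) * 16^K ≤ 2 * η := by have : (0:ℤ) < 16^K := by positivity
                                       linarith [h1.1]
    have : (-1:ℝ) * 16^K ≤ 2 * η := by exact_mod_cast this
    push_cast; linarith
  · have p0 : (0:ℝ) < ((16^K : ℕ) : ℝ) := by positivity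
    rw [div_le_iff₀ p0]
    have h2 : η ≤ 0 := by have : (0:ℤ) < 16^p.K := by positivity
                          linarith [h1.2]
    have : (η:ℝ) ≤ 0 := by exact_mod_cast h2
    linarith

lemma tPsi_zero (τ : ℕ → ℕ) (K : ℕ) (hK : K + 1 ≤ n) (p : Tile) (hp : Valid n p) (ξ : ℕ) (h : K + 3 ≤ p.K) (x : ℕ) :
    ∑ y ∈ range (16^n), tPsi n K ξ x y * tTh n τ p ξ y = 0 := by
  unfold tPsi
  rw [th_alg n τ K p ξ x pcc cut_pcc hK hp, Finset.sum_eq_zero, mul_zero, mul_zero]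
  intro η _
  by_cases h0 : chi ((η:ℝ) / ((16^p.K : ℕ) : ℝ)) = 0
  · rw [h0]; simp
  have h1 := chi_int h0
  rw [pcc_zero, Complex.ofReal_zero, mul_zero, zero_mul]
  left
  have p0 : (0:ℝ) < ((16^K : ℕ) : ℝ) := by positivity
  rw [div_le_iff₀ p0]
  have h6 : (16:ℤ)^(K+3) ≤ 16^p.K := pow_le_pow_right₀ (by norm_num) h
  rw [pow_add] at h6
  have : η ≤ -1 * 16^K := by have : (0:ℤ) < 16^K := by positivity
                             linarith [h1.2]
  have : (η:ℝ) ≤ -1 * 16^K := by exact_mod_cast this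
  push_cast; linarith

lemma exists_model : ∃ C0 : ℝ, 1 ≤ C0 ∧ ∀ (n : ℕ) (τ : ℕ → ℕ), Adm n τ → ∃ D : Model n C0, D.φ = tphi n τ ∧ D.Θ = tTh n τ := by
  obtain ⟨C1, h1, d1⟩ := ker_decay cut_rho
  obtain ⟨C2, h2, d2⟩ := ker_decay cut_chi
  obtain ⟨C3, h3, d3⟩ := ker_decay cut_pcc
  have h22 : C2 ≤ C2^2 := by nlinarith
  set C0 : ℝ := 324 * (C1 + C2^2 + C3) with hC0
  have hC : 1 ≤ C0 := by rw [hC0]; linarith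
  refine ⟨C0, hC, ?_⟩
  intro n τ hτ
  have ht : ∀ p, Valid n p → ∀ N, ∀ x < 16^n, ‖tTh n τ p N x‖ ≤ C2 * (W n p.K x (p.y n))^8 := by
    intro p hp N x hx
    have hL := LL_pos n p.K
    have w0 := W_pos n p.K x (p.y n)
    have w1 := W_le_one n p.K x (p.y n)
    unfold tTh
    rw [norm_mul, norm_mul, norm_ee, one_mul, Complex.norm_real, Real.norm_of_nonneg (mul_nonneg hL.le (hatp_nonneg _ _ _ _))]
    calc _ ≤ LL n p.K * 1 * (C2 * (LL n p.K)⁻¹ * (W n p.K x (p.y n))^9) := by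
          gcongr
          · exact hatp_le_one _ _ _ _
          · exact d2 n p.K hp.K_le x hx _ hp.y_lt
      _ = C2 * (W n p.K x (p.y n))^9 := by field_simp
      _ ≤ _ := by
          refine mul_le_mul_of_nonneg_left ?_ (by linarith)
          exact pow_le_pow_of_le_one w0.le w1 (by norm_num)
  refine ⟨⟨zz τ, tphi n τ, tTh n τ, tPsi n, hC, ?_, ?_, ?_, ?_, ?_, ?_, ?_, ?_, ?_, ?_, ?_⟩, rfl, rfl⟩
  · intro p hp
    have t1 := (hτ p.K hp.1 hp.2.1).1
    have t3 := (hτ p.K hp.1 hp.2.1).2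
    have : 0 < 16^(p.K-2) := by positivity
    unfold zz
    apply div_eq_w <;> omega
  · intro p hp x hx
    have hL := LL_pos n p.K
    have w0 := W_pos n p.K x (p.y n)
    have w1 := W_le_one n p.K x (p.y n)
    unfold tphi
    by_cases hz : zz τ p.K p.w < 16^n
    · rw [if_pos hz, norm_mul, norm_ee, one_mul]
      refine (d1 n p.K hp.K_le x hx _ hp.y_lt).trans ?_
      have : C1 ≤ C0 := by rw [hC0]; linarith
      gcongr ?_ * _ * ?_
      · exact pow_le_pow_of_le_one w0.le w1 (by norm_num)
    · rw [if_neg hz, norm_zero]; positivity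
  · intro p hp N x hx
    refine (ht p hp N x hx).trans ?_
    have w0 := W_pos n p.K x (p.y n)
    have : C2 ≤ C0 := by rw [hC0]; linarith
    gcongr
  · intro p hp N N' x hx
    have hL := LL_pos n p.K
    have w0 := W_pos n p.K x (p.y n)
    have w1 := W_le_one n p.K x (p.y n)
    set d : ℤ := (x:ℤ) - (p.y n : ℤ) with hd
    set κ := ker n p.K chi d with hκ
    have bk : LL n p.K * ‖κ‖ ≤ C2 * (W n p.K x (p.y n))^9 := by
      have := mul_le_mul_of_nonneg_left (d2 n p.K hp.K_le x hx _ hp.y_lt) hL.le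
      refine this.trans (le_of_eq ?_)
      field_simp
    have bk8 : LL n p.K * ‖κ‖ ≤ C2 * (W n p.K x (p.y n))^8 := by
      refine bk.trans (mul_le_mul_of_nonneg_left ?_ (by linarith))
      exact pow_le_pow_of_le_one w0.le w1 (by norm_num)
    have e : tTh n τ p N x - tTh n τ p N' x =
        (((hatp τ p.K p.w N - hatp τ p.K p.w N' : ℝ) : ℂ) * ee n (N * d) +
        ((hatp τ p.K p.w N' : ℝ) : ℂ) * (ee n (N' * d) * (ee n (((N:ℤ) - N') * d) - 1))) * (((LL n p.K : ℝ) : ℂ) * κ) := by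
      have : ee n (N' * d) * ee n (((N:ℤ) - N') * d) = ee n (N * d) := by
        rw [← ee_add]; congr 1; ring
      rw [mul_sub (ee n (N' * d)), this]
      unfold tTh
      push_cast; ring
    have b1 : |hatp τ p.K p.w N - hatp τ p.K p.w N'| ≤ 256 * (|(N:ℝ) - N'| / 16^p.K) := by
      refine (hat_lip _ _).trans (le_of_eq ?_)
      have e1 : (16:ℝ)^p.K = 256 * 16^(p.K-2) := by exact_mod_cast pow_split hp.1
      rw [e1, ← sub_div, abs_div, abs_of_pos (a := (16:ℝ)^(p.K-2)) (by positivity)]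
      have : (N:ℝ) - (zz τ p.K p.w : ℝ) - (N' - (zz τ p.K p.w : ℝ)) = N - N' := by ring
      rw [this]; field_simp
    have hML : (16:ℝ)^n = (16:ℝ)^p.K * LL n p.K := by unfold LL; rw [← pow_add]; congr 1; have := hp.K_le; omega
    have hcd := cd_nonneg n x (p.y n)
    have b2 : ‖ee n (((N:ℤ) - N') * d) - 1‖ * (LL n p.K * ‖κ‖) ≤ 7 * (|(N:ℝ) - N'| / 16^p.K) * (C2 * (W n p.K x (p.y n))^8) := by
      have := ee_upper hx hp.y_lt ((N:ℤ) - N')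
      push_cast at this
      have c1 : cd n x (p.y n) * W n p.K x (p.y n) ≤ LL n p.K := by
        unfold W
        rw [mul_div_assoc', div_le_iff₀ (by positivity)]
        nlinarith
      calc _ ≤ (2 * Real.pi * |(N:ℝ) - N'| * cd n x (p.y n) / 16^n) * (C2 * (W n p.K x (p.y n))^9) := by
            gcongr
        _ = (2 * Real.pi * |(N:ℝ) - N'| / 16^n) * (C2 * (W n p.K x (p.y n))^8) * (cd n x (p.y n) * W n p.K x (p.y n)) := by ring
        _ ≤ (2 * Real.pi * |(N:ℝ) - N'| / 16^n) * (C2 * (W n p.K x (p.y n))^8) * LL n p.K := by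
            have := Real.pi_pos
            gcongr
        _ = (2 * Real.pi) * (|(N:ℝ) - N'| / 16^p.K) * (C2 * (W n p.K x (p.y n))^8) := by
            rw [hML]; field_simp
        _ ≤ _ := by
            have := Real.pi_lt_d2
            gcongr; linarith
    rw [e, norm_mul, norm_mul, Complex.norm_real, Real.norm_of_nonneg hL.le]
    calc _ ≤ (|hatp τ p.K p.w N - hatp τ p.K p.w N'| + ‖ee n (((N:ℤ) - N') * d) - 1‖) * (LL n p.K * ‖κ‖) := by
          refine mul_le_mul_of_nonneg_right ?_ (by positivity)
          refine (norm_add_le _ _).trans (add_le_add ?_ ?_)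
          · rw [norm_mul, norm_ee, mul_one, Complex.norm_real, Real.norm_eq_abs]
          · rw [norm_mul, norm_mul, norm_ee, one_mul, Complex.norm_real, Real.norm_of_nonneg (hatp_nonneg _ _ _ _)]
            exact mul_le_of_le_one_left (norm_nonneg _) (hatp_le_one _ _ _ _)
      _ = |hatp τ p.K p.w N - hatp τ p.K p.w N'| * (LL n p.K * ‖κ‖) + ‖ee n (((N:ℤ) - N') * d) - 1‖ * (LL n p.K * ‖κ‖) := by ring
      _ ≤ 256 * (|(N:ℝ) - N'| / 16^p.K) * (C2 * (W n p.K x (p.y n))^8) + 7 * (|(N:ℝ) - N'| / 16^p.K) * (C2 * (W n p.K x (p.y n))^8) := by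
          refine add_le_add ?_ b2
          gcongr
      _ = 263 * C2 * (|(N:ℝ) - N'| / 16^p.K) * (W n p.K x (p.y n))^8 := by ring
      _ ≤ _ := by
          have : 263 * C2 ≤ C0 := by rw [hC0]; linarith
          gcongr
  · intro p hp N x hx h
    exact tTh_supp hτ p hp N x h
  · intro p q hp hq hne
    exact tphi_orth hτ p q hp hq hne
  · intro K w ξ hK hn b
    have hL := LL_pos n K
    refine (synth (by omega) (F := fun i x => tTh n τ ⟨K, i, w⟩ ξ x) (B := C2) (by linarith) ?_ b).trans ?_
    · intro i hi x hx
      exact ht ⟨K, i, w⟩ ⟨hK, hn, hi⟩ ξ x hx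
    · have : 324 * C2^2 ≤ C0 := by rw [hC0]; linarith
      have : 0 ≤ ∑ i ∈ range (16^K), ‖b i‖^2 := Finset.sum_nonneg fun i _ => by positivity
      gcongr
  · intro p q hp hq ξ h
    exact tTh_orth τ p q hp hq ξ h
  · intro K hK ξ x hx y hy
    have hL := LL_pos n K
    have w0 := W_pos n K x y
    have w1 := W_le_one n K x y
    unfold tPsi
    rw [norm_mul, norm_ee, one_mul]
    refine (d3 n K (by omega) x hx _ hy).trans ?_
    have : C3 ≤ C0 := by rw [hC0]; nlinarith
    gcongr ?_ * _ * ?_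
    · exact pow_le_pow_of_le_one w0.le w1 (by norm_num)
  · intro K hK p hp ξ h x _
    exact tPsi_id τ K hK p hp ξ h x
  · intro K hK p hp ξ h x _
    exact tPsi_zero τ K hK p hp ξ h x
end Carl

namespace Carl
open Finset
open scoped Classical ComplexConjugate
variable {n : ℕ} {C0 : ℝ}

lemma samp_inner {K : ℕ} (hK : K ≤ n) {ξ N : ℤ} (h1 : -16^K ≤ 2 * (ξ - N)) (h2 : ξ - N ≤ 0) (x : ℤ) :
    ∑ i ∈ range (16^K), ee n (ξ * ((i * LN n K : ℕ) : ℤ)) * (ee n (N * (x - ((i * LN n K : ℕ) : ℤ))) * ker n K chi (x - ((i * LN n K : ℕ) : ℤ))) =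
      ((LL n K : ℝ) : ℂ)⁻¹ * ((chi (((ξ - N : ℤ) : ℝ) / ((16^K : ℕ) : ℝ)) : ℂ) * ee n (ξ * x)) := by
  have hM : (16:ℂ)^n ≠ 0 := pow_ne_zero _ (by norm_num)
  have hML : (16:ℂ)^n = (16:ℂ)^K * ((LL n K : ℝ) : ℂ) := by
    unfold LL; push_cast; rw [← pow_add]; congr 1; omega
  have hLc : ((LL n K : ℝ) : ℂ) ≠ 0 := by exact_mod_cast (LL_pos n K).ne'
  have e1 : ∀ i ∈ range (16^K), ee n (ξ * ((i * LN n K : ℕ) : ℤ)) * (ee n (N * (x - ((i * LN n K : ℕ) : ℤ))) * ker n K chi (x - ((i * LN n K : ℕ) : ℤ))) =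
      ((16:ℂ)^n)⁻¹ * ∑ η ∈ Icc (-((16^K : ℕ) + 9 : ℤ)) ((16^K : ℕ) + 9),
      (chi ((η:ℝ) / ((16^K : ℕ) : ℝ)) : ℂ) * ee n ((N + η) * x) * ee n ((ξ - N - η) * ((i * LN n K : ℕ) : ℤ)) := by
    intro i _
    set y : ℤ := ((i * LN n K : ℕ) : ℤ)
    unfold ker KS
    have : ∀ A B c S : ℂ, A * (B * (c * S)) = c * (A * B * S) := by intros; ring
    rw [this, Finset.mul_sum]
    congr 1
    refine Finset.sum_congr rfl fun η _ => ?_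
    have : ee n ((N + η) * x) * ee n ((ξ - N - η) * y) = ee n (ξ * y) * ee n (N * (x - y)) * ee n (η * (x - y)) := by
      simp only [← ee_add]; congr 1; ring
    rw [mul_assoc _ (ee n ((N + η) * x)), this]; ring
  rw [Finset.sum_congr rfl e1, ← Finset.mul_sum, Finset.sum_comm]
  have hLm : LN n K * 16^K = 16^n := by unfold LN; rw [← pow_add]; congr 1; omega
  simp_rw [← Finset.mul_sum, ee_sum_gen (LN n K) (16^K) hLm]
  set d := ξ - N with hd
  have e2 : ∀ η ∈ Icc (-((16^K : ℕ) + 9 : ℤ)) ((16^K : ℕ) + 9), (chi ((η:ℝ) / ((16^K : ℕ) : ℝ)) : ℂ) * ee n ((N + η) * x) * (if (((16^K : ℕ)) : ℤ) ∣ d - η then (((16^K : ℕ)) : ℂ) else 0)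
      = if η = d then (chi ((d:ℝ) / ((16^K : ℕ) : ℝ)) : ℂ) * ee n (ξ * x) * 16^K else 0 := by
    intro η _
    by_cases hx : η = d
    · rw [hx, hd]; simp
    rw [if_neg hx]
    by_cases h0 : chi ((η:ℝ) / ((16^K : ℕ) : ℝ)) = 0
    · rw [h0]; simp
    rw [if_neg, mul_zero]
    intro hdv
    have h3 := chi_int h0
    push_cast at hdv
    have := dvd_eq_zero_of_abs hdv (abs_lt.2 ⟨by linarith [h3.1, h3.2], by linarith [h3.1, h3.2]⟩)
    exact hx (by linarith)
  rw [Finset.sum_congr rfl e2, Finset.sum_ite_eq']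
  have hm : d ∈ Icc (-((16^K : ℕ) + 9 : ℤ)) ((16^K : ℕ) + 9) := by
    have : (0:ℤ) < 16^K := by positivity
    rw [mem_Icc]; push_cast; constructor <;> linarith
  have hKc : (16:ℂ)^K ≠ 0 := pow_ne_zero _ (by norm_num)
  rw [if_pos hm, hML]; field_simp

/-- coefficient of a trigonometric polynomial -/
lemma coef_trig {τ : ℕ → ℕ} {K w : ℕ} (hK : K + 1 ≤ n) (hz : zz τ K w < 2 * 16^(n-1)) {Q s : ℕ} (hQ : Q + s ≤ 16^(n-1))
    (F : ℕ → ℂ) (i : ℕ) :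
    ∑ x ∈ range (16^n), (∑ ξ ∈ range Q, F ξ * ee n (((ξ:ℤ) + s) * x)) * conj (tphi n τ ⟨K, i, w⟩ x) =
      ∑ ξ ∈ range Q, F ξ * (rho ((((ξ:ℤ) + s - zz τ K w : ℤ) : ℝ) / ((16^K : ℕ) : ℝ)) : ℂ) * ee n (((ξ:ℤ) + s) * ((i * LN n K : ℕ) : ℤ)) := by
  have h2 : (16:ℤ)^K ≤ 16^(n-1) := pow_le_pow_right₀ (by norm_num) (by omega)
  have h4 : (16:ℤ)^n = 16 * 16^(n-1) := by rw [← pow_succ']; congr 1; omega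
  have h4' : (16:ℕ)^n = 16 * 16^(n-1) := by rw [← pow_succ']; congr 1; omega
  have h5 : (0:ℤ) < 16^(n-1) := by positivity
  have hz' : zz τ K w < 16^n := by omega
  zify at hz hQ
  set y : ℤ := ((i * LN n K : ℕ) : ℤ) with hy
  set z := zz τ K w with hzz
  have e1 : ∀ x ∈ range (16^n), (∑ ξ ∈ range Q, F ξ * ee n (((ξ:ℤ) + s) * x)) * conj (tphi n τ ⟨K, i, w⟩ x) =
      ∑ ξ ∈ range Q, F ξ * ee n (z * y) * (ker n K rho (y - x) * ee n (((ξ:ℤ) + s - z) * x)) := by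
    intro x _
    unfold tphi
    simp only [Tile.y, ← hzz, ← hy]
    rw [if_pos hz', map_mul, ker_conj, ee_conj, Finset.sum_mul]
    refine Finset.sum_congr rfl fun ξ _ => ?_
    have : ee n (z * y) * ee n (((ξ:ℤ) + s - z) * x) = ee n (((ξ:ℤ) + s) * x) * ee n (-(z * (x - y))) := by
      simp only [← ee_add]; congr 1; ring
    rw [neg_sub]
    linear_combination (-(F ξ * ker n K rho (y - x))) * this
  rw [Finset.sum_congr rfl e1, Finset.sum_comm]
  refine Finset.sum_congr rfl fun ξ hξ => ?_
  have hξ' : (ξ:ℤ) < Q := by exact_mod_cast mem_range.1 hξ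
  rw [← Finset.mul_sum, conv_ee cut_rho]
  · have : ee n (((ξ:ℤ) + s) * y) = ee n (z * y) * ee n (((ξ:ℤ) + s - z) * y) := by
      simp only [← ee_add]; congr 1; ring
    rw [this]; ring
  · have : |(ξ:ℤ) + s - z| ≤ 2 * 16^(n-1) := abs_le.2 ⟨by linarith, by linarith⟩
    linarith

lemma samp_eq {τ : ℕ → ℕ} {K w : ℕ} (hK2 : 2 ≤ K) (hK : K + 1 ≤ n) {Q s N : ℕ} (hQ : Q + s ≤ 16^(n-1))
    (hN : N ≤ Q) (F : ℕ → ℂ) (x : ℕ) :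
    ∑ i ∈ range (16^K), (∑ x' ∈ range (16^n), (∑ ξ ∈ range Q, F ξ * ee n (((ξ:ℤ) + s) * x')) * conj (tphi n τ ⟨K, i, w⟩ x')) * tTh n τ ⟨K, i, w⟩ (N + s) x =
      (hatp τ K w (N + s) : ℂ) * ∑ ξ ∈ range Q, F ξ * (chi ((((ξ:ℤ) - N : ℤ) : ℝ) / ((16^K : ℕ) : ℝ)) : ℂ) * ee n (((ξ:ℤ) + s) * x) := by
  by_cases hh : hatp τ K w (N + s) = 0
  · rw [hh]
    simp [tTh, hh]
  have h1 := abs_lt.1 (hatp_supp hh)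
  have hz : zz τ K w < 2 * 16^(n-1) := by
    have : (16:ℤ)^(K-2) ≤ 16^(n-1) := pow_le_pow_right₀ (by norm_num) (by omega)
    push_cast at h1
    zify at hQ hN ⊢
    linarith
  simp_rw [coef_trig hK hz hQ]
  have hLc : ((LL n K : ℝ) : ℂ) ≠ 0 := by exact_mod_cast (LL_pos n K).ne'
  have e1 : ∀ i ∈ range (16^K), (∑ ξ ∈ range Q, F ξ * (rho ((((ξ:ℤ) + s - zz τ K w : ℤ) : ℝ) / ((16^K : ℕ) : ℝ)) : ℂ) * ee n (((ξ:ℤ) + s) * ((i * LN n K : ℕ) : ℤ))) * tTh n τ ⟨K, i, w⟩ (N + s) x =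
     ∑ ξ ∈ range Q, (F ξ * (rho ((((ξ:ℤ) + s - zz τ K w : ℤ) : ℝ) / ((16^K : ℕ) : ℝ)) : ℂ) * (((LL n K : ℝ) : ℂ) * (hatp τ K w (N + s) : ℂ))) *
      (ee n (((ξ:ℤ) + s) * ((i * LN n K : ℕ) : ℤ)) * (ee n (((N + s : ℕ) : ℤ) * (x - ((i * LN n K : ℕ) : ℤ))) * ker n K chi (x - ((i * LN n K : ℕ) : ℤ)))) := by
    intro i _
    rw [Finset.sum_mul]
    refine Finset.sum_congr rfl fun ξ _ => ?_
    unfold tTh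
    simp only [Tile.y]
    rw [Complex.ofReal_mul]
    ring
  rw [Finset.sum_congr rfl e1, Finset.sum_comm, Finset.mul_sum]
  refine Finset.sum_congr rfl fun ξ _ => ?_
  rw [← Finset.mul_sum]
  have e16 : (16:ℤ)^K = 256 * 16^(K-2) := by exact_mod_cast pow_split hK2
  have p0 : (0:ℤ) < 16^(K-2) := by positivity
  push_cast at h1
  by_cases hr : rho ((((ξ:ℤ) + s - zz τ K w : ℤ) : ℝ) / ((16^K : ℕ) : ℝ)) = 0
  · rw [hr]
    have : chi ((((ξ:ℤ) - N : ℤ) : ℝ) / ((16^K : ℕ) : ℝ)) = 0 := by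
      by_contra hc
      have h3 := chi_int hc
      have p : (0:ℝ) < ((16^K : ℕ) : ℝ) := by positivity
      refine one_ne_zero (α := ℝ) ?_
      rw [← hr, eq_comm]
      apply rho_one
      · rw [le_div_iff₀ p]
        have : (-97:ℤ) * 16^K ≤ 256 * ((ξ:ℤ) + s - zz τ K w) := by linarith [h3.1, h3.2, h1.1, h1.2]
        have : (-97:ℝ) * 16^K ≤ 256 * (((ξ:ℤ) + s - zz τ K w : ℤ) : ℝ) := by exact_mod_cast this
        push_cast at this ⊢; linarith
      · rw [div_le_iff₀ p]
        have : 256 * ((ξ:ℤ) + s - zz τ K w) ≤ (-3:ℤ) * 16^K := by linarith [h3.1, h3.2, h1.1, h1.2]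
        have : 256 * (((ξ:ℤ) + s - zz τ K w : ℤ) : ℝ) ≤ (-3:ℝ) * 16^K := by exact_mod_cast this
        push_cast at this ⊢; linarith
    rw [this]; simp
  · have h3 := rho_int hr
    rw [samp_inner (by omega) (by push_cast; linarith [h3.1, h3.2, h1.1, h1.2]) (by push_cast; linarith [h3.1, h3.2, h1.1, h1.2])]
    have e3 : (ξ:ℤ) + s - ((N + s : ℕ) : ℤ) = ξ - N := by push_cast; ring
    rw [e3]
    by_cases hc : chi ((((ξ:ℤ) - N : ℤ) : ℝ) / ((16^K : ℕ) : ℝ)) = 0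
    · rw [hc]; simp
    · have h4 := chi_int hc
      have p : (0:ℝ) < ((16^K : ℕ) : ℝ) := by positivity
      rw [rho_one]
      · push_cast; field_simp
      · rw [le_div_iff₀ p]
        have : (-97:ℤ) * 16^K ≤ 256 * ((ξ:ℤ) + s - zz τ K w) := by linarith [h4.1, h4.2, h1.1, h1.2]
        have : (-97:ℝ) * 16^K ≤ 256 * (((ξ:ℤ) + s - zz τ K w : ℤ) : ℝ) := by exact_mod_cast this
        push_cast at this ⊢; linarith
      · rw [div_le_iff₀ p]
        have : 256 * ((ξ:ℤ) + s - zz τ K w) ≤ (-3:ℤ) * 16^K := by linarith [h4.1, h4.2, h1.1, h1.2]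
        have : 256 * (((ξ:ℤ) + s - zz τ K w : ℤ) : ℝ) ≤ (-3:ℝ) * 16^K := by exact_mod_cast this
        push_cast at this ⊢; linarith

/-- all tiles with given scales and frequency sets -/
noncomputable def tset (S : Finset ℕ) (Ws : ℕ → Finset ℕ) : Finset Tile :=
  S.biUnion fun K => (Ws K).biUnion fun w => (range (16^K)).image fun i => (⟨K, i, w⟩ : Tile)

lemma mem_tset {S : Finset ℕ} {Ws : ℕ → Finset ℕ} {p : Tile} (h : p ∈ tset S Ws) : p.K ∈ S ∧ p.w ∈ Ws p.K ∧ p.i < 16^p.K := by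
  unfold tset at h
  simp only [mem_biUnion, mem_image, mem_range] at h
  obtain ⟨K, hK, w, hw, i, hi, rfl⟩ := h
  exact ⟨hK, hw, hi⟩

lemma sum_tset (S : Finset ℕ) (Ws : ℕ → Finset ℕ) (G : Tile → ℂ) :
    ∑ p ∈ tset S Ws, G p = ∑ K ∈ S, ∑ w ∈ Ws K, ∑ i ∈ range (16^K), G ⟨K, i, w⟩ := by
  unfold tset
  rw [Finset.sum_biUnion]
  · refine Finset.sum_congr rfl fun K _ => ?_
    rw [Finset.sum_biUnion]
    · refine Finset.sum_congr rfl fun w _ => ?_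
      rw [Finset.sum_image]
      intro a _ b _ h
      simpa using h
    · intro w _ w' _ hne
      rw [Function.onFun, Finset.disjoint_left]
      intro p hp hp'
      simp only [mem_image] at hp hp'
      obtain ⟨i, _, rfl⟩ := hp
      obtain ⟨i', _, h⟩ := hp'
      simp only [Tile.mk.injEq] at h
      exact hne h.2.2.symm
  · intro w _ w' _ hne
    rw [Function.onFun, Finset.disjoint_left]
    intro p hp hp'
    simp only [mem_biUnion, mem_image] at hp hp'
    obtain ⟨_, _, i, _, rfl⟩ := hp
    obtain ⟨_, _, i', _, h⟩ := hp'
    simp only [Tile.mk.injEq] at h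
    exact hne h.1.symm

/-- frequency block of a trigonometric polynomial -/
noncomputable def BK (n s Q : ℕ) (F : ℕ → ℂ) (K N x : ℕ) : ℂ :=
  ∑ ξ ∈ range Q, F ξ * (chi ((((ξ:ℤ) - N : ℤ) : ℝ) / ((16^K : ℕ) : ℝ)) : ℂ) * ee n (((ξ:ℤ) + s) * x)

lemma typed : ∃ C : ℝ, 1 ≤ C ∧ ∀ (n : ℕ) (τ : ℕ → ℕ) (Ws : ℕ → Finset ℕ) (Q s : ℕ) (F : ℕ → ℂ) (g : ℕ → ℂ) (N : ℕ → ℕ),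
    1 ≤ n → Adm n τ → Q + s ≤ 16^(n-1) → ∑ x ∈ range (16^n), ‖∑ ξ ∈ range Q, F ξ * ee n (((ξ:ℤ) + s) * x)‖^2 ≤ 16^n →
    (∀ x < 16^n, ‖g x‖ ≤ 1) → (∀ x < 16^n, N x ≤ Q) →
    ‖∑ x ∈ range (16^n), g x * ∑ K ∈ Icc 2 (n-1), ((∑ w ∈ Ws K, hatp τ K w (N x + s) : ℝ) : ℂ) * BK n s Q F K (N x) x‖ ≤ C * 16^n := by
  obtain ⟨C0, hC0, hM⟩ := exists_model
  refine ⟨3 * (80000000000000000 * C0^4), by have := one_le_pow₀ hC0 (n := 4); linarith, ?_⟩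
  intro n τ Ws Q s F g N hn hτ hQ hf hg hN
  obtain ⟨D, hD1, hD2⟩ := hM n τ hτ
  have key : ∀ r, ‖∑ x ∈ range (16^n), g x * ∑ K ∈ (Icc 2 (n-1)).filter (fun K => K % 3 = r), ((∑ w ∈ Ws K, hatp τ K w (N x + s) : ℝ) : ℂ) * BK n s Q F K (N x) x‖
      ≤ 80000000000000000 * C0^4 * 16^n := by
    intro r
    have h1 := model_bound D (fun x => ∑ ξ ∈ range Q, F ξ * ee n (((ξ:ℤ) + s) * x)) (g := g) (N := fun x => N x + s) (r := r) hf hg ?_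
      (tset ((Icc 2 (n-1)).filter (fun K => K % 3 = r)) Ws) ?_ ?_
    · refine le_trans (le_of_eq ?_) h1
      unfold Lam
      congr 1
      refine Finset.sum_congr rfl fun x hx => ?_
      rw [sum_tset]
      congr 1
      refine Finset.sum_congr rfl fun K hK => ?_
      have hK' := mem_Icc.1 (mem_filter.1 hK).1
      rw [Complex.ofReal_sum, Finset.sum_mul]
      refine Finset.sum_congr rfl fun w _ => ?_
      unfold coef BK
      rw [hD1, hD2]
      exact (samp_eq hK'.1 (by omega) hQ (hN x (mem_range.1 hx)) F x).symm
    · intro x hx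
      have := hN x hx
      have h4' : (16:ℕ)^n = 16 * 16^(n-1) := by rw [← pow_succ']; congr 1; omega
      have : 0 < 16^(n-1) := by positivity
      show N x + s < 16^n
      omega
    · intro p hp
      obtain ⟨h1, _, h2⟩ := mem_tset hp
      have hK' := mem_Icc.1 (mem_filter.1 h1).1
      exact ⟨hK'.1, by omega, h2⟩
    · intro p hp
      exact (mem_filter.1 (mem_tset hp).1).2
  have e : ∑ x ∈ range (16^n), g x * ∑ K ∈ Icc 2 (n-1), ((∑ w ∈ Ws K, hatp τ K w (N x + s) : ℝ) : ℂ) * BK n s Q F K (N x) x =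
     ∑ r ∈ range 3, ∑ x ∈ range (16^n), g x * ∑ K ∈ (Icc 2 (n-1)).filter (fun K => K % 3 = r), ((∑ w ∈ Ws K, hatp τ K w (N x + s) : ℝ) : ℂ) * BK n s Q F K (N x) x := by
    rw [Finset.sum_comm]
    refine Finset.sum_congr rfl fun x _ => ?_
    rw [← Finset.mul_sum]
    congr 1
    rw [Finset.sum_fiberwise_of_maps_to]
    intro K _; rw [mem_range]; omega
  rw [e]
  refine (norm_sum_le _ _).trans ((Finset.sum_le_sum fun r _ => key r).trans (le_of_eq ?_))
  simp; ring
end Carl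

namespace Carl
open Finset
open scoped Classical ComplexConjugate
variable {n : ℕ} {C0 : ℝ}

/-- shift of the second grid -/
def TT : ℕ → ℕ
  | 0 => 0
  | K+1 => 16 * TT K + 8

lemma TT_eq (K : ℕ) : 15 * TT K + 8 = 8 * 16^K := by
  induction K with
  | zero => rfl
  | succ K ih => rw [pow_succ]; simp only [TT]; omega

lemma TT_add (K j : ℕ) : TT (K + j) = TT K + 16^K * TT j := by
  have h1 := TT_eq K
  have h2 := TT_eq j
  have h3 := TT_eq (K + j)
  rw [pow_add] at h3
  have : 16^K * (15 * TT j + 8) = 16^K * (8 * 16^j) := by rw [h2]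
  nlinarith

/-- shift data of a type -/
def tau (t K : ℕ) : ℕ := if 103 ≤ t then t * 16^(K-2) else t * 16^(K-2) + TT K

lemma tau_adm {t : ℕ} (ht : t < 256) (n : ℕ) : Adm n (tau t) := by
  intro K hK _
  have e := pow_split hK
  have e2 := TT_eq K
  have p : 0 < 16^(K-2) := by positivity
  unfold tau
  by_cases h : 103 ≤ t
  · rw [if_pos h]
    have h1 : 103 * 16^(K-2) ≤ t * 16^(K-2) := by gcongr
    have h2 : t * 16^(K-2) ≤ 255 * 16^(K-2) := by gcongr; omega
    omega
  · rw [if_neg h]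
    have h2 : t * 16^(K-2) ≤ 102 * 16^(K-2) := by gcongr; omega
    omega

/-- frequency shift of a type -/
def shf (n t : ℕ) : ℕ := if 103 ≤ t then 0 else TT (n-1)

/-- frequency sets of a type -/
def wset (n t R K : ℕ) : Finset ℕ := if 103 ≤ t then range R else (range R).image (fun m => m + TT (n-1-K))

lemma hatp_type {t R K N : ℕ} (hK : 2 ≤ K) (hn : K + 1 ≤ n) :
    ∑ w ∈ wset n t R K, hatp (tau t) K w (N + shf n t) = ∑ m ∈ range R, hat ((N:ℝ) / 16^(K-2) - ((256 * m + t : ℕ) : ℝ)) := by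
  have p0 : (0:ℝ) < 16^(K-2) := by positivity
  have e : (16:ℝ)^K = 256 * 16^(K-2) := by exact_mod_cast pow_split hK
  unfold wset shf
  by_cases h : 103 ≤ t
  · rw [if_pos h, if_pos h]
    refine Finset.sum_congr rfl fun m _ => ?_
    unfold hatp zz tau
    rw [if_pos h]
    congr 1
    push_cast
    rw [e]; field_simp; ring
  · rw [if_neg h, if_neg h, Finset.sum_image (by intro a _ b _ hab; simpa using hab)]
    refine Finset.sum_congr rfl fun m _ => ?_
    unfold hatp zz tau
    rw [if_neg h]
    congr 1
    have e3 : TT (n-1) = TT K + 16^K * TT (n-1-K) := by rw [← TT_add]; congr 1; omega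
    rw [e3]
    push_cast
    rw [e]; field_simp; ring

lemma hat_sum_one {u : ℝ} (hu : 0 ≤ u) {J : ℕ} (hJ : u + 2 ≤ J) : ∑ j ∈ range J, hat (u - (j:ℝ)) = 1 := by
  set k := ⌊u⌋₊ with hk
  have h1 : (k:ℝ) ≤ u := Nat.floor_le hu
  have h2 : u < k + 1 := Nat.lt_floor_add_one u
  have hkJ : k + 1 < J := by
    have : (k:ℝ) + 1 < J := by linarith
    exact_mod_cast this
  have e : ∑ j ∈ ({k, k+1} : Finset ℕ), hat (u - (j:ℝ)) = ∑ j ∈ range J, hat (u - (j:ℝ)) := by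
    refine Finset.sum_subset ?_ ?_
    · intro j hj
      simp only [mem_insert, mem_singleton] at hj
      rw [mem_range]; omega
    · intro j _ hj
      simp only [mem_insert, mem_singleton, not_or] at hj
      by_contra hne
      have := abs_lt.1 (hat_supp hne)
      have a1 : (j:ℝ) < k + 2 := by linarith
      have a2 : (k:ℝ) < j + 1 := by linarith
      have a1 : j < k + 2 := by exact_mod_cast a1
      have a2 : k < j + 1 := by exact_mod_cast a2
      omega
  rw [← e, Finset.sum_pair (by omega)]
  unfold hat
  push_cast
  rw [abs_of_nonneg (by linarith), abs_of_nonpos (by linarith), max_eq_right (by linarith), max_eq_right (by linarith)]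
  ring

lemma range_block (G : ℕ → ℝ) (R : ℕ) : ∑ m ∈ range R, ∑ t ∈ range 256, G (256 * m + t) = ∑ j ∈ range (256 * R), G j := by
  induction R with
  | zero => simp
  | succ R ih =>
    rw [Finset.sum_range_succ, ih, mul_add, mul_one, Finset.sum_range_add]

lemma types_one {K N R : ℕ} (hR : N + 2 ≤ 256 * R) :
    ∑ t ∈ range 256, ∑ m ∈ range R, hat ((N:ℝ) / 16^(K-2) - ((256 * m + t : ℕ) : ℝ)) = 1 := by
  rw [Finset.sum_comm, range_block (fun j => hat ((N:ℝ) / 16^(K-2) - (j : ℝ)))]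
  refine hat_sum_one (by positivity) ?_
  have : (N:ℝ) / 16^(K-2) ≤ N := div_le_self (by positivity) (one_le_pow₀ (by norm_num))
  have h2 : ((N + 2 : ℕ) : ℝ) ≤ ((256 * R : ℕ) : ℝ) := by exact_mod_cast hR
  push_cast at h2 ⊢; linarith

lemma chi_tele (v : ℝ) {m : ℕ} (hm : 1 ≤ m) :
    ∑ K ∈ Icc 2 m, chi (v / ((16^K : ℕ) : ℝ)) = tht (v / 16) - tht (v / ((16^m : ℕ) : ℝ)) := by
  induction m, hm using Nat.le_induction with
  | base => simp
  | succ m hm ih =>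
    rw [Finset.sum_Icc_succ_top (by omega), ih]
    unfold chi
    have : 16 * (v / ((16^(m+1) : ℕ) : ℝ)) = v / ((16^m : ℕ) : ℝ) := by
      push_cast; rw [pow_succ]; field_simp
    rw [this]; ring

lemma BK_shift (n s Q : ℕ) (F : ℕ → ℂ) (K N x : ℕ) : BK n s Q F K N x = ee n ((s:ℤ) * x) * BK n 0 Q F K N x := by
  unfold BK
  rw [Finset.mul_sum]
  refine Finset.sum_congr rfl fun ξ _ => ?_
  have : ee n (((ξ:ℤ) + s) * x) = ee n ((s:ℤ) * x) * ee n (((ξ:ℤ) + (0:ℕ)) * x) := by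
    rw [← ee_add]; congr 1; push_cast; ring
  rw [this]; ring

lemma disc_blocks : ∃ C : ℝ, 1 ≤ C ∧ ∀ (n Q : ℕ) (F : ℕ → ℂ) (g : ℕ → ℂ) (N : ℕ → ℕ),
    2 ≤ n → 4 * Q ≤ 16^(n-1) → ∑ x ∈ range (16^n), ‖∑ ξ ∈ range Q, F ξ * ee n ((ξ:ℤ) * x)‖^2 ≤ 16^n →
    (∀ x < 16^n, ‖g x‖ ≤ 1) → (∀ x < 16^n, N x ≤ Q) →
    ‖∑ x ∈ range (16^n), g x * ∑ K ∈ Icc 2 (n-1), BK n 0 Q F K (N x) x‖ ≤ C * 16^n := by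
  obtain ⟨C, hC, hT⟩ := typed
  refine ⟨256 * C, by linarith, ?_⟩
  intro n Q F g N hn hQ hf hg hN
  have key : ∀ t ∈ range 256, ‖∑ x ∈ range (16^n), g x * ∑ K ∈ Icc 2 (n-1), ((∑ m ∈ range (Q + 2), hat ((N x:ℝ) / 16^(K-2) - ((256 * m + t : ℕ) : ℝ)) : ℝ) : ℂ) * BK n 0 Q F K (N x) x‖ ≤ C * 16^n := by
    intro t ht
    set s := shf n t with hs
    have h1 := hT n (tau t) (wset n t (Q + 2)) Q s F (fun x => g x * ee n (-((s:ℤ) * x))) N (by omega) (tau_adm (mem_range.1 ht) n) ?_ ?_ ?_ hN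
    · refine le_trans (le_of_eq ?_) h1
      congr 1
      refine Finset.sum_congr rfl fun x _ => ?_
      rw [mul_assoc (g x)]
      congr 1
      rw [Finset.mul_sum]
      refine Finset.sum_congr rfl fun K hK => ?_
      have hK' := mem_Icc.1 hK
      rw [hatp_type hK'.1 (by omega), BK_shift n s]
      have : ee n (-((s:ℤ) * x)) * ee n ((s:ℤ) * x) = 1 := by rw [← ee_add, neg_add_cancel, ee_zero]
      linear_combination (-(((∑ m ∈ range (Q + 2), hat ((N x:ℝ) / 16^(K-2) - ((256 * m + t : ℕ) : ℝ)) : ℝ) : ℂ) * BK n 0 Q F K (N x) x)) * this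
    · have := TT_eq (n-1)
      rw [hs]; unfold shf
      split_ifs <;> omega
    · refine le_trans (le_of_eq ?_) hf
      refine Finset.sum_congr rfl fun x _ => ?_
      have : ∑ ξ ∈ range Q, F ξ * ee n (((ξ:ℤ) + s) * x) = ee n ((s:ℤ) * x) * ∑ ξ ∈ range Q, F ξ * ee n ((ξ:ℤ) * x) := by
        rw [Finset.mul_sum]
        refine Finset.sum_congr rfl fun ξ _ => ?_
        rw [add_mul, ee_add]; ring
      rw [this, norm_mul, norm_ee, one_mul]
    · intro x hx
      rw [norm_mul, norm_ee, mul_one]; exact hg x hx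
  have e : ∑ x ∈ range (16^n), g x * ∑ K ∈ Icc 2 (n-1), BK n 0 Q F K (N x) x =
      ∑ t ∈ range 256, ∑ x ∈ range (16^n), g x * ∑ K ∈ Icc 2 (n-1), ((∑ m ∈ range (Q + 2), hat ((N x:ℝ) / 16^(K-2) - ((256 * m + t : ℕ) : ℝ)) : ℝ) : ℂ) * BK n 0 Q F K (N x) x := by
    rw [Finset.sum_comm]
    refine Finset.sum_congr rfl fun x hx => ?_
    rw [← Finset.mul_sum]
    congr 1
    rw [Finset.sum_comm]
    refine Finset.sum_congr rfl fun K _ => ?_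
    rw [← Finset.sum_mul, ← Complex.ofReal_sum, types_one (by have := hN x (mem_range.1 hx); omega)]
    simp
  rw [e]
  refine (norm_sum_le _ _).trans ((Finset.sum_le_sum key).trans (le_of_eq ?_))
  simp; ring

lemma disc_lin : ∃ C : ℝ, 1 ≤ C ∧ ∀ (n Q : ℕ) (F : ℕ → ℂ) (g : ℕ → ℂ) (N : ℕ → ℕ),
    2 ≤ n → 4 * Q ≤ 16^(n-1) → ∑ x ∈ range (16^n), ‖∑ ξ ∈ range Q, F ξ * ee n ((ξ:ℤ) * x)‖^2 ≤ 16^n →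
    (∀ ξ < Q, ‖F ξ‖ ≤ 1) → (∀ x < 16^n, ‖g x‖ ≤ 1) → (∀ x < 16^n, N x ≤ Q) →
    ‖∑ x ∈ range (16^n), g x * ∑ ξ ∈ range (N x), F ξ * ee n ((ξ:ℤ) * x)‖ ≤ C * 16^n := by
  obtain ⟨C, hC, hT⟩ := disc_blocks
  refine ⟨C + 5, by linarith, ?_⟩
  intro n Q F g N hn hQ hf hF hg hN
  have h1 := hT n Q F g N hn hQ hf hg hN
  have key : ∀ x ∈ range (16^n), ‖g x * ∑ ξ ∈ range (N x), F ξ * ee n ((ξ:ℤ) * x) - g x * ∑ K ∈ Icc 2 (n-1), BK n 0 Q F K (N x) x‖ ≤ 5 := by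
    intro x hx
    have hNx := hN x (mem_range.1 hx)
    have e1 : ∑ K ∈ Icc 2 (n-1), BK n 0 Q F K (N x) x = ∑ ξ ∈ range Q, F ξ * ((tht ((((ξ:ℤ) - N x : ℤ) : ℝ) / 16) : ℝ) : ℂ) * ee n ((ξ:ℤ) * x) := by
      unfold BK
      rw [Finset.sum_comm]
      refine Finset.sum_congr rfl fun ξ hξ => ?_
      rw [← Finset.sum_mul, ← Finset.mul_sum, ← Complex.ofReal_sum, chi_tele _ (by omega : 1 ≤ n - 1)]
      rw [tht_zero (u := (((ξ:ℤ) - N x : ℤ) : ℝ) / ((16^(n-1) : ℕ) : ℝ)), sub_zero]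
      · simp
      · have p : (0:ℝ) < ((16^(n-1) : ℕ) : ℝ) := by positivity
        rw [le_div_iff₀ p]
        have : (-1:ℤ) * (16^(n-1) : ℕ) ≤ 4 * ((ξ:ℤ) - N x) := by push_cast; zify at hQ hNx; linarith [Int.natCast_nonneg ξ]
        have : (-1:ℝ) * (16^(n-1) : ℕ) ≤ 4 * (((ξ:ℤ) - N x : ℤ) : ℝ) := by exact_mod_cast this
        linarith
    have e2 : ∑ ξ ∈ range (N x), F ξ * ee n ((ξ:ℤ) * x) = ∑ ξ ∈ range Q, if ξ < N x then F ξ * ee n ((ξ:ℤ) * x) else 0 := by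
      rw [← Finset.sum_filter]
      refine Finset.sum_congr ?_ fun _ _ => rfl
      ext ξ; simp only [mem_range, mem_filter]; omega
    rw [← mul_sub, e1, e2, ← Finset.sum_sub_distrib, norm_mul]
    refine (mul_le_of_le_one_left (norm_nonneg _) (hg x (mem_range.1 hx))).trans ?_
    refine (norm_sum_le _ _).trans ?_
    calc _ ≤ ∑ ξ ∈ range Q, if N x ≤ ξ + 5 ∧ ξ < N x then (1:ℝ) else 0 := by
          refine Finset.sum_le_sum fun ξ hξ => ?_
          by_cases hlt : ξ < N x
          · rw [if_pos hlt]
            by_cases h5 : N x ≤ ξ + 5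
            · rw [if_pos ⟨h5, hlt⟩]
              have : F ξ * ee n ((ξ:ℤ) * x) - F ξ * ((tht ((((ξ:ℤ) - N x : ℤ) : ℝ) / 16) : ℝ) : ℂ) * ee n ((ξ:ℤ) * x) =
                F ξ * ((1 - tht ((((ξ:ℤ) - N x : ℤ) : ℝ) / 16) : ℝ) : ℂ) * ee n ((ξ:ℤ) * x) := by push_cast; ring
              rw [this, norm_mul, norm_mul, norm_ee, mul_one, Complex.norm_real, Real.norm_of_nonneg (by linarith [tht_le_one ((((ξ:ℤ) - N x : ℤ) : ℝ) / 16)])]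
              have a1 := hF ξ (mem_range.1 hξ)
              have a2 := tht_nonneg ((((ξ:ℤ) - N x : ℤ) : ℝ) / 16)
              have a3 := tht_le_one ((((ξ:ℤ) - N x : ℤ) : ℝ) / 16)
              exact mul_le_one₀ a1 (by linarith) (by linarith)
            · rw [if_neg (fun h => h5 h.1), tht_one]
              · simp
              · have : (ξ:ℤ) - N x ≤ -6 := by omega
                have : (((ξ:ℤ) - N x : ℤ) : ℝ) ≤ -6 := by exact_mod_cast this
                linarith
          · rw [if_neg hlt, if_neg (fun h => hlt h.2), tht_zero]
            · simp
            · have : 0 ≤ (ξ:ℤ) - N x := by omega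
              have : (0:ℝ) ≤ (((ξ:ℤ) - N x : ℤ) : ℝ) := by exact_mod_cast this
              linarith
      _ = (((range Q).filter (fun ξ => N x ≤ ξ + 5 ∧ ξ < N x)).card : ℝ) := by
          rw [← Finset.sum_filter]; simp
      _ ≤ 5 := by
          have : ((range Q).filter (fun ξ => N x ≤ ξ + 5 ∧ ξ < N x)).card ≤ (Ico (N x - 5) (N x)).card := by
            refine Finset.card_le_card ?_
            intro ξ; simp only [mem_range, mem_filter, mem_Ico]; omega
          rw [Nat.card_Ico] at this
          have : ((range Q).filter (fun ξ => N x ≤ ξ + 5 ∧ ξ < N x)).card ≤ 5 := by omega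
          exact_mod_cast this
  have h2 : ‖∑ x ∈ range (16^n), g x * ∑ ξ ∈ range (N x), F ξ * ee n ((ξ:ℤ) * x) - ∑ x ∈ range (16^n), g x * ∑ K ∈ Icc 2 (n-1), BK n 0 Q F K (N x) x‖ ≤ 5 * 16^n := by
    rw [← Finset.sum_sub_distrib]
    refine (norm_sum_le _ _).trans ((Finset.sum_le_sum key).trans (le_of_eq ?_))
    simp; ring
  have h3 := norm_le_norm_add_norm_sub' (∑ x ∈ range (16^n), g x * ∑ ξ ∈ range (N x), F ξ * ee n ((ξ:ℤ) * x)) (∑ x ∈ range (16^n), g x * ∑ K ∈ Icc 2 (n-1), BK n 0 Q F K (N x) x)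
  linarith
end Carl

namespace Carl
open Finset
open scoped Classical ComplexConjugate
variable {n : ℕ} {C0 : ℝ}

lemma coef_recover {Q : ℕ} (hQ : Q ≤ 16^n) (F : ℕ → ℂ) {η : ℕ} (hη : η < Q) :
    ∑ x ∈ range (16^n), (∑ ξ ∈ range Q, F ξ * ee n ((ξ:ℤ) * x)) * ee n (-((η:ℤ) * x)) = 16^n * F η := by
  have e1 : ∀ x ∈ range (16^n), (∑ ξ ∈ range Q, F ξ * ee n ((ξ:ℤ) * x)) * ee n (-((η:ℤ) * x)) =
      ∑ ξ ∈ range Q, F ξ * ee n (((ξ:ℤ) - η) * x) := by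
    intro x _
    rw [Finset.sum_mul]
    refine Finset.sum_congr rfl fun ξ _ => ?_
    rw [mul_assoc, ← ee_add]; congr 2; ring
  rw [Finset.sum_congr rfl e1, Finset.sum_comm]
  simp_rw [← Finset.mul_sum, ee_sum]
  rw [Finset.sum_eq_single η]
  · simp [mul_comm]
  · intro ξ hξ hne
    rw [if_neg, mul_zero]
    intro hd
    have h1 := mem_range.1 hξ
    have hQ' : (Q:ℤ) ≤ 16^n := by exact_mod_cast hQ
    have := dvd_eq_zero_of_abs hd (abs_lt.2 ⟨by omega, by omega⟩)
    omega
  · intro h; exact absurd (mem_range.2 hη) h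

lemma disc_weak : ∃ C : ℝ, 1 ≤ C ∧ ∀ (n Q : ℕ) (F : ℕ → ℂ) (l : ℝ),
    2 ≤ n → 4 * Q ≤ 16^(n-1) → (∀ x : ℕ, x < 16^n → ‖∑ ξ ∈ range Q, F ξ * ee n ((ξ:ℤ) * x)‖ ≤ 1) → 0 < l →
    l * (((range (16^n)).filter (fun x : ℕ => ∃ N ≤ Q, l < ‖∑ ξ ∈ range N, F ξ * ee n ((ξ:ℤ) * x)‖)).card : ℝ) ≤ C * 16^n := by
  obtain ⟨C, hC, hT⟩ := disc_lin
  refine ⟨C, hC, ?_⟩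
  intro n Q F l hn hQ hf hl
  have h4' : (16:ℕ)^n = 16 * 16^(n-1) := by rw [← pow_succ']; congr 1; omega
  have hM : (0:ℝ) < 16^n := by positivity
  have hF : ∀ ξ < Q, ‖F ξ‖ ≤ 1 := by
    intro η hη
    have h1 := coef_recover (n := n) (Q := Q) (by omega) F hη
    have h2 : ‖(16:ℂ)^n * F η‖ ≤ 16^n := by
      rw [← h1]
      refine (norm_sum_le _ _).trans ((Finset.sum_le_sum (g := fun _ => (1:ℝ)) fun x hx => ?_).trans (by simp))
      rw [norm_mul, norm_ee, mul_one]; exact hf x (mem_range.1 hx)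
    rw [norm_mul, norm_pow, show ‖(16:ℂ)‖ = 16 by simp] at h2
    exact le_of_mul_le_mul_left (by linarith) hM
  set bad : ℕ → Prop := fun x => ∃ N ≤ Q, l < ‖∑ ξ ∈ range N, F ξ * ee n ((ξ:ℤ) * x)‖ with hbad
  set N : ℕ → ℕ := fun x => if h : bad x then h.choose else 0 with hN
  set S : ℕ → ℂ := fun x => ∑ ξ ∈ range (N x), F ξ * ee n ((ξ:ℤ) * x) with hS
  have hN1 : ∀ x, N x ≤ Q := by
    intro x
    by_cases h : bad x
    · simp only [hN, dif_pos h]; exact h.choose_spec.1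
    · simp only [hN, dif_neg h]; omega
  have hN2 : ∀ x, bad x → l < ‖S x‖ := by
    intro x h
    have := h.choose_spec.2
    simp only [hS, hN, dif_pos h]; exact this
  set g : ℕ → ℂ := fun x => if bad x then conj (S x) / ‖S x‖ else 0 with hg
  have hg1 : ∀ x < 16^n, ‖g x‖ ≤ 1 := by
    intro x _
    by_cases h : bad x
    · simp only [hg, if_pos h]
      rw [norm_div, RCLike.norm_conj, Complex.norm_real, norm_norm]
      exact div_self_le_one _
    · simp only [hg, if_neg h]; simp
  have h2 : ∑ x ∈ range (16^n), ‖∑ ξ ∈ range Q, F ξ * ee n ((ξ:ℤ) * x)‖^2 ≤ 16^n := by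
    refine (Finset.sum_le_sum (g := fun _ => (1:ℝ)) fun x hx => ?_).trans (by simp)
    exact pow_le_one₀ (norm_nonneg _) (hf x (mem_range.1 hx))
  have h3 := hT n Q F g N hn hQ h2 hF hg1 (fun x _ => hN1 x)
  have h4 : ∀ x ∈ range (16^n), g x * ∑ ξ ∈ range (N x), F ξ * ee n ((ξ:ℤ) * x) = (((if bad x then ‖S x‖ else 0 : ℝ)) : ℂ) := by
    intro x _
    change g x * S x = _
    by_cases h : bad x
    · simp only [hg, if_pos h]
      have hpos : (‖S x‖ : ℂ) ≠ 0 := by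
        have := hN2 x h
        exact_mod_cast (by linarith : 0 < ‖S x‖).ne'
      rw [div_mul_eq_mul_div, mul_comm, Complex.mul_conj', div_eq_iff hpos]; ring
    · simp only [hg, if_neg h]; simp
  rw [Finset.sum_congr rfl h4, ← Complex.ofReal_sum, Complex.norm_real] at h3
  refine le_trans ?_ ((le_abs_self _).trans h3)
  rw [← Finset.sum_filter, mul_comm, ← nsmul_eq_mul]
  refine Finset.card_nsmul_le_sum _ _ _ ?_
  intro x hx
  exact (hN2 x (mem_filter.1 hx).2).le

/-- exponentials -/
noncomputable def Ex (k : ℤ) (x : ℝ) : ℂ := Complex.exp (Complex.I * (k:ℂ) * (x:ℂ))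

lemma norm_Ex (k : ℤ) (x : ℝ) : ‖Ex k x‖ = 1 := by
  unfold Ex
  have : Complex.I * (k:ℂ) * (x:ℂ) = ((k * x : ℝ) : ℂ) * Complex.I := by push_cast; ring
  rw [this]; exact Complex.norm_exp_ofReal_mul_I _

lemma continuous_Ex (k : ℤ) : Continuous (Ex k) := by unfold Ex; fun_prop

lemma Ex_grid (n : ℕ) (k : ℤ) (x : ℝ) (j : ℤ) : Ex k (x + 2 * Real.pi * j / 16^n) = Ex k x * ee n (k * j) := by
  unfold Ex ee
  rw [← Complex.exp_add]; congr 1; push_cast; ring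

lemma Ex_periodic (k : ℤ) : Function.Periodic (Ex k) (2 * Real.pi) := by
  intro x
  unfold Ex
  rw [Complex.exp_eq_exp_iff_exists_int]
  exact ⟨k, by push_cast; ring⟩

/-- symmetric trigonometric sum -/
noncomputable def TP (c : ℤ → ℂ) (N : ℕ) (x : ℝ) : ℂ := ∑ k ∈ Icc (-(N:ℤ)) N, c k * Ex k x

lemma TP_continuous (c : ℤ → ℂ) (N : ℕ) : Continuous (TP c N) := by
  unfold TP
  exact continuous_finsetSum _ fun k _ => continuous_const.mul (continuous_Ex k)

lemma TP_periodic (c : ℤ → ℂ) (N : ℕ) : Function.Periodic (TP c N) (2 * Real.pi) := by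
  intro x; unfold TP
  exact Finset.sum_congr rfl fun k _ => by rw [Ex_periodic k x]

lemma TP_grid (n : ℕ) (c : ℤ → ℂ) {N D : ℕ} (hN : N ≤ D) (x : ℝ) (j : ℕ) :
    ee n ((D:ℤ) * j) * TP c N (x + 2 * Real.pi * j / 16^n) =
      ∑ ξ ∈ range (D + N + 1), (c ((ξ:ℤ) - D) * Ex ((ξ:ℤ) - D) x) * ee n ((ξ:ℤ) * j) -
      ∑ ξ ∈ range (D - N), (c ((ξ:ℤ) - D) * Ex ((ξ:ℤ) - D) x) * ee n ((ξ:ℤ) * j) := by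
  rw [← Finset.sum_Ico_eq_sub _ (by omega)]
  unfold TP
  rw [Finset.mul_sum]
  symm
  refine Finset.sum_bij' (fun ξ _ => (ξ:ℤ) - D) (fun k _ => (k + D).toNat) ?_ ?_ ?_ ?_ ?_
  · intro ξ hξ; rw [mem_Ico] at hξ; rw [mem_Icc]; omega
  · intro k hk; rw [mem_Icc] at hk; rw [mem_Ico]; omega
  · intro ξ hξ; omega
  · intro k hk; rw [mem_Icc] at hk; omega
  · intro ξ _
    have := Ex_grid n ((ξ:ℤ) - D) x j
    rw [Int.cast_natCast] at this
    rw [this]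
    have : ee n ((ξ:ℤ) * j) = ee n ((D:ℤ) * j) * ee n (((ξ:ℤ) - D) * j) := by
      rw [← ee_add]; congr 1; ring
    rw [this]; ring

lemma grid_weak : ∃ C : ℝ, 1 ≤ C ∧ ∀ (c : ℤ → ℂ) (D : ℕ), (∀ x, ‖TP c D x‖ ≤ 1) → ∃ n : ℕ, ∀ (x : ℝ) (l : ℝ), 0 < l →
    l * (((range (16^n)).filter (fun j : ℕ => ∃ N ≤ D, 2 * l < ‖TP c N (x + 2 * Real.pi * j / 16^n)‖)).card : ℝ) ≤ C * 16^n := by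
  obtain ⟨C, hC, hT⟩ := disc_weak
  refine ⟨C, hC, ?_⟩
  intro c D hp
  refine ⟨4 * (2 * D + 1) + 1, ?_⟩
  set n := 4 * (2 * D + 1) + 1 with hn
  intro x l hl
  have hQ : 4 * (2 * D + 1) ≤ 16^(n-1) := by
    have : n - 1 = 4 * (2 * D + 1) := by omega
    rw [this]; exact (Nat.lt_pow_self (by norm_num)).le
  have h1 := hT n (2 * D + 1) (fun ξ => c ((ξ:ℤ) - D) * Ex ((ξ:ℤ) - D) x) l (by omega) hQ ?_ hl
  · refine le_trans ?_ h1
    refine mul_le_mul_of_nonneg_left ?_ hl.le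
    refine Nat.cast_le.2 (Finset.card_le_card ?_)
    intro j hj
    rw [mem_filter] at hj ⊢
    refine ⟨hj.1, ?_⟩
    obtain ⟨N, hN, hlt⟩ := hj.2
    have e := TP_grid n c hN x j
    have e2 := congrArg norm e
    rw [norm_mul, norm_ee, one_mul] at e2
    by_contra hc
    push Not at hc
    have a1 := hc (D + N + 1) (by omega)
    have a2 := hc (D - N) (by omega)
    have a3 := norm_sub_le (∑ ξ ∈ range (D + N + 1), (c ((ξ:ℤ) - D) * Ex ((ξ:ℤ) - D) x) * ee n ((ξ:ℤ) * j)) (∑ ξ ∈ range (D - N), (c ((ξ:ℤ) - D) * Ex ((ξ:ℤ) - D) x) * ee n ((ξ:ℤ) * j))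
    linarith
  · intro j _
    have e := TP_grid n c (le_refl D) x j
    have e2 := congrArg norm e
    rw [norm_mul, norm_ee, one_mul, Nat.sub_self] at e2
    simp only [range_zero, sum_empty, sub_zero] at e2
    rw [show 2 * D + 1 = D + D + 1 by ring, ← e2]
    exact hp _
end Carl

namespace Carl
open Finset
open scoped Classical ComplexConjugate
variable {n : ℕ} {C0 : ℝ}

lemma per_measure {E : Set ℝ} (hE : MeasurableSet E) (hper : ∀ x, x + 2 * Real.pi ∈ E ↔ x ∈ E) {M : ℕ} (hM : 0 < M) {K : ℝ}
    (hK : ∀ x : ℝ, (((range M).filter (fun j : ℕ => x + 2 * Real.pi * j / M ∈ E)).card : ℝ) ≤ K) (a : ℝ) :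
    volume (Set.Ioc a (a + 2 * Real.pi) ∩ E) ≤ ENNReal.ofReal (2 * Real.pi * K / M) := by
  have hpi := Real.pi_pos
  set G : ℝ → ℝ := E.indicator (fun _ => (1:ℝ)) with hG
  have hGm : Measurable G := measurable_const.indicator hE
  have hGb : ∀ x, ‖G x‖ ≤ 1 := by
    intro x; by_cases h : x ∈ E <;> simp [hG, h]
  have hGp : Function.Periodic G (2 * Real.pi) := by
    intro x
    by_cases h : x ∈ E
    · simp [hG, h, (hper x).2 h]
    · have : x + 2 * Real.pi ∉ E := fun h' => h ((hper x).1 h')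
      simp [hG, h, this]
  have hGi : ∀ t : ℝ, IntervalIntegrable (fun x => G (x + t)) volume a (a + 2 * Real.pi) := by
    intro t
    rw [intervalIntegrable_iff]
    refine Measure.integrableOn_of_bounded (M := 1) (by rw [Set.uIoc, Real.volume_Ioc]; exact ENNReal.ofReal_ne_top) ?_ ?_
    · exact (hGm.comp (measurable_id.add_const t)).aestronglyMeasurable
    · exact Filter.Eventually.of_forall fun x => hGb _
  have h1 : ∀ t : ℝ, ∫ x in a..(a + 2 * Real.pi), G (x + t) = ∫ x in a..(a + 2 * Real.pi), G x := by
    intro t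
    rw [intervalIntegral.integral_comp_add_right (f := G)]
    rw [show a + 2 * Real.pi + t = (a + t) + 2 * Real.pi by ring]
    exact hGp.intervalIntegral_add_eq _ _
  have h2 : (M:ℝ) * ∫ x in a..(a + 2 * Real.pi), G x = ∫ x in a..(a + 2 * Real.pi), ∑ j ∈ range M, G (x + 2 * Real.pi * j / M) := by
    rw [intervalIntegral.integral_finsetSum (fun j _ => hGi _)]
    simp_rw [h1]; simp
  have h3 : ∫ x in a..(a + 2 * Real.pi), ∑ j ∈ range M, G (x + 2 * Real.pi * j / M) ≤ ∫ x in a..(a + 2 * Real.pi), K := by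
    refine intervalIntegral.integral_mono_on (by linarith) ?_ (by simp) ?_
    · have := IntervalIntegrable.sum (range M) (f := fun j : ℕ => fun x => G (x + 2 * Real.pi * j / M)) (fun j _ => hGi _)
      simpa [Finset.sum_fn] using this
    · intro x _
      refine le_trans (le_of_eq ?_) (hK x)
      rw [Finset.card_filter]; push_cast
      refine Finset.sum_congr rfl fun j _ => ?_
      simp only [hG, Set.indicator_apply]
  have h4 : ∫ x in a..(a + 2 * Real.pi), G x = (volume (Set.Ioc a (a + 2 * Real.pi) ∩ E)).toReal := by
    rw [intervalIntegral.integral_of_le (by linarith), hG, MeasureTheory.setIntegral_indicator hE]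
    simp [Measure.real]
  rw [intervalIntegral.integral_const, smul_eq_mul] at h3
  have hfin : volume (Set.Ioc a (a + 2 * Real.pi) ∩ E) ≠ ⊤ :=
    ne_top_of_le_ne_top (by rw [Real.volume_Ioc]; exact ENNReal.ofReal_ne_top) (measure_mono (Set.inter_subset_left))
  rw [← ENNReal.ofReal_toReal hfin]
  refine ENNReal.ofReal_le_ofReal ?_
  rw [le_div_iff₀ (by exact_mod_cast hM), ← h4, mul_comm, h2]
  linarith

lemma TP_smul (c : ℤ → ℂ) (z : ℂ) (N : ℕ) (x : ℝ) : TP (fun k => z * c k) N x = z * TP c N x := by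
  unfold TP; rw [Finset.mul_sum]; exact Finset.sum_congr rfl fun k _ => by ring

lemma TP_weak : ∃ C : ℝ, 1 ≤ C ∧ ∀ (c : ℤ → ℂ) (D : ℕ) (δ ε a : ℝ), 0 < δ → 0 < ε → (∀ x, ‖TP c D x‖ ≤ δ) →
    volume (Set.Ioc a (a + 2 * Real.pi) ∩ {x | ∃ N ≤ D, ε < ‖TP c N x‖}) ≤ ENNReal.ofReal (C * δ / ε) := by
  obtain ⟨C, hC, hT⟩ := grid_weak
  have hpi := Real.pi_gt_three
  refine ⟨4 * Real.pi * C, by nlinarith, ?_⟩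
  intro c D δ ε a hδ hε hc
  have hnδ : ∀ y : ℂ, ‖((δ⁻¹ : ℝ) : ℂ) * y‖ = δ⁻¹ * ‖y‖ := by
    intro y
    rw [norm_mul, Complex.norm_real, Real.norm_of_nonneg (by positivity)]
  obtain ⟨n, hn⟩ := hT (fun k => ((δ⁻¹ : ℝ) : ℂ) * c k) D (by
    intro x
    rw [TP_smul, hnδ, inv_mul_le_iff₀ hδ, mul_one]; exact hc x)
  have hset : {x | ∃ N ≤ D, ε < ‖TP c N x‖} = ⋃ N ∈ Set.Iic D, {x | ε < ‖TP c N x‖} := by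
    ext x; simp
  have hl : 0 < ε / (2 * δ) := by positivity
  obtain ⟨E, hE⟩ : ∃ E : Set ℝ, E = {x | ∃ N ≤ D, ε < ‖TP c N x‖} := ⟨_, rfl⟩
  rw [← hE] at hset ⊢
  have hmem : ∀ x, x ∈ E ↔ ∃ N ≤ D, ε < ‖TP c N x‖ := fun x => by rw [hE]; rfl
  have key := per_measure (E := E) (M := 16^n) (K := C * 16^n / (ε / (2 * δ))) ?_ ?_ (by positivity) ?_ a
  · refine key.trans (ENNReal.ofReal_le_ofReal (le_of_eq ?_))
    push_cast
    field_simp; ring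
  · rw [hset]
    exact MeasurableSet.biUnion (Set.to_countable _) fun N _ => (isOpen_lt continuous_const (TP_continuous c N).norm).measurableSet
  · intro x
    simp only [hmem, TP_periodic c _ x]
  · intro x
    rw [le_div_iff₀ hl, mul_comm]
    have h := hn x (ε / (2 * δ)) hl
    refine le_trans (le_of_eq ?_) h
    congr 2
    refine congrArg Finset.card ?_
    ext j
    refine Finset.mem_filter.trans (Iff.trans ?_ Finset.mem_filter.symm)
    refine and_congr_right fun _ => ?_
    simp only [hmem, TP_smul, hnδ]
    refine exists_congr fun N => and_congr_right fun _ => ?_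
    push_cast
    rw [show 2 * (ε / (2 * δ)) = δ⁻¹ * ε by field_simp]
    rw [mul_lt_mul_iff_right₀ (by positivity)]

lemma TP_dense {f : ℝ → ℂ} (hf : Continuous f) (hp : Function.Periodic f (2 * Real.pi)) {η : ℝ} (hη : 0 < η) :
    ∃ (c : ℤ → ℂ) (D : ℕ), (∀ k : ℤ, (D:ℤ) < |k| → c k = 0) ∧ ∀ x, ‖f x - TP c D x‖ ≤ η := by
  have : Fact (0 < 2 * Real.pi) := ⟨by positivity⟩
  let F : C(AddCircle (2 * Real.pi), ℂ) := ⟨hp.lift, continuous_coinduced_dom.mpr hf⟩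
  have hF : F ∈ (Submodule.span ℂ (Set.range <| @fourier (2 * Real.pi))).topologicalClosure := by
    rw [span_fourier_closure_eq_top]; trivial
  have hF' : F ∈ closure ((Submodule.span ℂ (Set.range <| @fourier (2 * Real.pi)) : Submodule ℂ _) : Set C(AddCircle (2 * Real.pi), ℂ)) := hF
  obtain ⟨P, hP, hd⟩ := Metric.mem_closure_iff.1 hF' η hη
  obtain ⟨c, hc⟩ := (Finsupp.mem_span_range_iff_exists_finsupp).1 hP
  obtain ⟨D, hD⟩ : ∃ D : ℕ, ∀ k ∈ c.support, |k| ≤ D := by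
    refine ⟨∑ k ∈ c.support, k.natAbs, fun k hk => ?_⟩
    have := Finset.single_le_sum (f := fun k : ℤ => k.natAbs) (fun _ _ => Nat.zero_le _) hk
    rw [Int.abs_eq_natAbs]; exact_mod_cast this
  refine ⟨c, D, ?_, ?_⟩
  · intro k hk
    by_contra h
    have := hD k (Finsupp.mem_support_iff.2 h)
    omega
  · intro x
    have h1 : P (x : AddCircle (2 * Real.pi)) = TP c D x := by
      rw [← hc, Finsupp.sum_of_support_subset c (s := Icc (-(D:ℤ)) D)]
      · rw [ContinuousMap.sum_apply]
        unfold TP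
        refine Finset.sum_congr rfl fun k _ => ?_
        rw [ContinuousMap.smul_apply, smul_eq_mul, fourier_coe_apply]
        congr 1
        unfold Ex
        congr 1
        have : (Real.pi : ℂ) ≠ 0 := by exact_mod_cast Real.pi_ne_zero
        push_cast
        field_simp
      · intro k hk
        exact mem_Icc.2 (abs_le.1 (hD k hk))
      · simp
    rw [← h1]
    have h2 : f x = F (x : AddCircle (2 * Real.pi)) := rfl
    rw [h2, ← dist_eq_norm]
    exact (ContinuousMap.dist_apply_le_dist _).trans hd.le

/-- Fourier coefficient -/
noncomputable def fc (f : ℝ → ℂ) (k : ℤ) : ℂ := (((2 * Real.pi)⁻¹ : ℝ) : ℂ) * ∫ y in (0:ℝ)..(2 * Real.pi), f y * Ex (-k) y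

lemma pfs_eq (N : ℕ) (f : ℝ → ℂ) (x : ℝ) : partialFourierSum N f x = TP (fc f) N x := by
  unfold partialFourierSum TP fc Ex
  refine Finset.sum_congr rfl fun k _ => ?_
  congr 4
  ext y
  congr 2
  push_cast; ring

lemma fc_sub {f g : ℝ → ℂ} (hf : Continuous f) (hg : Continuous g) (k : ℤ) : fc (fun x => f x - g x) k = fc f k - fc g k := by
  unfold fc
  have h1 : IntervalIntegrable (fun y => f y * Ex (-k) y) volume 0 (2 * Real.pi) := (hf.mul (continuous_Ex (-k))).intervalIntegrable _ _
  have h2 : IntervalIntegrable (fun y => g y * Ex (-k) y) volume 0 (2 * Real.pi) := (hg.mul (continuous_Ex (-k))).intervalIntegrable _ _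
  rw [← mul_sub, ← intervalIntegral.integral_sub h1 h2]
  congr 2; ext y; ring

lemma fc_bound {f : ℝ → ℂ} {η : ℝ} (hf : ∀ x, ‖f x‖ ≤ η) (k : ℤ) : ‖fc f k‖ ≤ η := by
  unfold fc
  have hpi := Real.pi_pos
  have h := intervalIntegral.norm_integral_le_of_norm_le_const (a := 0) (b := 2 * Real.pi) (C := η) (f := fun y => f y * Ex (-k) y)
    (fun y _ => by rw [norm_mul, norm_Ex, mul_one]; exact hf y)
  rw [norm_mul, Complex.norm_real, Real.norm_of_nonneg (by positivity), inv_mul_le_iff₀ (by positivity)]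
  rw [sub_zero, abs_of_pos (by positivity)] at h
  linarith

lemma int_Ex (k : ℤ) : ∫ y in (0:ℝ)..(2 * Real.pi), Ex k y = if k = 0 then ((2 * Real.pi : ℝ) : ℂ) else 0 := by
  by_cases h : k = 0
  · subst h; simp [Ex]
  · rw [if_neg h]
    unfold Ex
    have hc : Complex.I * (k:ℂ) ≠ 0 := mul_ne_zero Complex.I_ne_zero (by exact_mod_cast h)
    rw [integral_exp_mul_complex hc]
    have := Ex_periodic k 0
    unfold Ex at this
    rw [zero_add] at this
    rw [this]; simp

lemma fc_TP (c : ℤ → ℂ) (D : ℕ) (hc : ∀ k : ℤ, (D:ℤ) < |k| → c k = 0) (k : ℤ) : fc (TP c D) k = c k := by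
  unfold fc TP
  have e : ∀ y : ℝ, (∑ m ∈ Icc (-(D:ℤ)) D, c m * Ex m y) * Ex (-k) y = ∑ m ∈ Icc (-(D:ℤ)) D, c m * Ex (m - k) y := by
    intro y
    rw [Finset.sum_mul]
    refine Finset.sum_congr rfl fun m _ => ?_
    rw [mul_assoc]; congr 1
    unfold Ex; rw [← Complex.exp_add]; congr 1; push_cast; ring
  simp_rw [e]
  rw [intervalIntegral.integral_finsetSum (f := fun m y => c m * Ex (m - k) y) (fun m _ => (continuous_const.mul (continuous_Ex _)).intervalIntegrable _ _)]
  simp_rw [intervalIntegral.integral_const_mul, int_Ex]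
  have hpi : ((2 * Real.pi : ℝ) : ℂ) ≠ 0 := by exact_mod_cast (by positivity : 2 * Real.pi ≠ 0)
  by_cases hk : k ∈ Icc (-(D:ℤ)) D
  · rw [Finset.sum_eq_single k]
    · rw [sub_self, if_pos rfl, Complex.ofReal_inv]; field_simp
    · intro m _ hm; rw [if_neg (by omega), mul_zero]
    · intro h; exact absurd hk h
  · rw [Finset.sum_eq_zero, mul_zero, hc k]
    · by_contra h
      exact hk (mem_Icc.2 (abs_le.1 (by omega)))
    · intro m hm
      rw [if_neg, mul_zero]
      intro h
      exact hk (by rwa [show k = m by omega])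

lemma TP_sub (c d : ℤ → ℂ) (N : ℕ) (x : ℝ) : TP (fun k => c k - d k) N x = TP c N x - TP d N x := by
  unfold TP; rw [← Finset.sum_sub_distrib]; exact Finset.sum_congr rfl fun k _ => by ring

lemma TP_bound {c : ℤ → ℂ} {η : ℝ} (hc : ∀ k, ‖c k‖ ≤ η) (N : ℕ) (x : ℝ) : ‖TP c N x‖ ≤ (2 * N + 1) * η := by
  unfold TP
  refine (norm_sum_le _ _).trans ((Finset.sum_le_sum (g := fun _ => η) fun k _ => ?_).trans (le_of_eq ?_))
  · rw [norm_mul, norm_Ex, mul_one]; exact hc k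
  · rw [Finset.sum_const, Int.card_Icc, nsmul_eq_mul]
    congr 1
    rw [show ((N:ℤ) + 1 - -(N:ℤ)).toNat = 2 * N + 1 by omega]; push_cast; ring

lemma TP_stable {c : ℤ → ℂ} {D : ℕ} (hc : ∀ k : ℤ, (D:ℤ) < |k| → c k = 0) {N : ℕ} (hN : D ≤ N) (x : ℝ) : TP c N x = TP c D x := by
  unfold TP
  symm
  refine Finset.sum_subset ?_ ?_
  · intro k hk; rw [mem_Icc] at *; omega
  · intro k _ hk
    rw [hc k, zero_mul]
    by_contra h
    exact hk (mem_Icc.2 (abs_le.1 (by omega)))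


lemma pfs_weak : ∃ C : ℝ, 1 ≤ C ∧ ∀ (h : ℝ → ℂ) (η ε a : ℝ), Continuous h → Function.Periodic h (2 * Real.pi) → 0 < η → η ≤ ε →
    (∀ x, ‖h x‖ ≤ η) → volume (Set.Ioc a (a + 2 * Real.pi) ∩ {x | ∃ N, 2 * ε < ‖partialFourierSum N h x‖}) ≤ ENNReal.ofReal (C * η / ε) := by
  obtain ⟨C, hC, hT⟩ := TP_weak
  refine ⟨2 * C, by linarith, ?_⟩
  intro h η ε a hh hp hη hηε hb
  have hε : 0 < ε := by linarith
  have hset : Set.Ioc a (a + 2 * Real.pi) ∩ {x | ∃ N, 2 * ε < ‖partialFourierSum N h x‖} =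
      ⋃ R : ℕ, Set.Ioc a (a + 2 * Real.pi) ∩ {x | ∃ N ≤ R, 2 * ε < ‖partialFourierSum N h x‖} := by
    rw [← Set.inter_iUnion]; congr 1
    ext x
    simp only [Set.mem_ofPred_eq, Set.mem_iUnion]
    exact ⟨fun ⟨N, hN⟩ => ⟨N, N, le_rfl, hN⟩, fun ⟨_, N, _, hN⟩ => ⟨N, hN⟩⟩
  rw [hset, Monotone.measure_iUnion]
  · refine iSup_le fun R => ?_
    have hR : (0:ℝ) < 2 * R + 1 := by positivity
    obtain ⟨c, D, hc, happ⟩ := TP_dense hh hp (η := η / (2 * R + 1)) (by positivity)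
    have hle : η / (2 * R + 1) ≤ η := div_le_self hη.le (by have : (0:ℝ) ≤ R := by positivity
                                                            linarith)
    have h1 := hT c D (2 * η) ε a (by positivity) hε (by
      intro x
      have := norm_sub_le (h x) (h x - TP c D x)
      rw [sub_sub_cancel] at this
      linarith [hb x, happ x])
    refine (measure_mono ?_).trans (h1.trans (ENNReal.ofReal_le_ofReal (le_of_eq (by ring))))
    refine Set.inter_subset_inter_right _ ?_
    rintro x ⟨N, hN, hlt⟩
    have e1 : partialFourierSum N h x - TP c N x = TP (fc (fun y => h y - TP c D y)) N x := by
      rw [pfs_eq, ← TP_sub]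
      congr 1
      ext k
      rw [fc_sub hh (TP_continuous c D), fc_TP c D hc]
    have e2 : ‖partialFourierSum N h x - TP c N x‖ ≤ η := by
      rw [e1]
      refine (TP_bound (fc_bound happ) N x).trans ?_
      rw [mul_div_assoc', div_le_iff₀ hR, mul_comm]
      have : (N:ℝ) ≤ R := by exact_mod_cast hN
      gcongr
    have e3 : ε < ‖TP c N x‖ := by
      have := norm_sub_norm_le (partialFourierSum N h x) (TP c N x)
      linarith
    by_cases hND : N ≤ D
    · exact ⟨N, hND, e3⟩
    · exact ⟨D, le_rfl, by rwa [TP_stable hc (by omega : D ≤ N)] at e3⟩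
  · intro R R' hRR
    refine Set.inter_subset_inter_right _ ?_
    rintro x ⟨N, hN, hlt⟩
    exact ⟨N, hN.trans hRR, hlt⟩

lemma ae_Ioc {f : ℝ → ℂ} (hf : Continuous f) (hp : Function.Periodic f (2 * Real.pi)) (a ε : ℝ) (hε : 0 < ε) :
    volume (Set.Ioc a (a + 2 * Real.pi) ∩ {x | ¬ ∃ N0 : ℕ, ∀ N ≥ N0, ‖partialFourierSum N f x - f x‖ ≤ 3 * ε}) = 0 := by
  obtain ⟨C, hC, hT⟩ := pfs_weak
  refine le_antisymm (ENNReal.le_of_forall_pos_le_add fun δ hδ _ => ?_) bot_le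
  have hδ' : (0:ℝ) < δ := hδ
  set η := min ε (δ * ε / C) with hηd
  have hη : 0 < η := lt_min hε (by positivity)
  obtain ⟨c, D, hc, happ⟩ := TP_dense hf hp hη
  have h1 := hT (fun x => f x - TP c D x) η ε a (hf.sub (TP_continuous c D)) (hp.sub (TP_periodic c D)) hη (min_le_left _ _) happ
  rw [zero_add]
  refine (measure_mono ?_).trans (h1.trans ?_)
  · refine Set.inter_subset_inter_right _ ?_
    intro x hx
    simp only [Set.mem_ofPred_eq] at hx ⊢
    by_contra hcon
    push Not at hcon
    refine hx ⟨D, fun N hN => ?_⟩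
    have e1 : partialFourierSum N (fun x => f x - TP c D x) x = partialFourierSum N f x - TP c D x := by
      rw [pfs_eq, pfs_eq, ← TP_stable hc hN, ← TP_sub]
      congr 1
      ext k
      rw [fc_sub hf (TP_continuous c D), fc_TP c D hc]
    have e2 := hcon N
    rw [e1] at e2
    have e3 := norm_sub_le (partialFourierSum N f x - TP c D x) (f x - TP c D x)
    rw [sub_sub_sub_cancel_right] at e3
    linarith [happ x, min_le_left ε (δ * ε / C)]
  · rw [← ENNReal.ofReal_coe_nnreal]
    refine ENNReal.ofReal_le_ofReal ?_
    rw [div_le_iff₀ hε]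
    have := min_le_right ε (δ * ε / C)
    rw [← hηd, le_div_iff₀ (by linarith)] at this
    linarith

lemma ae_conv {f : ℝ → ℂ} (hf : Continuous f) (hp : Function.Periodic f (2 * Real.pi)) :
    ∀ᵐ x : ℝ, Tendsto (fun N : ℕ => partialFourierSum N f x) atTop (nhds (f x)) := by
  have hpi := Real.pi_pos
  have h1 : ∀ m : ℕ, ∀ᵐ x : ℝ, ∃ N0 : ℕ, ∀ N ≥ N0, ‖partialFourierSum N f x - f x‖ ≤ 3 * (1 / ((m:ℝ) + 1)) := by
    intro m
    rw [ae_iff]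
    set B := {x | ¬ ∃ N0 : ℕ, ∀ N ≥ N0, ‖partialFourierSum N f x - f x‖ ≤ 3 * (1 / ((m:ℝ) + 1))} with hB
    have hsub : B ⊆ ⋃ k : ℤ, Set.Ioc (0 + k • (2 * Real.pi)) (0 + k • (2 * Real.pi) + 2 * Real.pi) ∩ B := by
      intro x hx
      have hu : x ∈ ⋃ k : ℤ, Set.Ioc (0 + k • (2 * Real.pi)) (0 + (k + 1) • (2 * Real.pi)) := by
        rw [iUnion_Ioc_add_zsmul (by positivity)]; trivial
      rw [Set.mem_iUnion] at hu ⊢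
      obtain ⟨k, hk⟩ := hu
      refine ⟨k, ?_, hx⟩
      rwa [add_smul, one_smul, ← add_assoc] at hk
    refine measure_mono_null hsub (measure_iUnion_null fun k => ?_)
    exact ae_Ioc hf hp _ _ (by positivity)
  filter_upwards [ae_all_iff.2 h1] with x hx
  rw [Metric.tendsto_atTop]
  intro ε hε
  obtain ⟨m, hm⟩ := exists_nat_one_div_lt (show 0 < ε / 3 by positivity)
  obtain ⟨N0, hN0⟩ := hx m
  refine ⟨N0, fun N hN => ?_⟩
  rw [dist_eq_norm]
  linarith [hN0 N hN]

end Carl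

/-- **Classical Carleson theorem**: the partial Fourier sums of a `2π`-periodic continuous
function converge to the function almost everywhere. -/
theorem classical_carleson {f : ℝ → ℂ} (cont_f : Continuous f)
    (periodic_f : Function.Periodic f (2 * π)) :
    ∀ᵐ x : ℝ, Tendsto (fun N : ℕ => partialFourierSum N f x) atTop (nhds (f x)) := by
  exact Carl.ae_conv cont_f periodic_f
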